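/- Let P be a simple polygon and let C be a nonredundant cut of P with endpoints v_C and w_C, generated by the edge u_C v_C. Then the vertices u_C and w_C are convex vertices of the polygon Pocket(C), and all vertices of Pocket(C) lie on the same side of the line through u_C and w_C. -/

import Mathlib

open Set

noncomputable section

/-- The Euclidean plane. -/
abbrev E2 := EuclideanSpace ℝ (Fin 2)

/-- A simple polygon in the plane, given by its cyclic sequence of vertices.
Adjacent edges meet exactly at their common vertex, and non-adjacent edges
are disjoint, so the boundary is a simple closed polygonal curve. -/
structure SimplePolygon where
  n : ℕ
  three_le : 3 ≤ n
  vtx : ZMod n → E2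
  inj : Function.Injective vtx
  adj_edges : ∀ i : ZMod n,
    segment ℝ (vtx i) (vtx (i + 1)) ∩ segment ℝ (vtx (i + 1)) (vtx (i + 2)) = {vtx (i + 1)}
  nonadj_edges : ∀ i j : ZMod n, i ≠ j → i + 1 ≠ j → j + 1 ≠ i →
    segment ℝ (vtx i) (vtx (i + 1)) ∩ segment ℝ (vtx j) (vtx (j + 1)) = ∅

namespace SimplePolygon

variable (P : SimplePolygon)

/-- The boundary `∂P`: the union of the edges. -/
def boundary : Set E2 := ⋃ i : ZMod P.n, segment ℝ (P.vtx i) (P.vtx (i + 1))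

/-- The compact region bounded by `∂P`: the boundary together with all points of the
bounded connected components of its complement. -/
def region : Set E2 :=
  P.boundary ∪ {x | x ∉ P.boundary ∧ Bornology.IsBounded (connectedComponentIn P.boundaryᶜ x)}

/-- `x` sees `y` (in `P`) if the closed segment `[x,y]` is contained in `P`. -/
def Visible (x y : E2) : Prop := segment ℝ x y ⊆ P.region

/-- The vertex `vtx i` is reflex: its internal angle is strictly larger than `π`, i.e.
near the vertex the midpoint of two points at equal small parameter along the two
incident edges lies outside the region. -/
def IsReflex (i : ZMod P.n) : Prop :=
  ∃ ε₀ > (0 : ℝ), ∀ ε ∈ Set.Ioo (0 : ℝ) ε₀,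
    midpoint ℝ (P.vtx i + ε • (P.vtx (i - 1) - P.vtx i))
               (P.vtx i + ε • (P.vtx (i + 1) - P.vtx i)) ∉ P.region

/-- `P` is star-shaped if a single point of `P` sees all of `P`. -/
def IsStarShaped : Prop := ∃ x ∈ P.region, ∀ y ∈ P.region, P.Visible x y

/-- A visibility path: a connected curve inside `P` from which every point of `P`
is visible. -/
def IsVisibilityPath (Pth : Set E2) : Prop :=
  IsConnected Pth ∧ Pth ⊆ P.region ∧ ∀ x ∈ P.region, ∃ p ∈ Pth, P.Visible x p

/-- The pocket, inside `P`, determined by a cut segment `s` on the side of the point `u`: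
the closure of the connected component of `P \ s` containing `u`, together with `s`. -/
def pocketOfSeg (s : Set E2) (u : E2) : Set E2 :=
  closure (connectedComponentIn (P.region \ s) u) ∪ s

end SimplePolygon

/-- A cut of a simple polygon `P`: for a reflex vertex `v = vtx i` with adjacent
vertex `u = vtx j`, the segment from `v` to the closest point `w` of `∂P` hit by
the ray from `v` in the direction from `u` to `v`. -/
structure SimplePolygon.Cut (P : SimplePolygon) where
  i : ZMod P.n
  j : ZMod P.n
  adj : j = i + 1 ∨ j = i - 1
  reflex : P.IsReflex i
  t : ℝ
  t_pos : 0 < t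
  hits : P.vtx i + t • (P.vtx i - P.vtx j) ∈ P.boundary
  first_hit : ∀ s ∈ Set.Ioo (0 : ℝ) t, P.vtx i + s • (P.vtx i - P.vtx j) ∉ P.boundary
  inside : segment ℝ (P.vtx i) (P.vtx i + t • (P.vtx i - P.vtx j)) ⊆ P.region

namespace SimplePolygon.Cut

variable {P : SimplePolygon} (C : P.Cut)

/-- The reflex vertex generating the cut. -/
def v : E2 := P.vtx C.i

/-- The adjacent vertex `u`; the edge `u v` is the generator of the cut. -/
def u : E2 := P.vtx C.j

/-- The other endpoint of the cut, on `∂P`. -/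
def w : E2 := P.vtx C.i + C.t • (P.vtx C.i - P.vtx C.j)

/-- The cut as a segment. -/
def seg : Set E2 := segment ℝ C.v C.w

/-- `Pocket(C)`: the part of `P` cut off by `C` that contains the generator vertex `u`. -/
def pocket : Set E2 := P.pocketOfSeg C.seg C.u

/-- A cut is redundant if the pocket of some cut is strictly contained in its pocket. -/
def Redundant : Prop := ∃ C' : P.Cut, C'.pocket ⊂ C.pocket

/-- A nonredundant (essential) cut. -/
def Nonredundant : Prop := ¬ C.Redundant

/-- `x` is a vertex of the polygon `Pocket(C)`: either the endpoint `w` of the cut, or a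
vertex of `P` belonging to the pocket. -/
def PocketVertex (x : E2) : Prop :=
  x = C.w ∨ ∃ k : ZMod P.n, P.vtx k = x ∧ x ∈ C.pocket

end SimplePolygon.Cut

/-- Length of a polygonal path given by its list of vertices. -/
def polyLength (l : List E2) : ℝ := ((l.zip l.tail).map fun p => dist p.1 p.2).sum

namespace SimplePolygon

variable (P : SimplePolygon)

/-- A polygonal path inside `P`: a nonempty list of points with each consecutive
segment contained in `P`. -/
def IsPolyPathIn (l : List E2) : Prop :=
  l ≠ [] ∧ List.Chain' (fun a b => segment ℝ a b ⊆ P.region) l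

/-- `l` is a shortest Euclidean (polygonal) path inside `P` from `x` to the set `S`. -/
def IsGeodesicTo (x : E2) (S : Set E2) (l : List E2) : Prop :=
  P.IsPolyPathIn l ∧ l.head? = some x ∧ (∃ y ∈ S, l.getLast? = some y) ∧
  ∀ m : List E2, P.IsPolyPathIn m → m.head? = some x →
    (∃ y ∈ S, m.getLast? = some y) → polyLength l ≤ polyLength m

/-- The subpolygon `Q` of `P` obtained by cutting `P` along all nonredundant cuts:
the closure of `P` minus the union of the pockets of all nonredundant cuts. -/
def core : Set E2 :=
  closure (P.region \ ⋃ C : {C : P.Cut // C.Nonredundant}, (C : P.Cut).pocket)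

end SimplePolygon

/-- The planar cross product. -/
def cross2 (a b : E2) : ℝ := a 0 * b 1 - a 1 * b 0

/-- A polygonal chain all of whose turns have the sign `s` (a convex chain bending
consistently to one side). -/
def ConvexChain (s : ℝ) (l : List E2) : Prop :=
  ∀ p q r : E2, [p, q, r] <:+: l → 0 ≤ s * cross2 (q - p) (r - q)

/-! ### The plane: cross product and sectors -/

theorem cross2_add_left (a b c : E2) : cross2 (a + b) c = cross2 a c + cross2 b c := by
  simp [cross2]; ring

theorem cross2_add_right (a b c : E2) : cross2 a (b + c) = cross2 a b + cross2 a c := by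
  simp [cross2]; ring

theorem cross2_sub_left (a b c : E2) : cross2 (a - b) c = cross2 a c - cross2 b c := by
  simp [cross2]; ring

theorem cross2_sub_right (a b c : E2) : cross2 a (b - c) = cross2 a b - cross2 a c := by
  simp [cross2]; ring

theorem cross2_smul_left (t : ℝ) (a b : E2) : cross2 (t • a) b = t * cross2 a b := by
  simp [cross2]; ring

theorem cross2_smul_right (t : ℝ) (a b : E2) : cross2 a (t • b) = t * cross2 a b := by
  simp [cross2]; ring

theorem cross2_neg_left (a b : E2) : cross2 (-a) b = -cross2 a b := by
  simp [cross2]; ring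

theorem cross2_neg_right (a b : E2) : cross2 a (-b) = -cross2 a b := by
  simp [cross2]; ring

theorem cross2_self (a : E2) : cross2 a a = 0 := by
  simp [cross2]; ring

theorem cross2_comm (a b : E2) : cross2 a b = -cross2 b a := by
  simp [cross2]; ring

theorem cross2_zero_left (a : E2) : cross2 0 a = 0 := by simp [cross2]

theorem cross2_zero_right (a : E2) : cross2 a 0 = 0 := by simp [cross2]

theorem continuous_cross2_right (a : E2) : Continuous fun y => cross2 a y := by
  unfold cross2; fun_prop

theorem continuous_cross2_left (a : E2) : Continuous fun y => cross2 y a := by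
  unfold cross2; fun_prop

theorem sq_add_sq_pos_of_ne_zero {a : E2} (ha : a ≠ 0) : 0 < a 0 ^ 2 + a 1 ^ 2 := by
  by_contra h
  apply ha
  have h0 : a 0 = 0 := by nlinarith [sq_nonneg (a 0), sq_nonneg (a 1)]
  have h1 : a 1 = 0 := by nlinarith [sq_nonneg (a 0), sq_nonneg (a 1)]
  ext i; fin_cases i <;> simp [h0, h1]

/-- The vector `a` rotated by a right angle. -/
def perp (a : E2) : E2 := !₂[-a 1, a 0]

theorem cross2_perp (a : E2) : cross2 a (perp a) = a 0 ^ 2 + a 1 ^ 2 := by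
  simp [cross2, perp]; ring

theorem exists_smul_of_cross2_eq_zero {a b : E2} (ha : a ≠ 0) (h : cross2 a b = 0) :
    ∃ c : ℝ, b = c • a := by
  have hp := sq_add_sq_pos_of_ne_zero ha
  refine ⟨(a 0 * b 0 + a 1 * b 1) / (a 0 ^ 2 + a 1 ^ 2), ?_⟩
  simp only [cross2] at h
  ext i
  fin_cases i
  · simp; field_simp; linear_combination (-a 1) * h
  · simp; field_simp; linear_combination (a 0) * h

/-- The open sector at `x` swept counterclockwise from `d₁` to `d₂`, for an angle at most `π`. -/
def smallSector (x d₁ d₂ : E2) : Set E2 := {y | 0 < cross2 d₁ (y - x) ∧ 0 < cross2 (y - x) d₂}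

/-- The open sector at `x` complementary to `smallSector x d₁ d₂`. -/
def largeSector (x d₁ d₂ : E2) : Set E2 := {y | cross2 d₁ (y - x) < 0 ∨ cross2 (y - x) d₂ < 0}

theorem convex_cross2_pos (d x : E2) : Convex ℝ {y | 0 < cross2 d (y - x)} := by
  intro y hy z hz a b ha hb hab
  simp only [mem_ofPred_eq] at *
  have : cross2 d (a • y + b • z - x) = a * cross2 d (y - x) + b * cross2 d (z - x) := by
    rw [cross2_sub_right, cross2_sub_right, cross2_sub_right, cross2_add_right, cross2_smul_right,
      cross2_smul_right]
    linear_combination (cross2 d x) * hab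
  rw [this]
  rcases ha.eq_or_lt with rfl | ha
  · have : b = 1 := by linarith
    subst this; simpa using hz
  · have := mul_pos ha hy
    have := mul_nonneg hb hz.le
    linarith

theorem convex_cross2_neg (d x : E2) : Convex ℝ {y | cross2 d (y - x) < 0} := by
  have := convex_cross2_pos (-d) x
  simpa [cross2_neg_left] using this

theorem convex_cross2_pos_left (d x : E2) : Convex ℝ {y | 0 < cross2 (y - x) d} := by
  have := convex_cross2_pos (-d) x
  simpa [cross2_neg_left, ← cross2_comm] using this

theorem convex_cross2_neg_left (d x : E2) : Convex ℝ {y | cross2 (y - x) d < 0} := by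
  have := convex_cross2_pos d x
  simp only [cross2_comm d, Left.neg_pos_iff] at this
  exact this

theorem convex_smallSector (x d₁ d₂ : E2) : Convex ℝ (smallSector x d₁ d₂) :=
  (convex_cross2_pos d₁ x).inter (convex_cross2_pos_left d₂ x)

theorem isPreconnected_smallSector_inter_ball (x d₁ d₂ : E2) (ρ : ℝ) :
    IsPreconnected (smallSector x d₁ d₂ ∩ Metric.ball x ρ) :=
  ((convex_smallSector x d₁ d₂).inter (convex_ball x ρ)).isPreconnected

theorem exists_small_smul_mem_ball (x q : E2) {ρ : ℝ} (hρ : 0 < ρ) :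
    ∃ ε₀ > (0 : ℝ), ∀ ε ∈ Ioo (0 : ℝ) ε₀, x + ε • q ∈ Metric.ball x ρ := by
  refine ⟨ρ / (‖q‖ + 1), by positivity, fun ε hε => ?_⟩
  rw [mem_ball_iff_norm, add_sub_cancel_left, norm_smul, Real.norm_of_nonneg hε.1.le]
  have h1 : 0 < ‖q‖ + 1 := by positivity
  have := (lt_div_iff₀ h1).1 hε.2
  nlinarith [hε.1]

theorem isPreconnected_largeSector_inter_ball (x d₁ d₂ q : E2) {ρ : ℝ} (hρ : 0 < ρ)
    (h1 : 0 < cross2 d₁ q) (h2 : 0 < cross2 q d₂) :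
    IsPreconnected (largeSector x d₁ d₂ ∩ Metric.ball x ρ) := by
  have : largeSector x d₁ d₂ ∩ Metric.ball x ρ =
      ({y | cross2 d₁ (y - x) < 0} ∩ Metric.ball x ρ) ∪
      ({y | cross2 (y - x) d₂ < 0} ∩ Metric.ball x ρ) := by
    rw [← union_inter_distrib_right]; rfl
  rw [this]
  obtain ⟨ε₀, hε₀, H⟩ := exists_small_smul_mem_ball x (-q) hρ
  have hm := H (ε₀ / 2) ⟨by linarith, by linarith⟩
  have hε : 0 < ε₀ / 2 := by linarith
  refine IsPreconnected.union (x + (ε₀ / 2) • (-q)) ⟨?_, hm⟩ ⟨?_, hm⟩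
    (((convex_cross2_neg d₁ x).inter (convex_ball x ρ)).isPreconnected)
    (((convex_cross2_neg_left d₂ x).inter (convex_ball x ρ)).isPreconnected)
  · simp only [mem_ofPred_eq, add_sub_cancel_left, cross2_smul_right, cross2_neg_right]
    nlinarith
  · simp only [mem_ofPred_eq, add_sub_cancel_left, cross2_smul_left, cross2_neg_left]
    nlinarith

/-- The data describing two distinct rays from a point in directions `d₁` and `d₂`, where `q` points
into the sector of angle at most `π` swept from `d₁` to `d₂`. -/
structure Wedge (d₁ d₂ q : E2) : Prop where
  nonneg : 0 ≤ cross2 d₁ d₂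
  left : 0 < cross2 d₁ q
  right : 0 < cross2 q d₂

namespace Wedge

variable {d₁ d₂ q : E2}

theorem ne_zero_left (h : Wedge d₁ d₂ q) : d₁ ≠ 0 := by
  rintro rfl; simpa [cross2_zero_left] using h.left

theorem ne_zero_right (h : Wedge d₁ d₂ q) : d₂ ≠ 0 := by
  rintro rfl; simpa [cross2_zero_right] using h.right

theorem trichotomy (h : Wedge d₁ d₂ q) (x y : E2) :
    y ∈ smallSector x d₁ d₂ ∨ y ∈ largeSector x d₁ d₂ ∨
      ∃ c : ℝ, 0 ≤ c ∧ (y = x + c • d₁ ∨ y = x + c • d₂) := by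
  by_cases h1 : y ∈ smallSector x d₁ d₂
  · exact Or.inl h1
  by_cases h2 : y ∈ largeSector x d₁ d₂
  · exact Or.inr (Or.inl h2)
  right; right
  simp only [smallSector, largeSector, mem_ofPred_eq, not_and_or, not_or, not_lt] at h1 h2
  have hpos : 0 < cross2 d₁ d₂ ∨ ∃ m : ℝ, 0 < m ∧ d₂ = -(m • d₁) := by
    rcases h.nonneg.lt_or_eq with h' | h'
    · exact Or.inl h'
    · right
      obtain ⟨m, hm⟩ := exists_smul_of_cross2_eq_zero h.ne_zero_left h'.symm
      refine ⟨-m, ?_, by rw [hm]; simp⟩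
      have h3 := h.right
      have h4 := h.left
      rw [hm, cross2_smul_right, cross2_comm] at h3
      by_contra hcon
      nlinarith
  rcases h1 with h1 | h1
  · have h0 : cross2 d₁ (y - x) = 0 := le_antisymm h1 h2.1
    obtain ⟨c, hc⟩ := exists_smul_of_cross2_eq_zero h.ne_zero_left h0
    have hy : y = x + c • d₁ := by rw [← hc]; simp
    by_cases hc0 : 0 ≤ c
    · exact ⟨c, hc0, Or.inl hy⟩
    · rcases hpos with hp | ⟨m, hm, hd⟩
      · have := h2.2
        rw [hc, cross2_smul_left] at this
        exfalso; nlinarith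
      · refine ⟨-c / m, div_nonneg (by linarith) hm.le, Or.inr ?_⟩
        rw [hy, hd, smul_neg, smul_smul, ← neg_smul]
        congr 2; field_simp
  · have h0 : cross2 d₂ (y - x) = 0 := by
      rw [cross2_comm]; linarith [le_antisymm h1 h2.2]
    obtain ⟨c, hc⟩ := exists_smul_of_cross2_eq_zero h.ne_zero_right h0
    have hy : y = x + c • d₂ := by rw [← hc]; simp
    by_cases hc0 : 0 ≤ c
    · exact ⟨c, hc0, Or.inr hy⟩
    · rcases hpos with hp | ⟨m, hm, hd⟩
      · have := h2.1
        rw [hc, cross2_smul_right] at this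
        exfalso; nlinarith
      · refine ⟨-c * m, mul_nonneg (by linarith) hm.le, Or.inl ?_⟩
        rw [hy, hd, smul_neg, smul_smul, ← neg_smul]
        congr 2; ring

theorem not_mem_sectors (h : Wedge d₁ d₂ q) (x : E2) {c : ℝ} (hc : 0 ≤ c) {y : E2}
    (hy : y = x + c • d₁ ∨ y = x + c • d₂) :
    y ∉ smallSector x d₁ d₂ ∧ y ∉ largeSector x d₁ d₂ := by
  have := mul_nonneg hc h.nonneg
  rcases hy with rfl | rfl <;>
  · simp [smallSector, largeSector, cross2_smul_left, cross2_smul_right, cross2_self, this]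

theorem add_smul_mem_smallSector (h : Wedge d₁ d₂ q) (x : E2) {c : ℝ} (hc : 0 ≤ c) {y : E2}
    (hy : y = x + c • d₁ ∨ y = x + c • d₂) {ε : ℝ} (hε : 0 < ε) :
    y + ε • q ∈ smallSector x d₁ d₂ := by
  have h0 := mul_nonneg hc h.nonneg
  have h1 := mul_pos hε h.left
  have h2 := mul_pos hε h.right
  rcases hy with rfl | rfl <;>
  · constructor <;>
    · simp only [add_assoc, add_sub_cancel_left, cross2_add_left, cross2_add_right,
        cross2_smul_left, cross2_smul_right, cross2_self]
      linarith

theorem sub_smul_mem_largeSector (h : Wedge d₁ d₂ q) (x : E2) {c : ℝ} {y : E2}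
    (hy : y = x + c • d₁ ∨ y = x + c • d₂) {ε : ℝ} (hε : 0 < ε) :
    y - ε • q ∈ largeSector x d₁ d₂ := by
  have h1 := mul_pos hε h.left
  have h2 := mul_pos hε h.right
  rcases hy with rfl | rfl
  · left
    rw [show x + c • d₁ - ε • q - x = c • d₁ - ε • q by abel, cross2_sub_right, cross2_smul_right,
      cross2_smul_right, cross2_self]
    linarith
  · right
    rw [show x + c • d₂ - ε • q - x = c • d₂ - ε • q by abel, cross2_sub_left, cross2_smul_left,
      cross2_smul_left, cross2_self]
    linarith

end Wedge

/-- Two nonzero vectors that do not point in the same direction bound a wedge, in one order or the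
other. -/
theorem exists_wedge {a b : E2} (ha : a ≠ 0) (hb : b ≠ 0) (h : ∀ c : ℝ, 0 < c → b ≠ c • a) :
    ∃ q, Wedge a b q ∨ Wedge b a q := by
  rcases lt_trichotomy (cross2 a b) 0 with h0 | h0 | h0
  · rw [cross2_comm, neg_lt_zero] at h0
    refine ⟨a + b, Or.inr ⟨h0.le, ?_, ?_⟩⟩ <;>
    simpa [cross2_add_left, cross2_add_right, cross2_self] using h0
  · obtain ⟨c, rfl⟩ := exists_smul_of_cross2_eq_zero ha h0
    have hc : c < 0 := by
      by_contra hc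
      rcases (not_lt.1 hc).eq_or_lt with rfl | hc
      · simp at hb
      · exact h c hc rfl
    have hp := sq_add_sq_pos_of_ne_zero ha
    refine ⟨perp a, Or.inl ⟨h0.ge, ?_, ?_⟩⟩
    · rwa [cross2_perp]
    · rw [cross2_comm, cross2_smul_left, cross2_perp]; nlinarith
  · refine ⟨a + b, Or.inl ⟨h0.le, ?_, ?_⟩⟩ <;>
    simpa [cross2_add_left, cross2_add_right, cross2_self] using h0

/-! ### Winding of closed polygonal curves -/

/-- The plane as complex numbers. -/
def toComplex (x : E2) : ℂ := ⟨x 0, x 1⟩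

theorem toComplex_ne_zero {x : E2} (hx : x ≠ 0) : toComplex x ≠ 0 := by
  intro h
  apply hx
  have h0 := congrArg Complex.re h
  have h1 := congrArg Complex.im h
  simp only [toComplex, Complex.zero_re, Complex.zero_im] at h0 h1
  ext i; fin_cases i <;> simp [h0, h1]

theorem continuous_toComplex : Continuous toComplex := by
  have : toComplex = fun x : E2 => ((x 0 : ℝ) : ℂ) + ((x 1 : ℝ) : ℂ) * Complex.I := by
    funext x; apply Complex.ext <;> simp [toComplex]
  rw [this]
  fun_prop

/-- The signed angle under which the segment from `a` to `b` is seen from `x`. -/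
def viewAngle (a b x : E2) : ℝ :=
  Complex.arg (toComplex (b - x) * (starRingEnd ℂ) (toComplex (a - x)))

theorem viewAngle_re (a b x : E2) :
    (toComplex (b - x) * (starRingEnd ℂ) (toComplex (a - x))).re =
      (a 0 - x 0) * (b 0 - x 0) + (a 1 - x 1) * (b 1 - x 1) := by
  simp [toComplex]; ring

theorem viewAngle_im (a b x : E2) :
    (toComplex (b - x) * (starRingEnd ℂ) (toComplex (a - x))).im = cross2 (a - x) (b - x) := by
  simp [toComplex, cross2]; ring

theorem viewAngle_mem_slitPlane {a b x : E2} (hx : x ∉ segment ℝ a b) :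
    toComplex (b - x) * (starRingEnd ℂ) (toComplex (a - x)) ∈ Complex.slitPlane := by
  rw [Complex.mem_slitPlane_iff, viewAngle_re, viewAngle_im]
  by_contra hcon
  simp only [not_or, not_lt, not_not] at hcon
  obtain ⟨hre, him⟩ := hcon
  apply hx
  by_cases hax : a - x = 0
  · rw [sub_eq_zero] at hax; rw [hax]; exact left_mem_segment ℝ _ _
  obtain ⟨c, hc⟩ := exists_smul_of_cross2_eq_zero hax him
  have h0 : b 0 - x 0 = c * (a 0 - x 0) := by simpa using congrArg (fun z : E2 => z 0) hc
  have h1 : b 1 - x 1 = c * (a 1 - x 1) := by simpa using congrArg (fun z : E2 => z 1) hc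
  have hp := sq_add_sq_pos_of_ne_zero hax
  simp only [PiLp.sub_apply] at hp
  rw [h0, h1] at hre
  have hc0 : c ≤ 0 := by
    by_contra hcon
    nlinarith
  refine ⟨-c / (1 - c), 1 / (1 - c), div_nonneg (by linarith) (by linarith),
    div_nonneg (by linarith) (by linarith), ?_, ?_⟩
  · have : 1 - c ≠ 0 := by linarith
    field_simp; ring
  · have : 1 - c ≠ 0 := by linarith
    ext i
    fin_cases i
    · simp; field_simp; linear_combination h0
    · simp; field_simp; linear_combination h1

theorem continuousAt_viewAngle {a b x : E2} (hx : x ∉ segment ℝ a b) :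
    ContinuousAt (viewAngle a b) x := by
  unfold viewAngle
  refine ContinuousAt.comp (f := fun x => toComplex (b - x) * (starRingEnd ℂ) (toComplex (a - x)))
    (Complex.continuousAt_arg (viewAngle_mem_slitPlane hx)) ?_
  have := continuous_toComplex
  fun_prop

theorem viewAngle_swap {a b x : E2} (hx : x ∉ segment ℝ a b) :
    viewAngle b a x = -viewAngle a b x := by
  have h := Complex.arg_conj (toComplex (b - x) * (starRingEnd ℂ) (toComplex (a - x)))
  rw [if_neg (Complex.mem_slitPlane_iff_arg.1 (viewAngle_mem_slitPlane hx)).1, map_mul,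
    Complex.conj_conj, mul_comm] at h
  exact h

/-- The total angle swept by the polygonal curve `h 0, …, h M`, seen from `x`. -/
def sweep (h : ℕ → E2) (M : ℕ) (x : E2) : ℝ :=
  ∑ i ∈ Finset.range M, viewAngle (h i) (h (i + 1)) x

theorem viewAngle_coe_angle {a b x : E2} (ha : a ≠ x) (hb : b ≠ x) :
    ((viewAngle a b x : ℝ) : Real.Angle) =
      (Complex.arg (toComplex (b - x)) : Real.Angle) - (Complex.arg (toComplex (a - x))) := by
  have h1 := toComplex_ne_zero (sub_ne_zero.2 ha)
  have h2 := toComplex_ne_zero (sub_ne_zero.2 hb)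
  rw [viewAngle, Complex.arg_mul_coe_angle h2 ((map_ne_zero _).2 h1), Complex.arg_conj_coe_angle,
    ← sub_eq_add_neg]

theorem exists_sweep_eq_int_mul {h : ℕ → E2} {M : ℕ} (hM : h M = h 0) {x : E2}
    (hx : ∀ i ≤ M, h i ≠ x) : ∃ k : ℤ, sweep h M x = 2 * Real.pi * k := by
  have key : ((sweep h M x : ℝ) : Real.Angle) = 0 := by
    have : ∀ m ≤ M, ((sweep h m x : ℝ) : Real.Angle) =
        (Complex.arg (toComplex (h m - x)) : Real.Angle) - (Complex.arg (toComplex (h 0 - x))) := by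
      intro m hm
      induction m with
      | zero => simp [sweep]
      | succ m ih =>
        have : sweep h (m + 1) x = sweep h m x + viewAngle (h m) (h (m + 1)) x :=
          Finset.sum_range_succ _ _
        rw [this, Real.Angle.coe_add, ih (by omega),
          viewAngle_coe_angle (hx m (by omega)) (hx (m + 1) hm)]
        abel
    rw [this M le_rfl, hM, sub_self]
  rw [← Real.Angle.coe_zero, Real.Angle.angle_eq_iff_two_pi_dvd_sub] at key
  simpa using key

theorem viewAngle_eq_sub_of_halfPlane {a b x e : E2} (ha : 0 < cross2 e (a - x))
    (hb : 0 < cross2 e (b - x)) :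
    viewAngle a b x = Complex.arg (toComplex (b - x) * ⟨-e 1, -e 0⟩) -
      Complex.arg (toComplex (a - x) * ⟨-e 1, -e 0⟩) := by
  set c : ℂ := ⟨-e 1, -e 0⟩ with hc
  set z := toComplex (a - x) with hz
  set w := toComplex (b - x) with hw
  have hzre : 0 < (z * c).re := by
    have : (z * c).re = cross2 e (a - x) := by
      simp [hz, hc, toComplex, cross2]; ring
    rwa [this]
  have hwre : 0 < (w * c).re := by
    have : (w * c).re = cross2 e (b - x) := by
      simp [hw, hc, toComplex, cross2]; ring
    rwa [this]
  have hc0 : c ≠ 0 := by rintro h; simp [h] at hzre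
  have hz0 : z * c ≠ 0 := by rintro h; simp [h] at hzre
  have hw0 : w * c ≠ 0 := by rintro h; simp [h] at hwre
  have h1 : w * c * (starRingEnd ℂ) (z * c) =
      ((Complex.normSq c : ℝ) : ℂ) * (w * (starRingEnd ℂ) z) := by
    rw [map_mul, Complex.normSq_eq_conj_mul_self]; ring
  have h2 : viewAngle a b x = Complex.arg (w * c * (starRingEnd ℂ) (z * c)) := by
    rw [h1, Complex.arg_real_mul _ (Complex.normSq_pos.2 hc0)]; rfl
  have hza := Complex.abs_arg_lt_pi_div_two_iff.2 (Or.inl hzre)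
  have hwa := Complex.abs_arg_lt_pi_div_two_iff.2 (Or.inl hwre)
  rw [abs_lt] at hza hwa
  have h3 : Complex.arg ((starRingEnd ℂ) (z * c)) = -Complex.arg (z * c) := by
    rw [Complex.arg_conj, if_neg]
    have := Real.pi_pos
    linarith
  rw [h2, Complex.arg_mul hw0 ((map_ne_zero _).2 hz0), h3]
  · ring
  · rw [h3]; constructor <;> linarith

theorem sweep_eq_zero_of_halfPlane {h : ℕ → E2} {M : ℕ} (hM : h M = h 0) {x e : E2}
    (hx : ∀ i ≤ M, 0 < cross2 e (h i - x)) : sweep h M x = 0 := by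
  have : ∀ m ≤ M, sweep h m x = Complex.arg (toComplex (h m - x) * ⟨-e 1, -e 0⟩) -
      Complex.arg (toComplex (h 0 - x) * ⟨-e 1, -e 0⟩) := by
    intro m hm
    induction m with
    | zero => simp [sweep]
    | succ m ih =>
      have : sweep h (m + 1) x = sweep h m x + viewAngle (h m) (h (m + 1)) x :=
        Finset.sum_range_succ _ _
      rw [this, ih (by omega),
        viewAngle_eq_sub_of_halfPlane (hx m (by omega)) (hx (m + 1) hm)]
      ring
  rw [this M le_rfl, hM, sub_self]

theorem continuousAt_sweep {h : ℕ → E2} {M : ℕ} {x : E2}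
    (hx : ∀ i < M, x ∉ segment ℝ (h i) (h (i + 1))) : ContinuousAt (sweep h M) x := by
  unfold sweep
  exact tendsto_finsetSum _ fun i hi => continuousAt_viewAngle (hx i (Finset.mem_range.1 hi))

theorem sweep_eq_of_isPreconnected {h : ℕ → E2} {M : ℕ} (hM : h M = h 0) (hM0 : 0 < M) {S : Set E2}
    (hS : IsPreconnected S) (hd : ∀ i < M, Disjoint S (segment ℝ (h i) (h (i + 1))))
    {x y : E2} (hx : x ∈ S) (hy : y ∈ S) : sweep h M x = sweep h M y := by
  have hne : ∀ z ∈ S, ∀ i ≤ M, h i ≠ z := by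
    rintro z hz i hi rfl
    rcases hi.lt_or_eq with hi | rfl
    · exact Set.disjoint_left.1 (hd i hi) hz (left_mem_segment ℝ _ _)
    · rw [hM] at hz
      exact Set.disjoint_left.1 (hd 0 hM0) hz (left_mem_segment ℝ _ _)
  have hcont : ContinuousOn (sweep h M) S := fun z hz =>
    (continuousAt_sweep fun i hi hz' => Set.disjoint_left.1 (hd i hi) hz hz').continuousWithinAt
  have hinteger : ∀ z ∈ S, ∃ k : ℤ, sweep h M z = 2 * Real.pi * k :=
    fun z hz => exists_sweep_eq_int_mul hM (hne z hz)
  have key : ∀ x ∈ S, ∀ y ∈ S, ¬ sweep h M x < sweep h M y := by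
    intro x hx y hy hlt
    obtain ⟨k, hk⟩ := hinteger x hx
    obtain ⟨l, hl⟩ := hinteger y hy
    have hpi := Real.pi_pos
    have hkl : k < l := by
      have : (k : ℝ) < l := by
        rw [hk, hl] at hlt
        exact lt_of_mul_lt_mul_left hlt (by positivity)
      exact_mod_cast this
    have hkl' : (k : ℝ) + 1 ≤ l := by exact_mod_cast hkl
    have hmem : 2 * Real.pi * k + Real.pi ∈ Icc (sweep h M x) (sweep h M y) := by
      rw [hk, hl]; constructor
      · linarith
      · nlinarith
    obtain ⟨z, hz, hzeq⟩ := hS.intermediate_value hx hy hcont hmem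
    obtain ⟨m, hm⟩ := hinteger z hz
    rw [hm] at hzeq
    have h1 : (2 : ℝ) * m = 2 * k + 1 := by
      have : Real.pi * (2 * m) = Real.pi * (2 * k + 1) := by linarith
      exact mul_left_cancel₀ hpi.ne' this
    have h2 : (2 : ℤ) * m = 2 * k + 1 := by exact_mod_cast h1
    omega
  exact le_antisymm (not_lt.1 (key y hy x hx)) (not_lt.1 (key x hx y hy))

/-- Crossing an edge transversally changes the angle under which it is seen by more than `π`. -/
theorem eventually_pi_lt_viewAngle_sub {a b x ν : E2} (hx : x ∈ openSegment ℝ a b)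
    (hν : 0 < cross2 (b - a) ν) :
    ∀ᶠ ε in nhdsWithin (0 : ℝ) (Ioi 0),
      Real.pi < viewAngle a b (x + ε • ν) - viewAngle a b (x - ε • ν) := by
  obtain ⟨m, μ, hm, hμ, hmμ, rfl⟩ := hx
  have hab : b - a ≠ 0 := by
    intro h; rw [h, cross2_zero_left] at hν; exact lt_irrefl _ hν
  have hp := sq_add_sq_pos_of_ne_zero hab
  simp only [PiLp.sub_apply] at hp
  set x := m • a + μ • b with hxdef
  have hm' : m = 1 - μ := by linarith
  have hx0 : x 0 = (1 - μ) * a 0 + μ * b 0 := by simp [hxdef, hm']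
  have hx1 : x 1 = (1 - μ) * a 1 + μ * b 1 := by simp [hxdef, hm']
  have hre : ∀ᶠ ε in nhds (0 : ℝ),
      (toComplex (b - (x + ε • ν)) * (starRingEnd ℂ) (toComplex (a - (x + ε • ν)))).re < 0 := by
    simp only [viewAngle_re]
    have hc : Continuous fun ε : ℝ => (a 0 - (x + ε • ν) 0) * (b 0 - (x + ε • ν) 0) +
        (a 1 - (x + ε • ν) 1) * (b 1 - (x + ε • ν) 1) := by fun_prop
    refine hc.continuousAt.eventually_lt continuousAt_const ?_
    simp only [zero_smul, add_zero, hx0, hx1]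
    have : 0 < μ * m * ((b 0 - a 0) ^ 2 + (b 1 - a 1) ^ 2) := by positivity
    rw [hm'] at this
    nlinarith
  have hre' : ∀ᶠ ε in nhds (0 : ℝ),
      (toComplex (b - (x - ε • ν)) * (starRingEnd ℂ) (toComplex (a - (x - ε • ν)))).re < 0 := by
    have ht : Filter.Tendsto (fun ε : ℝ => -ε) (nhds 0) (nhds 0) := by
      simpa using (continuous_neg (G := ℝ)).tendsto 0
    have := ht.eventually hre
    simpa [sub_eq_add_neg] using this
  have him : ∀ ε : ℝ, cross2 (a - (x + ε • ν)) (b - (x + ε • ν)) = ε * cross2 (b - a) ν := by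
    intro ε
    simp only [cross2, PiLp.sub_apply, PiLp.add_apply, PiLp.smul_apply, hx0, hx1, smul_eq_mul]
    ring
  filter_upwards [nhdsWithin_le_nhds hre, nhdsWithin_le_nhds hre', self_mem_nhdsWithin]
    with ε h1 h2 hε
  have hε' : (0 : ℝ) < ε := hε
  have hpos : Real.pi / 2 < viewAngle a b (x + ε • ν) := by
    have : (0 : ℝ) < (toComplex (b - (x + ε • ν)) *
        (starRingEnd ℂ) (toComplex (a - (x + ε • ν)))).im := by
      rw [viewAngle_im, him]; positivity
    unfold viewAngle
    by_contra hcon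
    rcases (Complex.arg_le_pi_div_two_iff.1 (not_lt.1 hcon)) with h | h <;> linarith
  have hneg : viewAngle a b (x - ε • ν) < -(Real.pi / 2) := by
    have : (toComplex (b - (x - ε • ν)) *
        (starRingEnd ℂ) (toComplex (a - (x - ε • ν)))).im < 0 := by
      have := him (-ε)
      rw [neg_smul, ← sub_eq_add_neg] at this
      rw [viewAngle_im, this]; nlinarith
    unfold viewAngle
    by_contra hcon
    rcases (Complex.neg_pi_div_two_le_arg_iff.1 (not_lt.1 hcon)) with h | h <;> linarith
  linarith

/-- Crossing a closed polygonal curve once, transversally, changes the swept angle. -/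
theorem eventually_sweep_ne {h : ℕ → E2} {M : ℕ} {j : ℕ} (hj : j < M) {x ν : E2}
    (hx : x ∈ openSegment ℝ (h j) (h (j + 1)))
    (hother : ∀ i < M, i ≠ j → x ∉ segment ℝ (h i) (h (i + 1)))
    (hν : cross2 (h (j + 1) - h j) ν ≠ 0) :
    ∀ᶠ ε in nhdsWithin (0 : ℝ) (Ioi 0), sweep h M (x + ε • ν) ≠ sweep h M (x - ε • ν) := by
  have aux : ∀ ν : E2, 0 < cross2 (h (j + 1) - h j) ν →
      ∀ᶠ ε in nhdsWithin (0 : ℝ) (Ioi 0), sweep h M (x + ε • ν) ≠ sweep h M (x - ε • ν) := by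
    intro ν hν
    set G : E2 → ℝ := fun y => ∑ i ∈ (Finset.range M).erase j, viewAngle (h i) (h (i + 1)) y
      with hG
    have hsplit : ∀ y, sweep h M y = viewAngle (h j) (h (j + 1)) y + G y := fun y =>
      (Finset.add_sum_erase _ _ (Finset.mem_range.2 hj)).symm
    have hGc : ContinuousAt G x := by
      refine tendsto_finsetSum _ fun i hi => continuousAt_viewAngle ?_
      exact hother i (Finset.mem_range.1 (Finset.mem_of_mem_erase hi)) (Finset.ne_of_mem_erase hi)
    have hd : ∀ᶠ ε in nhds (0 : ℝ), |G (x + ε • ν) - G (x - ε • ν)| < Real.pi := by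
      have h1 : ContinuousAt (fun ε : ℝ => G (x + ε • ν)) 0 :=
        ContinuousAt.comp' (x := (0 : ℝ)) (f := fun ε : ℝ => x + ε • ν) (g := G)
          (by simpa using hGc) (by fun_prop)
      have h2 : ContinuousAt (fun ε : ℝ => G (x - ε • ν)) 0 :=
        ContinuousAt.comp' (x := (0 : ℝ)) (f := fun ε : ℝ => x - ε • ν) (g := G)
          (by simpa using hGc) (by fun_prop)
      refine (h1.sub h2).abs.eventually_lt continuousAt_const ?_
      simpa using Real.pi_pos
    filter_upwards [nhdsWithin_le_nhds hd, eventually_pi_lt_viewAngle_sub hx hν] with ε h1 h2 heq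
    rw [hsplit, hsplit] at heq
    rw [abs_lt] at h1
    linarith
  rcases hν.lt_or_gt with h0 | h0
  · have := aux (-ν) (by rw [cross2_neg_right]; linarith)
    filter_upwards [this] with ε hε
    simp only [smul_neg, ← sub_eq_add_neg, sub_neg_eq_add] at hε
    exact hε.symm
  · exact aux ν h0

/-! ### Parametrizing the boundary of a simple polygon -/

/-- A periodic parametrization of the boundary of `P` by the real line, affine between consecutive
integers, taking the integers to the vertices in one of the two cyclic orders. -/
structure SimplePolygon.Param (P : SimplePolygon) where
  toFun : ℝ → E2
  cont : Continuous toFun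
  periodic : ∀ s, toFun (s + P.n) = toFun s
  inj : ∀ s t, toFun s = toFun t → ∃ k : ℤ, t = s + k * P.n
  lin : ∀ (k : ℤ) (θ : ℝ), θ ∈ Icc (0 : ℝ) 1 →
    toFun (k + θ) = toFun k + θ • (toFun (k + 1) - toFun k)
  range_eq : range toFun = P.boundary
  vert : ∃ (i : ZMod P.n) (σ : ℤ), (σ = 1 ∨ σ = -1) ∧
    ∀ k : ℤ, toFun k = P.vtx (i + ((σ * k : ℤ) : ZMod P.n))

namespace SimplePolygon

variable {P : SimplePolygon}

instance : CoeFun P.Param (fun _ => ℝ → E2) := ⟨Param.toFun⟩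

theorem n_pos_real (P : SimplePolygon) : (3 : ℝ) ≤ P.n := by exact_mod_cast P.three_le

namespace Param

/-- Traversing the boundary backwards. -/
def reverse (γ : P.Param) : P.Param where
  toFun s := γ (-s)
  cont := γ.cont.comp continuous_neg
  periodic s := by
    have := γ.periodic (-(s + P.n))
    rw [← this]; congr 1; ring
  inj s t h := by
    obtain ⟨k, hk⟩ := γ.inj _ _ h
    refine ⟨-k, ?_⟩
    push_cast; linarith
  lin k θ hθ := by
    have h1 := γ.lin (-k - 1) (1 - θ) ⟨by linarith [hθ.2], by linarith [hθ.1]⟩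
    push_cast at h1
    rw [show -((k : ℝ) + θ) = -k - 1 + (1 - θ) by ring, h1, sub_add_cancel,
      show -((k : ℝ) + 1) = -k - 1 by ring]
    module
  range_eq := by
    rw [← γ.range_eq]
    exact (Function.Surjective.range_comp neg_surjective γ.toFun)
  vert := by
    obtain ⟨i, σ, hσ, h⟩ := γ.vert
    refine ⟨i, -σ, ?_, fun k => ?_⟩
    · rcases hσ with rfl | rfl <;> simp
    · have := h (-k)
      push_cast at this ⊢
      rw [this]; congr 2; ring

/-- Starting the parametrization at another vertex. -/
def shift (γ : P.Param) (m : ℤ) : P.Param where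
  toFun s := γ (s + m)
  cont := γ.cont.comp (continuous_add_const _)
  periodic s := by rw [add_right_comm, γ.periodic]
  inj s t h := by
    obtain ⟨k, hk⟩ := γ.inj _ _ h
    exact ⟨k, by linarith⟩
  lin k θ hθ := by
    have h1 := γ.lin (k + m) θ hθ
    push_cast at h1
    rw [add_right_comm, h1, add_right_comm (k : ℝ) m 1]
  range_eq := by
    rw [← γ.range_eq]
    exact (Function.Surjective.range_comp (add_right_surjective (m : ℝ)) γ.toFun)
  vert := by
    obtain ⟨i, σ, hσ, h⟩ := γ.vert
    refine ⟨i + ((σ * m : ℤ) : ZMod P.n), σ, hσ, fun k => ?_⟩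
    have := h (k + m)
    push_cast at this ⊢
    rw [this]; congr 1; ring

end Param

/-- The point of `∂P` at parameter `s`, the vertex `i` having parameter `i`. -/
def boundaryPoint (P : SimplePolygon) (s : ℝ) : E2 :=
  P.vtx (⌊s⌋ : ZMod P.n) +
    Int.fract s • (P.vtx ((⌊s⌋ : ZMod P.n) + 1) - P.vtx (⌊s⌋ : ZMod P.n))

theorem boundaryPoint_int (k : ℤ) : P.boundaryPoint k = P.vtx (k : ZMod P.n) := by
  simp [boundaryPoint]

theorem boundaryPoint_lin (k : ℤ) {θ : ℝ} (hθ : θ ∈ Icc (0 : ℝ) 1) :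
    P.boundaryPoint (k + θ) = P.boundaryPoint k +
      θ • (P.boundaryPoint (k + 1) - P.boundaryPoint k) := by
  have hk1 : P.boundaryPoint (k + 1) = P.vtx ((k : ZMod P.n) + 1) := by
    have := boundaryPoint_int (P := P) (k + 1)
    push_cast at this
    exact this
  rw [hk1, boundaryPoint_int]
  rcases hθ.2.eq_or_lt with rfl | h1
  · rw [hk1]; simp
  · have hfl : ⌊(k : ℝ) + θ⌋ = k := by
      rw [Int.floor_eq_iff]; constructor <;> linarith [hθ.1]
    have hfr : Int.fract ((k : ℝ) + θ) = θ := by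
      rw [Int.fract, hfl]; ring
    simp only [boundaryPoint, hfl, hfr]

theorem continuous_boundaryPoint : Continuous P.boundaryPoint := by
  have hpiece : ∀ k : ℤ, ContinuousOn P.boundaryPoint (Icc (k : ℝ) (k + 1)) := by
    intro k
    have : ContinuousOn (fun s : ℝ => P.boundaryPoint k +
      (s - k) • (P.boundaryPoint (k + 1) - P.boundaryPoint k)) (Icc (k : ℝ) (k + 1)) := by
      fun_prop
    refine this.congr fun s hs => ?_
    have := boundaryPoint_lin (P := P) k (θ := s - k) ⟨by linarith [hs.1], by linarith [hs.2]⟩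
    rw [add_sub_cancel] at this; exact this
  rw [continuous_iff_continuousAt]
  intro s
  rcases (Int.floor_le s).eq_or_lt with h | h
  · have h1 := hpiece (⌊s⌋ - 1)
    have h2 := hpiece ⌊s⌋
    push_cast at h1
    rw [sub_add_cancel] at h1
    have h3 : ContinuousOn P.boundaryPoint (Icc ((⌊s⌋ : ℝ) - 1) (⌊s⌋ + 1)) := by
      rw [← Icc_union_Icc_eq_Icc (b := (⌊s⌋ : ℝ)) (by linarith) (by linarith)]
      exact h1.union_of_isClosed h2 isClosed_Icc isClosed_Icc
    exact h3.continuousAt (Icc_mem_nhds (by linarith) (by linarith))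
  · exact (hpiece ⌊s⌋).continuousAt (Icc_mem_nhds h (Int.lt_floor_add_one s))

theorem vtx_ne_add_one (i : ZMod P.n) : P.vtx i ≠ P.vtx (i + 1) := by
  intro h
  have h1 := P.inj h
  have : Fact (1 < P.n) := ⟨by linarith [P.three_le]⟩
  simp at h1

theorem segment_param {a b : E2} {θ : ℝ} (hθ : θ ∈ Icc (0 : ℝ) 1) :
    a + θ • (b - a) ∈ segment ℝ a b := by
  rw [segment_eq_image']
  exact ⟨θ, hθ, rfl⟩

theorem boundaryPoint_mem_segment (s : ℝ) : P.boundaryPoint s ∈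
    segment ℝ (P.vtx (⌊s⌋ : ZMod P.n)) (P.vtx ((⌊s⌋ : ZMod P.n) + 1)) :=
  segment_param ⟨Int.fract_nonneg s, (Int.fract_lt_one s).le⟩

theorem boundaryPoint_ne_vtx_succ (s : ℝ) :
    P.boundaryPoint s ≠ P.vtx ((⌊s⌋ : ZMod P.n) + 1) := by
  intro h
  have h1 : (1 - Int.fract s) • (P.vtx ((⌊s⌋ : ZMod P.n) + 1) - P.vtx (⌊s⌋ : ZMod P.n)) = 0 := by
    rw [sub_smul, one_smul, sub_eq_zero, sub_eq_iff_eq_add']; exact h.symm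
  rcases smul_eq_zero.1 h1 with h2 | h2
  · linarith [Int.fract_lt_one s]
  · exact vtx_ne_add_one _ (sub_eq_zero.1 h2).symm

theorem boundaryPoint_inj {s t : ℝ} (h : P.boundaryPoint s = P.boundaryPoint t) :
    ∃ k : ℤ, t = s + k * P.n := by
  have hs := boundaryPoint_mem_segment (P := P) s
  have ht := boundaryPoint_mem_segment (P := P) t
  by_cases h0 : (⌊s⌋ : ZMod P.n) = (⌊t⌋ : ZMod P.n)
  · have h1 : (Int.fract s - Int.fract t) •
        (P.vtx ((⌊s⌋ : ZMod P.n) + 1) - P.vtx (⌊s⌋ : ZMod P.n)) = 0 := by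
      simp only [boundaryPoint, ← h0] at h
      rw [sub_smul, sub_eq_zero]
      exact add_left_cancel h
    rcases smul_eq_zero.1 h1 with h2 | h2
    · rw [ZMod.intCast_eq_intCast_iff_dvd_sub] at h0
      obtain ⟨k, hk⟩ := h0
      refine ⟨k, ?_⟩
      have hk' : (⌊t⌋ : ℝ) - ⌊s⌋ = P.n * k := by exact_mod_cast hk
      have e1 := Int.floor_add_fract s
      have e2 := Int.floor_add_fract t
      linarith
    · exact absurd (sub_eq_zero.1 h2).symm (vtx_ne_add_one _)
  exfalso
  by_cases h1 : (⌊s⌋ : ZMod P.n) + 1 = (⌊t⌋ : ZMod P.n)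
  · have h2 := P.adj_edges (⌊s⌋ : ZMod P.n)
    rw [show (⌊s⌋ : ZMod P.n) + 2 = (⌊s⌋ : ZMod P.n) + 1 + 1 by ring, h1] at h2
    have h3 : P.boundaryPoint s ∈ ({P.vtx (⌊t⌋ : ZMod P.n)} : Set E2) := by
      rw [← h2]
      refine ⟨h1 ▸ hs, h ▸ ht⟩
    exact boundaryPoint_ne_vtx_succ s (by rw [h1]; exact h3)
  by_cases h2 : (⌊t⌋ : ZMod P.n) + 1 = (⌊s⌋ : ZMod P.n)
  · have h3 := P.adj_edges (⌊t⌋ : ZMod P.n)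
    rw [show (⌊t⌋ : ZMod P.n) + 2 = (⌊t⌋ : ZMod P.n) + 1 + 1 by ring, h2] at h3
    have h4 : P.boundaryPoint t ∈ ({P.vtx (⌊s⌋ : ZMod P.n)} : Set E2) := by
      rw [← h3]
      refine ⟨h2 ▸ ht, h ▸ hs⟩
    exact boundaryPoint_ne_vtx_succ t (by rw [h2]; exact h4)
  have h3 := P.nonadj_edges _ _ h0 h1 h2
  have : P.boundaryPoint s ∈ (∅ : Set E2) := by
    rw [← h3]; exact ⟨hs, h ▸ ht⟩
  exact this

/-- The parametrization of `∂P` in the order of the vertices. -/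
def param (P : SimplePolygon) : P.Param where
  toFun := P.boundaryPoint
  cont := continuous_boundaryPoint
  periodic s := by
    have h1 : ⌊s + P.n⌋ = ⌊s⌋ + P.n := Int.floor_add_natCast s P.n
    have h2 : Int.fract (s + P.n) = Int.fract s := Int.fract_add_natCast s P.n
    simp [boundaryPoint, h1, h2]
  inj s t h := boundaryPoint_inj h
  lin k θ hθ := boundaryPoint_lin k hθ
  range_eq := by
    apply Subset.antisymm
    · rintro _ ⟨s, rfl⟩
      exact mem_iUnion.2 ⟨_, boundaryPoint_mem_segment s⟩
    · intro x hx
      obtain ⟨i, hi⟩ := mem_iUnion.1 hx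
      rw [segment_eq_image'] at hi
      obtain ⟨θ, hθ, rfl⟩ := hi
      obtain ⟨k, rfl⟩ := ZMod.intCast_surjective i
      refine ⟨k + θ, ?_⟩
      have := boundaryPoint_int (P := P) (k + 1)
      push_cast at this
      simp only [boundaryPoint_lin k hθ, boundaryPoint_int, this]
  vert := ⟨0, 1, Or.inl rfl, fun k => by simp [boundaryPoint_int]⟩

namespace Param

variable (γ : P.Param)

theorem apply_ne {s t : ℝ} (h1 : s < t) (h2 : t < s + P.n) : γ s ≠ γ t := by
  intro h
  obtain ⟨k, hk⟩ := γ.inj _ _ h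
  have hn := P.n_pos_real
  have hk0 : (0 : ℝ) < k := by
    by_contra hcon
    nlinarith
  have hk1 : (1 : ℝ) ≤ k := by exact_mod_cast hk0
  nlinarith

theorem eq_of_apply_eq {s t : ℝ} (h : γ s = γ t) (h1 : t < s + P.n) (h2 : s < t + P.n) : s = t := by
  rcases lt_trichotomy s t with h0 | h0 | h0
  · exact absurd h (γ.apply_ne h0 h1)
  · exact h0
  · exact absurd h.symm (γ.apply_ne h0 h2)

theorem exists_mem_Ico (a s : ℝ) : ∃ t ∈ Ico a (a + P.n), γ t = γ s := by
  have hn : (0 : ℝ) < P.n := by linarith [P.n_pos_real]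
  have hp : Function.Periodic γ.toFun (P.n : ℝ) := γ.periodic
  obtain ⟨t, ht, h⟩ := hp.exists_mem_Ico hn s a
  exact ⟨t, ht, h.symm⟩

theorem exists_mem_Ico_of_mem (a : ℝ) {x : E2} (hx : x ∈ P.boundary) :
    ∃ t ∈ Ico a (a + P.n), γ t = x := by
  rw [← γ.range_eq] at hx
  obtain ⟨s, rfl⟩ := hx
  exact γ.exists_mem_Ico a s

theorem mem_boundary (s : ℝ) : γ s ∈ P.boundary := γ.range_eq ▸ mem_range_self s

theorem _root_.SimplePolygon.isCompact_boundary : IsCompact P.boundary := by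
  let γ := P.param
  have : P.boundary = γ '' Icc 0 (0 + P.n) := by
    apply Subset.antisymm
    · intro x hx
      obtain ⟨t, ht, rfl⟩ := γ.exists_mem_Ico_of_mem 0 hx
      exact mem_image_of_mem _ (Ico_subset_Icc_self ht)
    · rintro _ ⟨t, _, rfl⟩; exact γ.mem_boundary t
  rw [this]
  exact isCompact_Icc.image γ.cont

theorem lin_sub {k : ℤ} {s t : ℝ} (hs : s ∈ Icc (k : ℝ) (k + 1)) (ht : t ∈ Icc (k : ℝ) (k + 1)) :
    γ t = γ s + (t - s) • (γ (k + 1) - γ k) := by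
  have h1 := γ.lin k (s - k) ⟨by linarith [hs.1], by linarith [hs.2]⟩
  have h2 := γ.lin k (t - k) ⟨by linarith [ht.1], by linarith [ht.2]⟩
  rw [add_sub_cancel] at h1 h2
  rw [h1, h2]
  module

theorem image_Icc_eq_segment {k : ℤ} {s t : ℝ} (hs : (k : ℝ) ≤ s) (hst : s ≤ t) (ht : t ≤ k + 1) :
    γ '' Icc s t = segment ℝ (γ s) (γ t) := by
  have hsm : s ∈ Icc (k : ℝ) (k + 1) := ⟨hs, hst.trans ht⟩
  have htm : t ∈ Icc (k : ℝ) (k + 1) := ⟨hs.trans hst, ht⟩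
  rw [segment_eq_image']
  apply Subset.antisymm
  · rintro _ ⟨r, hr, rfl⟩
    have hrm : r ∈ Icc (k : ℝ) (k + 1) := ⟨hs.trans hr.1, hr.2.trans ht⟩
    rcases hst.eq_or_lt with rfl | hlt
    · refine ⟨0, by simp, ?_⟩
      have : r = s := le_antisymm hr.2 hr.1
      simp [this]
    · have hpos : 0 < t - s := by linarith
      refine ⟨(r - s) / (t - s), ⟨div_nonneg (by linarith [hr.1]) hpos.le,
        (div_le_one hpos).2 (by linarith [hr.2])⟩, ?_⟩
      simp only
      rw [γ.lin_sub hsm htm, γ.lin_sub hsm hrm, add_sub_cancel_left, smul_smul,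
        div_mul_cancel₀ _ hpos.ne']
  · rintro _ ⟨θ, hθ, rfl⟩
    refine ⟨s + θ * (t - s), ⟨by nlinarith [hθ.1], by nlinarith [hθ.2]⟩, ?_⟩
    have hrm : s + θ * (t - s) ∈ Icc (k : ℝ) (k + 1) :=
      ⟨by nlinarith [hθ.1], by nlinarith [hθ.2]⟩
    simp only
    rw [γ.lin_sub hsm htm, γ.lin_sub hsm hrm, add_sub_cancel_left, add_sub_cancel_left, smul_smul]

/-! ### Local shape of the boundary -/

/-- A step small enough for `γ` to be affine on either side of `s`. -/
def step (s : ℝ) : ℝ :=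
  if (⌊s⌋ : ℝ) = s then 1 else min (⌊s⌋ + 1 - s) (s - ⌊s⌋)

theorem step_pos (s : ℝ) : 0 < step s := by
  unfold step
  split_ifs with h
  · exact one_pos
  · have h1 := (Int.floor_le s).lt_of_ne h
    have h2 := Int.lt_floor_add_one s
    exact lt_min (by linarith) (by linarith)

theorem step_le_one (s : ℝ) : step s ≤ 1 := by
  unfold step
  split_ifs with h
  · exact le_rfl
  · exact (min_le_right _ _).trans (by linarith [Int.lt_floor_add_one s])

theorem add_step_le (s : ℝ) : s + step s ≤ ⌊s⌋ + 1 := by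
  unfold step
  split_ifs with h
  · linarith
  · linarith [min_le_left ((⌊s⌋ : ℝ) + 1 - s) (s - ⌊s⌋)]

/-- The direction in which `γ` leaves `γ s`. -/
def fwd (s : ℝ) : E2 := γ (s + step s) - γ s

/-- The direction from which `γ` arrives at `γ s`, seen from `γ s`. -/
def bwd (s : ℝ) : E2 := γ (s - step s) - γ s

theorem fwd_lin (s : ℝ) {θ : ℝ} (hθ : θ ∈ Icc (0 : ℝ) 1) :
    γ (s + θ * step s) = γ s + θ • γ.fwd s := by
  have h0 := step_pos s
  have h1 := add_step_le s
  have h2 := Int.floor_le s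
  have hs : s ∈ Icc (⌊s⌋ : ℝ) (⌊s⌋ + 1) := ⟨h2, by linarith⟩
  rw [fwd, γ.lin_sub hs (t := s + step s) ⟨by linarith, h1⟩,
    γ.lin_sub hs (t := s + θ * step s) ⟨by nlinarith [hθ.1], by nlinarith [hθ.2]⟩]
  module

theorem bwd_lin (s : ℝ) {θ : ℝ} (hθ : θ ∈ Icc (0 : ℝ) 1) :
    γ (s - θ * step s) = γ s + θ • γ.bwd s := by
  have h0 := step_pos s
  by_cases h : (⌊s⌋ : ℝ) = s
  · have h1 : step s = 1 := by simp [step, h]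
    rw [bwd, h1]
    have hc : (((⌊s⌋ - 1 : ℤ)) : ℝ) = s - 1 := by push_cast; rw [h]
    have hs : s ∈ Icc (((⌊s⌋ - 1 : ℤ)) : ℝ) (((⌊s⌋ - 1 : ℤ)) + 1) := by
      rw [hc]; constructor <;> linarith
    rw [γ.lin_sub hs (t := s - 1) (by rw [hc]; constructor <;> linarith),
      γ.lin_sub hs (t := s - θ * 1) (by rw [hc]; constructor <;> linarith [hθ.1, hθ.2])]
    module
  · have h1 : step s ≤ s - ⌊s⌋ := by simp [step, h]
    have h2 := Int.lt_floor_add_one s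
    have hs : s ∈ Icc (⌊s⌋ : ℝ) (⌊s⌋ + 1) := ⟨by linarith, h2.le⟩
    rw [bwd, γ.lin_sub hs (t := s - step s) ⟨by linarith, by linarith⟩,
      γ.lin_sub hs (t := s - θ * step s) ⟨by nlinarith [hθ.2], by nlinarith [hθ.1]⟩]
    module

theorem bwd_eq_neg_fwd {s : ℝ} (h : (⌊s⌋ : ℝ) ≠ s) : γ.bwd s = -γ.fwd s := by
  have h0 := step_pos s
  have h1 : step s ≤ s - ⌊s⌋ := by simp [step, h]
  have h2 := Int.lt_floor_add_one s
  have h3 := add_step_le s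
  have hs : s ∈ Icc (⌊s⌋ : ℝ) (⌊s⌋ + 1) := ⟨by linarith, h2.le⟩
  rw [bwd, fwd, γ.lin_sub hs (t := s - step s) ⟨by linarith, by linarith⟩,
    γ.lin_sub hs (t := s + step s) ⟨by linarith, by linarith⟩]
  module

theorem step_int (k : ℤ) : step (k : ℝ) = 1 := by simp [step]

theorem fwd_int (k : ℤ) : γ.fwd k = γ (k + 1) - γ k := by rw [fwd, step_int]

theorem bwd_int (k : ℤ) : γ.bwd k = γ (k - 1) - γ k := by rw [bwd, step_int]

theorem fwd_ne_zero (s : ℝ) : γ.fwd s ≠ 0 := by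
  have := step_pos s
  have := step_le_one s
  exact sub_ne_zero.2 (γ.apply_ne (by linarith) (by linarith [P.n_pos_real])).symm

theorem bwd_ne_zero (s : ℝ) : γ.bwd s ≠ 0 := by
  have := step_pos s
  have := step_le_one s
  exact sub_ne_zero.2 (γ.apply_ne (by linarith) (by linarith [P.n_pos_real]))

theorem bwd_ne_smul_fwd (s : ℝ) {c : ℝ} (hc : 0 < c) : γ.bwd s ≠ c • γ.fwd s := by
  intro h
  have h0 := step_pos s
  have h1 := step_le_one s
  have hn := P.n_pos_real
  rcases le_total c 1 with hc1 | hc1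
  · have h2 := γ.fwd_lin s (θ := c) ⟨hc.le, hc1⟩
    have h3 := γ.bwd_lin s (θ := 1) ⟨zero_le_one, le_rfl⟩
    rw [one_smul, h, ← h2] at h3
    exact γ.apply_ne (s := s - 1 * step s) (t := s + c * step s) (by nlinarith) (by nlinarith) h3
  · have h2 := γ.fwd_lin s (θ := 1) ⟨zero_le_one, le_rfl⟩
    have hc' : c⁻¹ ≤ 1 := inv_le_one_of_one_le₀ hc1
    have hc0 : 0 < c⁻¹ := inv_pos.2 hc
    have h3 := γ.bwd_lin s (θ := c⁻¹) ⟨hc0.le, hc'⟩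
    rw [h, smul_smul, inv_mul_cancel₀ hc.ne', ← h2] at h3
    exact γ.apply_ne (s := s - c⁻¹ * step s) (t := s + 1 * step s) (by nlinarith) (by nlinarith) h3

end Param

/-- Near `x` the boundary of `P` consists of the two rays from `x` in the directions `d₁`, `d₂`. -/
structure IsChart (P : SimplePolygon) (x : E2) (ρ : ℝ) (d₁ d₂ q : E2) : Prop where
  wedge : Wedge d₁ d₂ q
  pos : 0 < ρ
  mem_iff : ∀ y ∈ Metric.ball x ρ, y ∈ P.boundary ↔
    ∃ c : ℝ, 0 ≤ c ∧ (y = x + c • d₁ ∨ y = x + c • d₂)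

theorem IsChart.mono {x : E2} {ρ ρ' : ℝ} {d₁ d₂ q : E2} (h : P.IsChart x ρ d₁ d₂ q)
    (hρ' : 0 < ρ') (hle : ρ' ≤ ρ) : P.IsChart x ρ' d₁ d₂ q :=
  ⟨h.wedge, hρ', fun y hy => h.mem_iff y (Metric.ball_subset_ball hle hy)⟩

namespace Param

variable (γ : P.Param)

theorem exists_chart (s : ℝ) : ∃ ρ d₁ d₂ q, P.IsChart (γ s) ρ d₁ d₂ q ∧
    ((d₁ = γ.fwd s ∧ d₂ = γ.bwd s) ∨ (d₁ = γ.bwd s ∧ d₂ = γ.fwd s)) := by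
  have h0 := step_pos s
  have h1 := step_le_one s
  have hn := P.n_pos_real
  have hf := norm_pos_iff.2 (γ.fwd_ne_zero s)
  have hb := norm_pos_iff.2 (γ.bwd_ne_zero s)
  set rest := γ '' Icc (s + step s) (s - step s + P.n) with hrest
  have hcl : IsClosed rest := (isCompact_Icc.image γ.cont).isClosed
  have hnot : γ s ∉ rest := by
    rintro ⟨t, ht, hts⟩
    exact γ.apply_ne (by linarith [ht.1]) (by linarith [ht.2]) hts.symm
  obtain ⟨ρ₀, hρ₀, hball⟩ := Metric.isOpen_iff.1 hcl.isOpen_compl _ hnot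
  set ρ := min ρ₀ (min ‖γ.fwd s‖ ‖γ.bwd s‖) with hρ
  have hρpos : 0 < ρ := lt_min hρ₀ (lt_min hf hb)
  have hmem : ∀ y ∈ Metric.ball (γ s) ρ, y ∈ P.boundary ↔
      ∃ c : ℝ, 0 ≤ c ∧ (y = γ s + c • γ.fwd s ∨ y = γ s + c • γ.bwd s) := by
    intro y hy
    constructor
    · intro hyJ
      obtain ⟨t, ht, rfl⟩ := γ.exists_mem_Ico_of_mem (s - step s) hyJ
      by_cases hts : t < s + step s
      · rcases le_total s t with hst | hst
        · refine ⟨(t - s) / step s, div_nonneg (by linarith) h0.le, Or.inl ?_⟩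
          rw [← γ.fwd_lin s ⟨div_nonneg (by linarith) h0.le, (div_le_one h0).2 (by linarith)⟩,
            div_mul_cancel₀ _ h0.ne', add_sub_cancel]
        · refine ⟨(s - t) / step s, div_nonneg (by linarith) h0.le, Or.inr ?_⟩
          rw [← γ.bwd_lin s ⟨div_nonneg (by linarith) h0.le,
            (div_le_one h0).2 (by linarith [ht.1])⟩, div_mul_cancel₀ _ h0.ne', sub_sub_cancel]
      · exact absurd ⟨t, ⟨not_lt.1 hts, ht.2.le⟩, rfl⟩
          (hball (Metric.ball_subset_ball (min_le_left _ _) hy))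
    · rintro ⟨c, hc, rfl | rfl⟩
      · have hlt : c < 1 := by
          rw [mem_ball_iff_norm, add_sub_cancel_left, norm_smul, Real.norm_of_nonneg hc] at hy
          have := hy.trans_le ((min_le_right _ _).trans (min_le_left _ _))
          by_contra hcon
          nlinarith
        rw [← γ.fwd_lin s ⟨hc, hlt.le⟩]; exact γ.mem_boundary _
      · have hlt : c < 1 := by
          rw [mem_ball_iff_norm, add_sub_cancel_left, norm_smul, Real.norm_of_nonneg hc] at hy
          have := hy.trans_le ((min_le_right _ _).trans (min_le_right _ _))
          by_contra hcon
          nlinarith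
        rw [← γ.bwd_lin s ⟨hc, hlt.le⟩]; exact γ.mem_boundary _
  obtain ⟨q, hq | hq⟩ := exists_wedge (γ.fwd_ne_zero s) (γ.bwd_ne_zero s)
    fun c hc => γ.bwd_ne_smul_fwd s hc
  · exact ⟨ρ, _, _, q, ⟨hq, hρpos, hmem⟩, Or.inl ⟨rfl, rfl⟩⟩
  · exact ⟨ρ, _, _, q, ⟨hq, hρpos, fun y hy => (hmem y hy).trans
      (exists_congr fun c => and_congr_right fun _ => or_comm)⟩, Or.inr ⟨rfl, rfl⟩⟩

end Param

end SimplePolygon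

/-! ### Winding of a boundary arc closed up by its chord -/

namespace SimplePolygon

variable {P : SimplePolygon}

namespace IsChart

variable {x d₁ d₂ q : E2} {ρ : ℝ}

theorem disjoint_smallSector (h : P.IsChart x ρ d₁ d₂ q) :
    Disjoint (smallSector x d₁ d₂ ∩ Metric.ball x ρ) P.boundary := by
  rw [Set.disjoint_left]
  rintro y ⟨hy, hb⟩ hyP
  obtain ⟨c, hc, hcy⟩ := (h.mem_iff y hb).1 hyP
  exact (h.wedge.not_mem_sectors x hc hcy).1 hy

theorem disjoint_largeSector (h : P.IsChart x ρ d₁ d₂ q) :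
    Disjoint (largeSector x d₁ d₂ ∩ Metric.ball x ρ) P.boundary := by
  rw [Set.disjoint_left]
  rintro y ⟨hy, hb⟩ hyP
  obtain ⟨c, hc, hcy⟩ := (h.mem_iff y hb).1 hyP
  exact (h.wedge.not_mem_sectors x hc hcy).2 hy

theorem not_mem_smallSector_self (x d₁ d₂ : E2) : x ∉ smallSector x d₁ d₂ := by
  simp [smallSector, cross2_zero_right]

theorem not_mem_largeSector_self (x d₁ d₂ : E2) : x ∉ largeSector x d₁ d₂ := by
  simp [largeSector, cross2_zero_right, cross2_zero_left]

theorem isPreconnected_largeSector (h : P.IsChart x ρ d₁ d₂ q) :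
    IsPreconnected (largeSector x d₁ d₂ ∩ Metric.ball x ρ) :=
  isPreconnected_largeSector_inter_ball x d₁ d₂ q h.pos h.wedge.left h.wedge.right

end IsChart

namespace Param

variable (γ : P.Param) {a b : ℝ}

/-- The closed curve made of the arc of `γ` over `[a, b]` and the chord joining its ends. -/
def loop (a b : ℝ) : Set E2 := γ '' Icc a b ∪ segment ℝ (γ b) (γ a)

/-- The break points of `γ` on `[a, b]`. -/
def brk (a b : ℝ) (i : ℕ) : ℝ := max a (min b (⌊a⌋ + i))

/-- The number of edges of `γ` on `[a, b]`. -/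
def brkNum (a b : ℝ) : ℕ := (⌈b⌉ - ⌊a⌋).toNat

/-- The corners of the closed polygonal curve `loop a b`. -/
def loopPts (a b : ℝ) (i : ℕ) : E2 := if i ≤ brkNum a b then γ (brk a b i) else γ a

/-- The total angle swept by the closed curve `loop a b` as seen from `x`. -/
def winding (a b : ℝ) (x : E2) : ℝ := sweep (γ.loopPts a b) (brkNum a b + 1) x

theorem brk_zero (a b : ℝ) : brk a b 0 = a := by
  have := Int.floor_le a
  simp only [brk, Nat.cast_zero, add_zero]
  exact max_eq_left ((min_le_right _ _).trans this)

theorem cast_brkNum (hab : a < b) : (brkNum a b : ℤ) = ⌈b⌉ - ⌊a⌋ := by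
  have h1 := Int.floor_le a
  have h2 := Int.le_ceil b
  have : (⌊a⌋ : ℝ) ≤ ⌈b⌉ := by linarith
  have h3 : ⌊a⌋ ≤ ⌈b⌉ := by exact_mod_cast this
  rw [brkNum, Int.toNat_of_nonneg (by linarith)]

theorem brk_brkNum (hab : a < b) : brk a b (brkNum a b) = b := by
  have h1 := cast_brkNum hab
  have h2 : ((brkNum a b : ℕ) : ℝ) = ⌈b⌉ - ⌊a⌋ := by exact_mod_cast h1
  have h3 := Int.le_ceil b
  rw [brk, h2, add_sub_cancel, min_eq_left h3, max_eq_right hab.le]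

theorem brk_mem (hab : a < b) (i : ℕ) : brk a b i ∈ Icc a b :=
  ⟨le_max_left _ _, max_le hab.le (min_le_left _ _)⟩

theorem brk_le_succ (a b : ℝ) (i : ℕ) : brk a b i ≤ brk a b (i + 1) := by
  unfold brk; gcongr; omega

theorem le_brk (hab : a < b) {i : ℕ} (hi : i < brkNum a b) :
    (((⌊a⌋ + i : ℤ)) : ℝ) ≤ brk a b i := by
  have h1 := cast_brkNum hab
  have h2 : ⌊a⌋ + i < ⌈b⌉ := by omega
  have h3 := Int.lt_ceil.1 h2
  push_cast at h3 ⊢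
  exact le_max_of_le_right (le_min h3.le le_rfl)

theorem brk_succ_le (a b : ℝ) (i : ℕ) : brk a b (i + 1) ≤ (((⌊a⌋ + i : ℤ)) : ℝ) + 1 := by
  have h3 := Int.lt_floor_add_one a
  have : (0 : ℝ) ≤ i := by positivity
  unfold brk
  push_cast
  exact max_le (by linarith) ((min_le_right _ _).trans (by linarith))

theorem segment_loopPts (hab : a < b) {i : ℕ} (hi : i < brkNum a b) :
    segment ℝ (γ.loopPts a b i) (γ.loopPts a b (i + 1)) =
      γ '' Icc (brk a b i) (brk a b (i + 1)) := by
  rw [loopPts, loopPts, if_pos hi.le, if_pos (by omega : i + 1 ≤ brkNum a b)]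
  exact (γ.image_Icc_eq_segment (le_brk hab hi) (brk_le_succ a b i) (brk_succ_le a b i)).symm

theorem loopPts_brkNum (hab : a < b) : γ.loopPts a b (brkNum a b) = γ b := by
  rw [loopPts, if_pos le_rfl, brk_brkNum hab]

theorem loopPts_last (a b : ℝ) : γ.loopPts a b (brkNum a b + 1) = γ a := by
  rw [loopPts, if_neg (by omega)]

theorem loopPts_closed (a b : ℝ) : γ.loopPts a b (brkNum a b + 1) = γ.loopPts a b 0 := by
  rw [loopPts_last, loopPts, if_pos (Nat.zero_le _), brk_zero]

theorem segment_loopPts_subset (hab : a < b) {i : ℕ} (hi : i < brkNum a b + 1) :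
    segment ℝ (γ.loopPts a b i) (γ.loopPts a b (i + 1)) ⊆ γ.loop a b := by
  rcases (Nat.lt_succ_iff.1 hi).lt_or_eq with h | rfl
  · rw [γ.segment_loopPts hab h]
    exact (image_mono (Icc_subset_Icc (brk_mem hab _).1 (brk_mem hab _).2)).trans
      subset_union_left
  · rw [γ.loopPts_brkNum hab, loopPts_last]
    exact subset_union_right

theorem isCompact_loop (a b : ℝ) : IsCompact (γ.loop a b) := by
  refine (isCompact_Icc.image γ.cont).union ?_
  rw [segment_eq_image']
  exact isCompact_Icc.image (by fun_prop)

theorem apply_mem_loop {s : ℝ} (hs : s ∈ Icc a b) : γ s ∈ γ.loop a b :=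
  Or.inl (mem_image_of_mem _ hs)

theorem winding_eq_of_isPreconnected (hab : a < b) {S : Set E2} (hS : IsPreconnected S)
    (hd : Disjoint S (γ.loop a b)) {x y : E2} (hx : x ∈ S) (hy : y ∈ S) :
    γ.winding a b x = γ.winding a b y :=
  sweep_eq_of_isPreconnected (γ.loopPts_closed a b) (Nat.succ_pos _) hS
    (fun _ hi => hd.mono_right (γ.segment_loopPts_subset hab hi)) hx hy

theorem winding_eq_zero (hab : a < b) {e x : E2} (h : ∀ z ∈ γ.loop a b, 0 < cross2 e (z - x)) :
    γ.winding a b x = 0 := by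
  refine sweep_eq_zero_of_halfPlane (e := e) (γ.loopPts_closed a b) fun i _ => h _ ?_
  rw [loopPts]
  split_ifs
  · exact γ.apply_mem_loop (brk_mem hab _)
  · exact γ.apply_mem_loop ⟨le_rfl, hab.le⟩

theorem eventually_winding_ne_of_mem_chord (hab : a < b) {x ν : E2}
    (hx : x ∈ openSegment ℝ (γ b) (γ a)) (hx' : x ∉ γ '' Icc a b)
    (hν : cross2 (γ a - γ b) ν ≠ 0) :
    ∀ᶠ ε in nhdsWithin (0 : ℝ) (Ioi 0), γ.winding a b (x + ε • ν) ≠ γ.winding a b (x - ε • ν) := by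
  refine eventually_sweep_ne (Nat.lt_succ_self (brkNum a b)) ?_ ?_ ?_
  · rwa [γ.loopPts_brkNum hab, loopPts_last]
  · intro i hi hne hxi
    rw [γ.segment_loopPts hab (by omega)] at hxi
    exact hx' (image_mono (Icc_subset_Icc (brk_mem hab _).1 (brk_mem hab _).2) hxi)
  · rwa [γ.loopPts_brkNum hab, loopPts_last]

theorem eventually_winding_ne_of_mem_Ioo (hb : b ≤ a + P.n) {s : ℝ}
    (hs : s ∈ Ioo a b) (hinteger : (⌊s⌋ : ℝ) ≠ s) (hchord : γ s ∉ segment ℝ (γ b) (γ a)) {ν : E2}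
    (hν : cross2 (γ (⌊s⌋ + 1) - γ ⌊s⌋) ν ≠ 0) :
    ∀ᶠ ε in nhdsWithin (0 : ℝ) (Ioi 0),
      γ.winding a b (γ s + ε • ν) ≠ γ.winding a b (γ s - ε • ν) := by
  have hab : a < b := hs.1.trans hs.2
  have hfl := (Int.floor_le s).lt_of_ne hinteger
  have hfl' := Int.lt_floor_add_one s
  have hmono : ⌊a⌋ ≤ ⌊s⌋ := Int.floor_mono hs.1.le
  obtain ⟨j, hj⟩ := Int.eq_ofNat_of_zero_le (sub_nonneg.2 hmono)
  have hj' : (⌊a⌋ : ℝ) + j = ⌊s⌋ := by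
    have : ⌊a⌋ + (j : ℤ) = ⌊s⌋ := by omega
    exact_mod_cast this
  have hjN : j < brkNum a b := by
    have h1 := cast_brkNum hab
    have : ⌊s⌋ < ⌈b⌉ := Int.lt_ceil.2 (hfl.trans hs.2)
    omega
  have hj1 : brk a b j < s := by
    rw [brk, hj']; exact max_lt hs.1 ((min_le_right _ _).trans_lt hfl)
  have hj2 : s < brk a b (j + 1) := by
    rw [brk]; push_cast
    rw [← add_assoc, hj']
    exact (lt_min hs.2 hfl').trans_le (le_max_right _ _)
  have e1 := le_brk hab hjN
  have e2 := brk_succ_le a b j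
  push_cast at e1 e2
  rw [hj'] at e1 e2
  have hlin : γ (brk a b (j + 1)) = γ (brk a b j) +
      (brk a b (j + 1) - brk a b j) • (γ (⌊s⌋ + 1) - γ ⌊s⌋) :=
    γ.lin_sub ⟨e1, by linarith⟩ ⟨by linarith, e2⟩
  have hlin' : γ s = γ (brk a b j) + (s - brk a b j) • (γ (⌊s⌋ + 1) - γ ⌊s⌋) :=
    γ.lin_sub ⟨e1, by linarith⟩ ⟨by linarith, by linarith⟩
  have hp1 : γ.loopPts a b j = γ (brk a b j) := by rw [loopPts, if_pos hjN.le]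
  have hp2 : γ.loopPts a b (j + 1) = γ (brk a b (j + 1)) := by
    rw [loopPts, if_pos (by omega : j + 1 ≤ brkNum a b)]
  have hpos : 0 < brk a b (j + 1) - brk a b j := by linarith
  refine eventually_sweep_ne (j := j) (by omega) ?_ ?_ ?_
  · rw [hp1, hp2, openSegment_eq_image']
    refine ⟨(s - brk a b j) / (brk a b (j + 1) - brk a b j), ⟨div_pos (by linarith) hpos,
      (div_lt_one hpos).2 (by linarith)⟩, ?_⟩
    simp only
    rw [hlin, hlin', add_sub_cancel_left, smul_smul, div_mul_cancel₀ _ hpos.ne']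
  · intro i hi hne hxi
    rcases (Nat.lt_succ_iff.1 hi).lt_or_eq with h | rfl
    · rw [γ.segment_loopPts hab h] at hxi
      obtain ⟨t, ht, hts⟩ := hxi
      have ht1 := (brk_mem hab i).1
      have ht2 := (brk_mem hab (i + 1)).2
      obtain rfl : t = s := γ.eq_of_apply_eq hts (by linarith [ht.1, ht.2, hs.1, hs.2])
        (by linarith [ht.1, ht.2, hs.1, hs.2])
      have e3 := (le_brk hab h).trans ht.1
      have e4 := ht.2.trans (brk_succ_le a b i)
      have e5 : ⌊a⌋ + (i : ℤ) ≤ ⌊t⌋ := Int.le_floor.2 e3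
      have e6 : ⌊t⌋ < ⌊a⌋ + (i : ℤ) + 1 := by
        have : (⌊t⌋ : ℝ) < ((⌊a⌋ + (i : ℤ) : ℤ) : ℝ) + 1 := by linarith
        exact_mod_cast this
      omega
    · rw [γ.loopPts_brkNum hab, loopPts_last] at hxi
      exact hchord hxi
  · rw [hp1, hp2, hlin, add_sub_cancel_left, cross2_smul_left]
    exact mul_ne_zero hpos.ne' hν

theorem fwd_eq_smul (s : ℝ) : γ.fwd s = step s • (γ (⌊s⌋ + 1) - γ ⌊s⌋) := by
  have h0 := step_pos s
  have h1 := add_step_le s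
  have h2 := Int.floor_le s
  rw [fwd, γ.lin_sub (k := ⌊s⌋) (s := s) (t := s + step s) ⟨h2, by linarith⟩ ⟨by linarith, h1⟩,
    add_sub_cancel_left, add_sub_cancel_left]

/-- The arc `γ` over `[a, b]` separates the two sectors at a boundary point not on the chord. -/
theorem winding_ne_of_sectors (hb : b ≤ a + P.n) {s ρ : ℝ} {d₁ d₂ q : E2} (hs : s ∈ Ico a b)
    (hch : P.IsChart (γ s) ρ d₁ d₂ q) (hd : d₁ = γ.fwd s ∨ d₂ = γ.fwd s)
    (hchord : ∀ y ∈ segment ℝ (γ b) (γ a), y ∈ Metric.ball (γ s) ρ → y = γ s) {y z : E2}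
    (hy : y ∈ smallSector (γ s) d₁ d₂ ∩ Metric.ball (γ s) ρ)
    (hz : z ∈ largeSector (γ s) d₁ d₂ ∩ Metric.ball (γ s) ρ) :
    γ.winding a b y ≠ γ.winding a b z := by
  have hab : a < b := hs.1.trans_lt hs.2
  have h0 := step_pos s
  have hρ := hch.pos
  have hsub : γ '' Icc a b ⊆ P.boundary := by rintro _ ⟨t, _, rfl⟩; exact γ.mem_boundary t
  have dS : Disjoint (smallSector (γ s) d₁ d₂ ∩ Metric.ball (γ s) ρ) (γ.loop a b) := by
    rw [loop, disjoint_union_right]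
    refine ⟨hch.disjoint_smallSector.mono_right hsub, Set.disjoint_left.2 fun p hp hp' => ?_⟩
    have := hchord p hp' hp.2
    rw [this] at hp
    exact IsChart.not_mem_smallSector_self _ _ _ hp.1
  have dL : Disjoint (largeSector (γ s) d₁ d₂ ∩ Metric.ball (γ s) ρ) (γ.loop a b) := by
    rw [loop, disjoint_union_right]
    refine ⟨hch.disjoint_largeSector.mono_right hsub, Set.disjoint_left.2 fun p hp hp' => ?_⟩
    have := hchord p hp' hp.2
    rw [this] at hp
    exact IsChart.not_mem_largeSector_self _ _ _ hp.1
  obtain ⟨ε₀, hε₀, hball⟩ := exists_small_smul_mem_ball (γ s) (γ.fwd s) hρ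
  obtain ⟨θ, hθ0, hθ⟩ : ∃ θ, 0 < θ ∧ θ < min ε₀ (min 1 ((b - s) / step s)) := by
    apply exists_between
    exact lt_min hε₀ (lt_min one_pos (div_pos (by linarith [hs.2]) h0))
  rw [lt_min_iff, lt_min_iff, lt_div_iff₀ h0] at hθ
  obtain ⟨hθ1, hθ2, hθ3⟩ := hθ
  have hfl : ⌊s + θ * step s⌋ = ⌊s⌋ := by
    rw [Int.floor_eq_iff]
    constructor
    · nlinarith [Int.floor_le s]
    · nlinarith [add_step_le s]
  have hlin := γ.fwd_lin s (θ := θ) ⟨hθ0.le, hθ2.le⟩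
  have hin : γ (s + θ * step s) ∈ Metric.ball (γ s) ρ := by
    rw [hlin]; exact hball θ ⟨hθ0, hθ1⟩
  have hfq : cross2 (γ.fwd s) q ≠ 0 := by
    rcases hd with rfl | rfl
    · exact hch.wedge.left.ne'
    · rw [cross2_comm, neg_ne_zero]; exact hch.wedge.right.ne'
  have key := γ.eventually_winding_ne_of_mem_Ioo hb (s := s + θ * step s) (ν := q)
    ⟨by nlinarith [hs.1], by linarith⟩ (by rw [hfl]; nlinarith [Int.floor_le s])
    (fun hcon => by
      have := hchord _ hcon hin
      rw [hlin, add_eq_left, smul_eq_zero] at this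
      exact this.elim hθ0.ne' (γ.fwd_ne_zero s))
    (by
      rw [hfl]
      rw [fwd_eq_smul, cross2_smul_left] at hfq
      exact right_ne_zero_of_mul hfq)
  have hev : ∀ c : ℝ, ∀ᶠ ε in nhdsWithin (0 : ℝ) (Ioi 0),
      γ (s + θ * step s) + ε • (c • q) ∈ Metric.ball (γ s) ρ := by
    intro c
    have hc : ContinuousAt (fun ε : ℝ => γ (s + θ * step s) + ε • (c • q)) 0 := by fun_prop
    refine (hc.eventually_mem ?_).filter_mono nhdsWithin_le_nhds
    simpa using Metric.isOpen_ball.mem_nhds hin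
  obtain ⟨ε, ⟨⟨hne, h1⟩, h2⟩, hε⟩ :=
    (((key.and (hev 1)).and (hev (-1))).and self_mem_nhdsWithin).exists
  have hform : γ (s + θ * step s) = γ s + θ • d₁ ∨ γ (s + θ * step s) = γ s + θ • d₂ := by
    rcases hd with rfl | rfl
    · exact Or.inl hlin
    · exact Or.inr hlin
  rw [one_smul] at h1
  rw [neg_one_smul, smul_neg, ← sub_eq_add_neg] at h2
  rw [γ.winding_eq_of_isPreconnected hab (isPreconnected_smallSector_inter_ball _ _ _ _) dS hy
      ⟨hch.wedge.add_smul_mem_smallSector _ hθ0.le hform hε, h1⟩,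
    γ.winding_eq_of_isPreconnected hab hch.isPreconnected_largeSector dL hz
      ⟨hch.wedge.sub_smul_mem_largeSector _ hform hε, h2⟩]
  exact hne

end Param

end SimplePolygon

/-! ### The Jordan curve theorem for simple polygons -/

theorem mem_connectedComponentIn_of_mem_closure {α : Type*} [TopologicalSpace α] {F : Set α}
    {x y : α} (hy : y ∈ closure (connectedComponentIn F x)) (hyF : y ∈ F) :
    y ∈ connectedComponentIn F x := by
  by_cases hx : x ∈ F
  · have h1 : IsPreconnected (insert y (connectedComponentIn F x)) :=
      isPreconnected_connectedComponentIn.subset_closure (subset_insert _ _)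
        (insert_subset hy subset_closure)
    exact h1.subset_connectedComponentIn (Or.inr (mem_connectedComponentIn hx))
      (insert_subset hyF (connectedComponentIn_subset F x)) (Or.inl rfl)
  · simp [connectedComponentIn_eq_empty hx] at hy

theorem cross2_perp_sub_pos {x z : E2} (h : ‖z‖ < ‖x‖) : 0 < cross2 (perp x) (z - x) := by
  have h1 := real_inner_le_norm x z
  have h2 := real_inner_self_eq_norm_sq x
  simp only [PiLp.inner_apply, Fin.sum_univ_two, RCLike.inner_apply, conj_trivial] at h1 h2
  have h3 : cross2 (perp x) (z - x) =
      (x 0 * x 0 + x 1 * x 1) - (z 0 * x 0 + z 1 * x 1) := by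
    simp [cross2, perp]; ring
  have h4 := norm_nonneg z
  rw [h3]
  nlinarith

theorem exists_norm_gt (R : ℝ) : ∃ x : E2, R < ‖x‖ := by
  have : Nontrivial E2 := inferInstance
  obtain ⟨x, hx⟩ := NormedSpace.exists_lt_norm ℝ E2 R
  exact ⟨x, hx⟩

namespace SimplePolygon

variable {P : SimplePolygon}

theorem isClosed_boundary : IsClosed P.boundary := P.isCompact_boundary.isClosed

theorem boundary_subset_region : P.boundary ⊆ P.region := subset_union_left

namespace Param

variable (γ : P.Param) {a b : ℝ}

theorem exists_winding_eq_zero (hab : a < b) :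
    ∃ R : ℝ, ∀ x, R ≤ ‖x‖ → γ.winding a b x = 0 := by
  obtain ⟨R, hR⟩ := (γ.isCompact_loop a b).isBounded.subset_ball 0
  refine ⟨R, fun x hx => γ.winding_eq_zero hab (e := perp x) fun z hz => cross2_perp_sub_pos ?_⟩
  have := hR hz
  rw [mem_ball_zero_iff] at this
  linarith

theorem loop_period (a : ℝ) : γ.loop a (a + P.n) = P.boundary := by
  rw [loop, γ.periodic, segment_same]
  apply Subset.antisymm
  · rintro _ (⟨t, _, rfl⟩ | rfl) <;> exact γ.mem_boundary _
  · intro x hx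
    obtain ⟨t, ht, rfl⟩ := γ.exists_mem_Ico_of_mem a hx
    exact Or.inl (mem_image_of_mem _ (Ico_subset_Icc_self ht))

end Param

namespace IsChart

variable {x d₁ d₂ q : E2} {ρ : ℝ}

theorem exists_mem_sectors (h : P.IsChart x ρ d₁ d₂ q) {y : E2} (hy : y ∈ P.boundary)
    (hyb : y ∈ Metric.ball x ρ) {V : Set E2} (hV : V ∈ nhds y) :
    (smallSector x d₁ d₂ ∩ Metric.ball x ρ ∩ V).Nonempty ∧
      (largeSector x d₁ d₂ ∩ Metric.ball x ρ ∩ V).Nonempty := by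
  obtain ⟨c, hc, hcy⟩ := (h.mem_iff y hyb).1 hy
  have hev : ∀ c : ℝ, ∀ᶠ ε in nhdsWithin (0 : ℝ) (Ioi 0),
      y + ε • (c • q) ∈ Metric.ball x ρ ∩ V := by
    intro c
    have hc : ContinuousAt (fun ε : ℝ => y + ε • (c • q)) 0 := by fun_prop
    refine (hc.eventually_mem ?_).filter_mono nhdsWithin_le_nhds
    simpa using ⟨Metric.isOpen_ball.mem_nhds hyb, hV⟩
  obtain ⟨ε, ⟨h1, h2⟩, hε⟩ := (((hev 1).and (hev (-1))).and self_mem_nhdsWithin).exists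
  rw [one_smul] at h1
  rw [neg_one_smul, smul_neg, ← sub_eq_add_neg] at h2
  exact ⟨⟨_, ⟨h.wedge.add_smul_mem_smallSector _ hc hcy hε, h1.1⟩, h1.2⟩,
    ⟨_, ⟨h.wedge.sub_smul_mem_largeSector _ hcy hε, h2.1⟩, h2.2⟩⟩

theorem mem_sectors (h : P.IsChart x ρ d₁ d₂ q) {y : E2} (hy : y ∉ P.boundary)
    (hyb : y ∈ Metric.ball x ρ) :
    y ∈ smallSector x d₁ d₂ ∩ Metric.ball x ρ ∨ y ∈ largeSector x d₁ d₂ ∩ Metric.ball x ρ := by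
  rcases h.wedge.trichotomy x y with h1 | h1 | h1
  · exact Or.inl ⟨h1, hyb⟩
  · exact Or.inr ⟨h1, hyb⟩
  · exact absurd ((h.mem_iff y hyb).2 h1) hy

theorem sector_subset_component (h : P.IsChart x ρ d₁ d₂ q) {z : E2}
    (hx : x ∈ closure (connectedComponentIn P.boundaryᶜ z)) :
    smallSector x d₁ d₂ ∩ Metric.ball x ρ ⊆ connectedComponentIn P.boundaryᶜ z ∨
      largeSector x d₁ d₂ ∩ Metric.ball x ρ ⊆ connectedComponentIn P.boundaryᶜ z := by
  obtain ⟨y, hyb, hyU⟩ := mem_closure_iff_nhds.1 hx _ (Metric.ball_mem_nhds x h.pos)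
  have hyJ : y ∉ P.boundary := connectedComponentIn_subset _ _ hyU
  rw [connectedComponentIn_eq hyU]
  rcases h.mem_sectors hyJ hyb with h1 | h1
  · exact Or.inl ((isPreconnected_smallSector_inter_ball _ _ _ _).subset_connectedComponentIn h1
      h.disjoint_smallSector.subset_compl_right)
  · exact Or.inr (h.isPreconnected_largeSector.subset_connectedComponentIn h1
      h.disjoint_largeSector.subset_compl_right)

end IsChart

namespace Param

variable (γ : P.Param)

theorem apply_mem_closure_component {z : E2} (hz : z ∉ P.boundary) (s : ℝ) :
    γ s ∈ closure (connectedComponentIn P.boundaryᶜ z) := by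
  set U := connectedComponentIn P.boundaryᶜ z with hU
  have hzU : z ∈ U := mem_connectedComponentIn hz
  have hUo : IsOpen U := isClosed_boundary.isOpen_compl.connectedComponentIn
  have hclosed : IsClosed {s | γ s ∈ closure U} := isClosed_closure.preimage γ.cont
  have hopen : IsOpen {s | γ s ∈ closure U} := by
    rw [isOpen_iff_mem_nhds]
    intro s hs
    obtain ⟨ρ, d₁, d₂, q, hch, -⟩ := γ.exists_chart s
    have hnhds : γ ⁻¹' Metric.ball (γ s) ρ ∈ nhds s :=
      γ.cont.continuousAt.preimage_mem_nhds (Metric.ball_mem_nhds _ hch.pos)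
    filter_upwards [hnhds] with t ht
    rw [mem_closure_iff_nhds]
    intro V hV
    obtain ⟨h1, h2⟩ := hch.exists_mem_sectors (γ.mem_boundary t) ht hV
    rcases hch.sector_subset_component hs with h3 | h3
    · exact h1.mono fun y hy => ⟨hy.2, h3 hy.1⟩
    · exact h2.mono fun y hy => ⟨hy.2, h3 hy.1⟩
  have hne : {s | γ s ∈ closure U}.Nonempty := by
    by_contra hcon
    have hUc : closure U ⊆ U := by
      intro y hy
      apply mem_connectedComponentIn_of_mem_closure hy
      intro hyJ
      obtain ⟨t, -, rfl⟩ := γ.exists_mem_Ico_of_mem 0 hyJ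
      exact hcon ⟨t, hy⟩
    have hclopen : IsClopen U := ⟨isClosed_of_closure_subset hUc, hUo⟩
    have := hclopen.eq_univ ⟨z, hzU⟩
    exact connectedComponentIn_subset P.boundaryᶜ z (hU ▸ this ▸ mem_univ (γ 0)) (γ.mem_boundary 0)
  have := IsClopen.eq_univ ⟨hclosed, hopen⟩ hne
  exact eq_univ_iff_forall.1 this s

theorem chord_period (s a : ℝ) {ρ : ℝ} : ∀ y ∈ segment ℝ (γ (a + P.n)) (γ a),
    γ a = γ s → y ∈ Metric.ball (γ s) ρ → y = γ s := by
  intro y hy h _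
  rw [γ.periodic, segment_same] at hy
  rw [← h]; exact hy

theorem winding_period_eq (a : ℝ) {S : Set E2} (hS : IsPreconnected S)
    (hd : Disjoint S P.boundary) {x y : E2} (hx : x ∈ S) (hy : y ∈ S) :
    γ.winding a (a + P.n) x = γ.winding a (a + P.n) y :=
  γ.winding_eq_of_isPreconnected (by linarith [P.n_pos_real]) hS (by rwa [loop_period]) hx hy

theorem winding_period_ne {a ρ : ℝ} {d₁ d₂ q : E2} (hch : P.IsChart (γ a) ρ d₁ d₂ q)
    (hd : d₁ = γ.fwd a ∨ d₂ = γ.fwd a) {y z : E2}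
    (hy : y ∈ smallSector (γ a) d₁ d₂ ∩ Metric.ball (γ a) ρ)
    (hz : z ∈ largeSector (γ a) d₁ d₂ ∩ Metric.ball (γ a) ρ) :
    γ.winding a (a + P.n) y ≠ γ.winding a (a + P.n) z :=
  γ.winding_ne_of_sectors le_rfl ⟨le_rfl, by linarith [P.n_pos_real]⟩ hch hd
    (fun y hy => γ.chord_period a a y hy rfl) hy hz

theorem component_eq_of_winding_eq {a : ℝ} {x y : E2} (hx : x ∉ P.boundary) (hy : y ∉ P.boundary)
    (h : γ.winding a (a + P.n) x = γ.winding a (a + P.n) y) :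
    connectedComponentIn P.boundaryᶜ x = connectedComponentIn P.boundaryᶜ y := by
  obtain ⟨ρ, d₁, d₂, q, hch, hd⟩ := γ.exists_chart a
  have hd' : d₁ = γ.fwd a ∨ d₂ = γ.fwd a := hd.imp (·.1) (·.2)
  obtain ⟨⟨p, hp, -⟩, ⟨r, hr, -⟩⟩ := hch.exists_mem_sectors (γ.mem_boundary a)
    (Metric.mem_ball_self hch.pos) Filter.univ_mem
  have hconst : ∀ z ∉ P.boundary, ∀ u ∈ connectedComponentIn P.boundaryᶜ z,
      γ.winding a (a + P.n) u = γ.winding a (a + P.n) z := by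
    intro z hz u hu
    exact γ.winding_period_eq a isPreconnected_connectedComponentIn
      (disjoint_compl_left.mono_left (connectedComponentIn_subset _ _)) hu
      (mem_connectedComponentIn hz)
  have hne := γ.winding_period_ne hch hd' hp hr
  rcases hch.sector_subset_component (γ.apply_mem_closure_component hx a) with h1 | h1 <;>
  rcases hch.sector_subset_component (γ.apply_mem_closure_component hy a) with h2 | h2
  · rw [connectedComponentIn_eq (h1 hp), connectedComponentIn_eq (h2 hp)]
  · exact absurd ((hconst x hx p (h1 hp)).trans (h.trans (hconst y hy r (h2 hr)).symm)) hne
  · exact absurd ((hconst y hy p (h2 hp)).trans (h.symm.trans (hconst x hx r (h1 hr)).symm)) hne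
  · rw [connectedComponentIn_eq (h1 hr), connectedComponentIn_eq (h2 hr)]

theorem mem_region_iff (a : ℝ) {x : E2} (hx : x ∉ P.boundary) :
    x ∈ P.region ↔ γ.winding a (a + P.n) x ≠ 0 := by
  have hn := P.n_pos_real
  obtain ⟨R, hR⟩ := γ.exists_winding_eq_zero (a := a) (b := a + P.n) (by linarith)
  obtain ⟨R', hR'⟩ := P.isCompact_boundary.isBounded.subset_ball 0
  have hfar : ∀ y : E2, R' ≤ ‖y‖ → y ∉ P.boundary := by
    intro y hy hyJ
    have := hR' hyJ
    rw [mem_ball_zero_iff] at this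
    linarith
  have h1 : x ∈ P.region ↔ Bornology.IsBounded (connectedComponentIn P.boundaryᶜ x) := by
    simp [region, hx]
  rw [h1]
  constructor
  · intro hb h0
    obtain ⟨B, hB⟩ := hb.subset_ball 0
    obtain ⟨y, hy⟩ := exists_norm_gt (max (max R R') B)
    have hyR : R ≤ ‖y‖ := ((le_max_left _ _).trans (le_max_left _ _)).trans hy.le
    have hyR' : R' ≤ ‖y‖ := ((le_max_right _ _).trans (le_max_left _ _)).trans hy.le
    have hyB : B ≤ ‖y‖ := (le_max_right _ _).trans hy.le
    have := γ.component_eq_of_winding_eq hx (hfar y hyR') (h0.trans (hR y hyR).symm)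
    rw [this] at hB
    have h2 := hB (mem_connectedComponentIn (hfar y hyR'))
    rw [mem_ball_zero_iff] at h2
    linarith
  · intro h0
    refine (Metric.isBounded_ball (x := (0 : E2)) (r := R)).subset fun y hy => ?_
    rw [mem_ball_zero_iff]
    by_contra hcon
    apply h0
    rw [← hR y (not_lt.1 hcon)]
    exact γ.winding_period_eq a isPreconnected_connectedComponentIn
      (disjoint_compl_left.mono_left (connectedComponentIn_subset _ _))
      (mem_connectedComponentIn hx) hy

end Param

theorem mem_region_of_isPreconnected {S : Set E2} (hS : IsPreconnected S)
    (hd : Disjoint S P.boundary) {x y : E2} (hx : x ∈ S) (hy : y ∈ S) (hxr : x ∈ P.region) :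
    y ∈ P.region := by
  rw [P.param.mem_region_iff 0 (Set.disjoint_left.1 hd hx)] at hxr
  rw [P.param.mem_region_iff 0 (Set.disjoint_left.1 hd hy)]
  rwa [P.param.winding_period_eq 0 hS hd hy hx]

theorem isBounded_region : Bornology.IsBounded P.region := by
  have hn := P.n_pos_real
  obtain ⟨R, hR⟩ := P.param.exists_winding_eq_zero (a := 0) (b := 0 + P.n) (by linarith)
  have : P.region ⊆ P.boundary ∪ Metric.ball 0 R := by
    intro x hx
    by_cases hxJ : x ∈ P.boundary
    · exact Or.inl hxJ
    · right
      rw [mem_ball_zero_iff]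
      by_contra hcon
      exact (P.param.mem_region_iff 0 hxJ).1 hx (hR x (not_lt.1 hcon))
  exact (P.isCompact_boundary.isBounded.union Metric.isBounded_ball).subset this

theorem compl_region_eq {x : E2} (hx : x ∉ P.region) :
    P.regionᶜ = connectedComponentIn P.boundaryᶜ x := by
  have hxJ : x ∉ P.boundary := fun h => hx (boundary_subset_region h)
  apply Subset.antisymm
  · intro y hy
    have hyJ : y ∉ P.boundary := fun h => hy (boundary_subset_region h)
    have h1 := (P.param.mem_region_iff 0 hxJ).not.1 hx
    have h2 := (P.param.mem_region_iff 0 hyJ).not.1 hy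
    rw [not_not] at h1 h2
    rw [P.param.component_eq_of_winding_eq hxJ hyJ (h1.trans h2.symm)]
    exact mem_connectedComponentIn hyJ
  · intro y hy hyr
    exact hx (mem_region_of_isPreconnected isPreconnected_connectedComponentIn
      (disjoint_compl_left.mono_left (connectedComponentIn_subset _ _)) hy
      (mem_connectedComponentIn hxJ) hyr)

theorem exists_norm_gt_not_mem_region (R : ℝ) : ∃ x, x ∉ P.region ∧ R < ‖x‖ := by
  obtain ⟨B, hB⟩ := P.isBounded_region.subset_ball 0
  obtain ⟨y, hy⟩ := exists_norm_gt (max R B)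
  refine ⟨y, fun h => ?_, (le_max_left _ _).trans_lt hy⟩
  have := hB h
  rw [mem_ball_zero_iff] at this
  linarith [le_max_right R B]

theorem isPreconnected_compl_region : IsPreconnected P.regionᶜ := by
  obtain ⟨x, hx, -⟩ := P.exists_norm_gt_not_mem_region 0
  rw [compl_region_eq hx]
  exact isPreconnected_connectedComponentIn

/-- The interior of the polygon. -/
def inside (P : SimplePolygon) : Set E2 := P.region \ P.boundary

theorem isOpen_inside : IsOpen P.inside := by
  rw [Metric.isOpen_iff]
  rintro x ⟨hx, hxJ⟩
  obtain ⟨r, hr, hb⟩ := Metric.isOpen_iff.1 isClosed_boundary.isOpen_compl x hxJ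
  refine ⟨r, hr, fun y hy => ⟨?_, hb hy⟩⟩
  exact mem_region_of_isPreconnected (convex_ball x r).isPreconnected
    (subset_compl_iff_disjoint_right.1 hb) (Metric.mem_ball_self hr) hy hx

theorem subset_inside_of_isPreconnected {S : Set E2} (hS : IsPreconnected S)
    (hd : Disjoint S P.boundary) {x : E2} (hx : x ∈ S) (hxr : x ∈ P.region) : S ⊆ P.inside :=
  fun _ hy => ⟨mem_region_of_isPreconnected hS hd hx hy hxr, Set.disjoint_left.1 hd hy⟩

namespace Param

variable (γ : P.Param)

theorem apply_mem_closure_compl_region (s : ℝ) : γ s ∈ closure P.regionᶜ := by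
  obtain ⟨x, hx, -⟩ := P.exists_norm_gt_not_mem_region 0
  rw [compl_region_eq hx]
  exact γ.apply_mem_closure_component (fun h => hx (boundary_subset_region h)) s

/-- At every boundary point exactly one of the two sectors belongs to the polygon. -/
theorem sector_dichotomy {s ρ : ℝ} {d₁ d₂ q : E2} (hch : P.IsChart (γ s) ρ d₁ d₂ q)
    (hd : d₁ = γ.fwd s ∨ d₂ = γ.fwd s) :
    (smallSector (γ s) d₁ d₂ ∩ Metric.ball (γ s) ρ ⊆ P.inside ∧
      largeSector (γ s) d₁ d₂ ∩ Metric.ball (γ s) ρ ⊆ P.regionᶜ) ∨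
    (largeSector (γ s) d₁ d₂ ∩ Metric.ball (γ s) ρ ⊆ P.inside ∧
      smallSector (γ s) d₁ d₂ ∩ Metric.ball (γ s) ρ ⊆ P.regionᶜ) := by
  obtain ⟨x, hx, -⟩ := P.exists_norm_gt_not_mem_region 0
  have hxJ : x ∉ P.boundary := fun h => hx (boundary_subset_region h)
  have hw : ∀ z, z ∉ P.region → γ.winding s (s + P.n) z = 0 := by
    intro z hz
    by_contra hcon
    exact hz ((γ.mem_region_iff s fun h => hz (boundary_subset_region h)).2 hcon)
  obtain ⟨⟨p, hp, -⟩, ⟨r, hr, -⟩⟩ := hch.exists_mem_sectors (γ.mem_boundary s)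
    (Metric.mem_ball_self hch.pos) Filter.univ_mem
  have h := hch.sector_subset_component (γ.apply_mem_closure_component hxJ s)
  rw [← compl_region_eq hx] at h
  rcases h with h1 | h1
  · refine Or.inr ⟨fun y hy => ?_, h1⟩
    have hyJ := Set.disjoint_left.1 hch.disjoint_largeSector hy
    refine ⟨(γ.mem_region_iff s hyJ).2 fun h0 => ?_, hyJ⟩
    exact γ.winding_period_ne hch hd hp hy ((hw p (h1 hp)).trans h0.symm)
  · refine Or.inl ⟨fun y hy => ?_, h1⟩
    have hyJ := Set.disjoint_left.1 hch.disjoint_smallSector hy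
    refine ⟨(γ.mem_region_iff s hyJ).2 fun h0 => ?_, hyJ⟩
    exact γ.winding_period_ne hch hd hy hr (h0.trans (hw r (h1 hr)).symm)

theorem winding_eq_zero_of_not_mem_region {a b : ℝ} (hab : a < b)
    (hchord : segment ℝ (γ b) (γ a) ⊆ P.region) {x : E2} (hx : x ∉ P.region) :
    γ.winding a b x = 0 := by
  obtain ⟨R, hR⟩ := γ.exists_winding_eq_zero hab
  obtain ⟨y, hy, hyR⟩ := P.exists_norm_gt_not_mem_region R
  rw [← hR y hyR.le]
  refine γ.winding_eq_of_isPreconnected hab P.isPreconnected_compl_region ?_ hx hy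
  rw [disjoint_compl_left_iff_subset]
  rintro z (⟨t, _, rfl⟩ | hz)
  · exact boundary_subset_region (γ.mem_boundary t)
  · exact hchord hz

/-- Points around which the loop winds belong to the polygon's interior. -/
theorem mem_inside_of_winding_ne_zero {a b : ℝ} (hab : a < b)
    (hchord : segment ℝ (γ b) (γ a) ⊆ P.region) {x : E2} (hx : γ.winding a b x ≠ 0)
    (hxl : x ∉ γ.loop a b) : x ∈ P.inside := by
  have hr : ∀ y, γ.winding a b y ≠ 0 → y ∈ P.region := fun y hy => by
    by_contra hcon
    exact hy (γ.winding_eq_zero_of_not_mem_region hab hchord hcon)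
  refine ⟨hr x hx, fun hxJ => ?_⟩
  obtain ⟨r, hr0, hb⟩ := Metric.isOpen_iff.1 (γ.isCompact_loop a b).isClosed.isOpen_compl x hxl
  obtain ⟨t, -, rfl⟩ := γ.exists_mem_Ico_of_mem 0 hxJ
  obtain ⟨y, hyb, hy⟩ := mem_closure_iff_nhds.1 (γ.apply_mem_closure_compl_region t) _
    (Metric.ball_mem_nhds _ hr0)
  refine hy (hr y ?_)
  rwa [γ.winding_eq_of_isPreconnected hab (convex_ball _ r).isPreconnected
    (subset_compl_iff_disjoint_right.1 hb) hyb (Metric.mem_ball_self hr0)]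

end Param

end SimplePolygon

namespace SimplePolygon

variable {P : SimplePolygon}

namespace Param

variable (γ : P.Param)

theorem isClosed_chord (a b : E2) : IsClosed (segment ℝ a b) := by
  rw [segment_eq_image']
  exact (isCompact_Icc.image (by fun_prop)).isClosed

/-- A chord of the polygon separates the two boundary arcs that it cuts off. -/
theorem not_mem_of_chord {a b : ℝ} (hab : a < b) (hba : b < a + P.n)
    (hchord : segment ℝ (γ b) (γ a) ⊆ P.region) {T : Set E2} (hT : IsPreconnected T)
    (hTr : T ⊆ P.region \ segment ℝ (γ b) (γ a)) {s t : ℝ} (hs : s ∈ Ioo a b)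
    (ht : t ∈ Ioo b (a + P.n)) (hsT : γ s ∈ T) : γ t ∉ T := by
  intro htT
  set Q : E2 → Prop := fun x => x ∈ γ '' Ioo a b ∨ (x ∉ P.boundary ∧ γ.winding a b x ≠ 0) with hQ
  have hQs : Q (γ s) := Or.inl (mem_image_of_mem _ hs)
  have hnot : ∀ t ∈ Ioo b (a + P.n), γ t ∉ γ '' Icc a b := by
    rintro t ht ⟨t', ht', h⟩
    exact γ.apply_ne (by linarith [ht.1, ht'.2]) (by linarith [ht.2, ht'.1]) h
  have hQt : ¬ Q (γ t) := by
    rintro (h | h)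
    · exact hnot t ht (image_mono Ioo_subset_Icc_self h)
    · exact h.1 (γ.mem_boundary t)
  refine hQt ((hT.induction₂' (fun x y => Q x ↔ Q y) ?_
    (fun x y z _ _ _ => Iff.trans) hsT htT).1 hQs)
  intro x hx
  suffices ∀ᶠ y in nhdsWithin x T, Q x ↔ Q y from this.mono fun y h => ⟨h, h.symm⟩
  rw [eventually_nhdsWithin_iff]
  have hxc := (hTr hx).2
  by_cases hxJ : x ∈ P.boundary
  · obtain ⟨r, hr, rfl⟩ := γ.exists_mem_Ico_of_mem a hxJ
    have hra : r ≠ a := by rintro rfl; exact hxc (right_mem_segment _ _ _)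
    have hrb : r ≠ b := by rintro rfl; exact hxc (left_mem_segment _ _ _)
    have hra' : a < r := lt_of_le_of_ne hr.1 hra.symm
    rcases lt_or_gt_of_ne hrb with hrb | hrb
    · obtain ⟨ρ, d₁, d₂, q, hch, hd⟩ := γ.exists_chart r
      have hd' : d₁ = γ.fwd r ∨ d₂ = γ.fwd r := hd.imp (·.1) (·.2)
      have hcl : IsClosed (segment ℝ (γ b) (γ a) ∪ γ '' Icc b (a + P.n)) :=
        (isClosed_chord _ _).union (isCompact_Icc.image γ.cont).isClosed
      have hxcl : γ r ∉ segment ℝ (γ b) (γ a) ∪ γ '' Icc b (a + P.n) := by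
        rintro (h | ⟨t, ht, h⟩)
        · exact hxc h
        · exact γ.apply_ne (by linarith [ht.1]) (by linarith [ht.2]) h.symm
      obtain ⟨ρ', hρ', hball⟩ := Metric.isOpen_iff.1 hcl.isOpen_compl _ hxcl
      have hmin : 0 < min ρ ρ' := lt_min hch.pos hρ'
      have hch' := hch.mono hmin (min_le_left _ _)
      filter_upwards [Metric.ball_mem_nhds (γ r) hmin] with y hy hyT
      have hQr : Q (γ r) := Or.inl (mem_image_of_mem _ ⟨hra', hrb⟩)
      have hyb := hball (Metric.ball_subset_ball (min_le_right _ _) hy)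
      refine ⟨fun _ => ?_, fun _ => hQr⟩
      by_cases hyJ : y ∈ P.boundary
      · obtain ⟨t, ht, rfl⟩ := γ.exists_mem_Ico_of_mem a hyJ
        refine Or.inl ⟨t, ⟨lt_of_le_of_ne ht.1 ?_, ?_⟩, rfl⟩
        · rintro rfl; exact hyb (Or.inl (right_mem_segment _ _ _))
        · by_contra hcon
          exact hyb (Or.inr ⟨t, ⟨not_lt.1 hcon, ht.2.le⟩, rfl⟩)
      · refine Or.inr ⟨hyJ, fun h0 => ?_⟩
        have hyr := (hTr hyT).1
        have hc : ∀ y ∈ segment ℝ (γ b) (γ a), y ∈ Metric.ball (γ r) (min ρ ρ') → y = γ r :=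
          fun z hz hzb => absurd (Or.inl hz)
            (hball (Metric.ball_subset_ball (min_le_right _ _) hzb))
        obtain ⟨⟨p, hp, -⟩, ⟨r', hr', -⟩⟩ := hch'.exists_mem_sectors (γ.mem_boundary r)
          (Metric.mem_ball_self hch'.pos) Filter.univ_mem
        rcases γ.sector_dichotomy hch' hd' with ⟨h1, h2⟩ | ⟨h1, h2⟩ <;>
        rcases hch'.mem_sectors hyJ hy with h3 | h3
        · refine γ.winding_ne_of_sectors hba.le ⟨hra'.le, hrb⟩ hch' hd' hc h3 hr' ?_
          rw [h0, γ.winding_eq_zero_of_not_mem_region hab hchord (h2 hr')]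
        · exact h2 h3 hyr
        · exact h2 h3 hyr
        · refine γ.winding_ne_of_sectors hba.le ⟨hra'.le, hrb⟩ hch' hd' hc hp h3 ?_
          rw [h0, γ.winding_eq_zero_of_not_mem_region hab hchord (h2 hp)]
    · have hrl : γ r ∉ γ.loop a b := by
        rintro (h | h)
        · exact hnot r ⟨hrb, hr.2⟩ h
        · exact hxc h
      obtain ⟨ρ, hρ, hball⟩ := Metric.isOpen_iff.1 (γ.isCompact_loop a b).isClosed.isOpen_compl
        _ hrl
      filter_upwards [Metric.ball_mem_nhds (γ r) hρ] with y hy hyT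
      refine ⟨?_, ?_⟩
      · rintro (h | h)
        · exact absurd (Or.inl (image_mono Ioo_subset_Icc_self h)) hrl
        · exact absurd (γ.mem_boundary r) h.1
      · rintro (h | h)
        · exact absurd (Or.inl (image_mono Ioo_subset_Icc_self h)) (hball hy)
        · obtain ⟨z, hz, hzr⟩ := mem_closure_iff_nhds.1 (γ.apply_mem_closure_compl_region r) _
            (Metric.ball_mem_nhds _ hρ)
          refine absurd ?_ h.2
          rw [← γ.winding_eq_zero_of_not_mem_region hab hchord hzr]
          exact γ.winding_eq_of_isPreconnected hab (convex_ball _ ρ).isPreconnected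
            (subset_compl_iff_disjoint_right.1 hball) hy hz
  · have hcl : IsClosed (P.boundary ∪ segment ℝ (γ b) (γ a)) :=
      isClosed_boundary.union (isClosed_chord _ _)
    obtain ⟨ρ, hρ, hball⟩ := Metric.isOpen_iff.1 hcl.isOpen_compl x
      (by rintro (h | h); exacts [hxJ h, hxc h])
    filter_upwards [Metric.ball_mem_nhds x hρ] with y hy hyT
    have hyJ : y ∉ P.boundary := fun h => hball hy (Or.inl h)
    have himg : ∀ z, z ∈ γ '' Ioo a b → z ∈ P.boundary := by
      rintro _ ⟨t, _, rfl⟩; exact γ.mem_boundary t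
    have hw : γ.winding a b x = γ.winding a b y := by
      refine γ.winding_eq_of_isPreconnected hab (convex_ball x ρ).isPreconnected ?_
        (Metric.mem_ball_self hρ) hy
      rw [Set.disjoint_left]
      rintro z hz (⟨t, _, rfl⟩ | h)
      · exact hball hz (Or.inl (γ.mem_boundary t))
      · exact hball hz (Or.inr h)
    have hx' : x ∉ γ '' Ioo a b := fun h => hxJ (himg x h)
    have hy' : y ∉ γ '' Ioo a b := fun h => hyJ (himg y h)
    simp only [hQ, hxJ, hyJ, hw, hx', hy']

end Param

end SimplePolygon

/-! ### Reflex vertices and the cuts they generate -/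

theorem cross2_smul_eq (d₁ d₂ y : E2) :
    cross2 d₁ d₂ • y = cross2 y d₂ • d₁ + cross2 d₁ y • d₂ := by
  ext i; fin_cases i <;> simp [cross2] <;> ring

namespace Wedge

variable {d₁ d₂ q : E2}

/-- A wedge of directions on the nonpositive side of `e` spans only nonpositive vectors. -/
theorem cross2_pos_and_not_mem_smallSector (h : Wedge d₁ d₂ q) {e : E2} (h1 : cross2 e d₁ ≤ 0)
    (h2 : cross2 e d₂ ≤ 0) (h12 : cross2 e d₁ < 0 ∨ cross2 e d₂ < 0) :
    0 < cross2 d₁ d₂ ∧ ∀ x y, 0 < cross2 e (y - x) → y ∉ smallSector x d₁ d₂ := by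
  have hpos : 0 < cross2 d₁ d₂ := by
    refine lt_of_le_of_ne h.nonneg fun h0 => ?_
    obtain ⟨c, rfl⟩ := exists_smul_of_cross2_eq_zero h.ne_zero_left h0.symm
    have h3 := h.right
    have h4 := h.left
    rw [cross2_smul_right, cross2_comm] at h3
    rw [cross2_smul_right] at h2 h12
    have hc : c < 0 := by nlinarith
    have : cross2 e d₁ = 0 := le_antisymm h1 (by nlinarith)
    simp [this] at h12
  refine ⟨hpos, fun x y hy hmem => ?_⟩
  have := congrArg (cross2 e) (cross2_smul_eq d₁ d₂ (y - x))
  rw [cross2_add_right, cross2_smul_right, cross2_smul_right, cross2_smul_right] at this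
  nlinarith [hmem.1, hmem.2, mul_pos hpos hy]

end Wedge

namespace SimplePolygon

variable {P : SimplePolygon}

theorem Cut.w_eq (C : P.Cut) : C.w = C.v + C.t • (C.v - C.u) := rfl

namespace Param

variable (γ : P.Param)

theorem vert_eq : ∃ (i : ℤ → ZMod P.n) (σ : ZMod P.n), (σ = 1 ∨ σ = -1) ∧
    (∀ k : ℤ, γ k = P.vtx (i k)) ∧ (∀ k : ℤ, i (k + 1) = i k + σ) := by
  obtain ⟨i, σ, hσ, h⟩ := γ.vert
  refine ⟨fun k => i + ((σ * k : ℤ) : ZMod P.n), σ, ?_, h, fun k => ?_⟩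
  · rcases hσ with rfl | rfl <;> simp
  · push_cast; ring

/-- The midpoints occurring in the definition of a reflex vertex. -/
theorem midpoint_eq {i : ZMod P.n} {k : ℤ} (hi : γ k = P.vtx i)
    (h : (P.vtx (i + 1) = γ (k + 1) ∧ P.vtx (i - 1) = γ (k - 1)) ∨
      (P.vtx (i + 1) = γ (k - 1) ∧ P.vtx (i - 1) = γ (k + 1))) (ε : ℝ) :
    midpoint ℝ (P.vtx i + ε • (P.vtx (i - 1) - P.vtx i))
      (P.vtx i + ε • (P.vtx (i + 1) - P.vtx i)) = γ k + (ε / 2) • (γ.fwd k + γ.bwd k) := by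
  rw [midpoint_eq_smul_add, γ.fwd_int, γ.bwd_int, ← hi, invOf_eq_inv]
  rcases h with ⟨h1, h2⟩ | ⟨h1, h2⟩ <;> rw [h1, h2] <;> module

theorem vtx_neighbours (k : ℤ) : ∃ i : ZMod P.n, γ k = P.vtx i ∧
    ((P.vtx (i + 1) = γ (k + 1) ∧ P.vtx (i - 1) = γ (k - 1)) ∨
      (P.vtx (i + 1) = γ (k - 1) ∧ P.vtx (i - 1) = γ (k + 1))) ∧
    ∃ j, (j = i + 1 ∨ j = i - 1) ∧ P.vtx j = γ (k + 1) := by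
  obtain ⟨i, σ, hσ, h1, h2⟩ := γ.vert_eq
  have e1 := h1 (k + 1)
  have e2 := h1 (k - 1)
  have e3 := h2 (k - 1)
  rw [sub_add_cancel] at e3
  push_cast at e1 e2
  refine ⟨i k, h1 k, ?_, i (k + 1), ?_, e1.symm⟩
  · rw [e1, e2, h2, e3]
    rcases hσ with rfl | rfl
    · left; simp
    · right; simp [sub_eq_add_neg]
  · rw [h2]
    rcases hσ with rfl | rfl
    · left; rfl
    · right; ring

theorem exists_first_hit {x d : E2} (hd : d ≠ 0) {δ : ℝ} (hδ : 0 < δ)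
    (hin : ∀ t ∈ Ioo 0 δ, x + t • d ∈ P.inside) :
    ∃ t : ℝ, 0 < t ∧ x + t • d ∈ P.boundary ∧ ∀ s ∈ Ioo 0 t, x + s • d ∈ P.inside := by
  have hcont : Continuous fun t : ℝ => x + t • d := by fun_prop
  set H : Set ℝ := {t | δ / 2 ≤ t ∧ x + t • d ∈ P.boundary} with hH
  have hHc : IsClosed H := isClosed_Ici.inter (isClosed_boundary.preimage hcont)
  have hin0 := hin (δ / 2) ⟨by linarith, by linarith⟩
  have hrun : ∀ S : Set ℝ, IsPreconnected S → δ / 2 ∈ S → (∀ t ∈ S, x + t • d ∉ P.boundary) →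
      ∀ t ∈ S, x + t • d ∈ P.inside := by
    intro S hS h0 hJ t ht
    refine subset_inside_of_isPreconnected (hS.image _ hcont.continuousOn) ?_
      (mem_image_of_mem _ h0) hin0.1 (mem_image_of_mem _ ht)
    rw [Set.disjoint_left]
    rintro _ ⟨t, ht, rfl⟩
    exact hJ t ht
  have hne : H.Nonempty := by
    by_contra hcon
    have h1 := hrun (Ici (δ / 2)) isPreconnected_Ici self_mem_Ici
      fun t ht hJ => hcon ⟨t, ht, hJ⟩
    obtain ⟨R, hR⟩ := P.isBounded_region.subset_ball x
    have hdn := norm_pos_iff.2 hd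
    have h2 := hR (h1 (max (δ / 2) (R / ‖d‖)) (mem_Ici.2 (le_max_left _ _))).1
    have h3 : (0 : ℝ) ≤ max (δ / 2) (R / ‖d‖) := by
      exact le_max_of_le_left (by linarith)
    rw [mem_ball_iff_norm, add_sub_cancel_left, norm_smul, Real.norm_of_nonneg h3] at h2
    have h4 := (div_le_iff₀ hdn).1 (le_max_right (δ / 2) (R / ‖d‖))
    linarith
  have hbdd : BddBelow H := ⟨δ / 2, fun t ht => ht.1⟩
  have hmem := hHc.csInf_mem hne hbdd
  refine ⟨sInf H, by linarith [hmem.1], hmem.2, ?_⟩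
  have hlt : δ / 2 < sInf H := by
    refine lt_of_le_of_ne hmem.1 fun h => ?_
    exact hin0.2 (h ▸ hmem.2)
  refine hrun _ isPreconnected_Ioo ⟨by linarith, hlt⟩ fun t ht hJ => ?_
  by_cases htδ : t < δ
  · exact (hin t ⟨ht.1, htδ⟩).2 hJ
  · exact absurd (csInf_le hbdd ⟨by linarith, hJ⟩) (not_le.2 ht.2)

/-- A boundary point at which the polygon contains points above both boundary directions is a
reflex vertex, and generates a cut going upwards. -/
theorem exists_cut_of_up {s : ℝ} {e : E2} (hf : cross2 e (γ.fwd s) < 0)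
    (hb : cross2 e (γ.bwd s) ≤ 0)
    (hin : ∀ r > 0, ∃ y ∈ Metric.ball (γ s) r, 0 < cross2 e (y - γ s) ∧ y ∈ P.inside) :
    ∃ k : ℤ, s = k ∧ ∃ C : P.Cut, C.v = γ k ∧ C.u = γ (k + 1) ∧
      ∀ t ∈ Ioo 0 C.t, C.v + t • (C.v - C.u) ∈ P.inside := by
  have hinteger : (⌊s⌋ : ℝ) = s := by
    by_contra hne
    rw [γ.bwd_eq_neg_fwd hne, cross2_neg_right] at hb
    linarith
  obtain ⟨k, rfl⟩ : ∃ k : ℤ, s = k := ⟨⌊s⌋, hinteger.symm⟩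
  refine ⟨k, rfl, ?_⟩
  obtain ⟨ρ, d₁, d₂, q, hch, hd⟩ := γ.exists_chart k
  have hd' : d₁ = γ.fwd k ∨ d₂ = γ.fwd k := hd.imp (·.1) (·.2)
  have hle : cross2 e d₁ ≤ 0 ∧ cross2 e d₂ ≤ 0 ∧ (cross2 e d₁ < 0 ∨ cross2 e d₂ < 0) := by
    rcases hd with ⟨rfl, rfl⟩ | ⟨rfl, rfl⟩
    · exact ⟨hf.le, hb, Or.inl hf⟩
    · exact ⟨hb, hf.le, Or.inr hf⟩
  obtain ⟨hpos, hsm⟩ := hch.wedge.cross2_pos_and_not_mem_smallSector hle.1 hle.2.1 hle.2.2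
  have hup : ∀ y ∈ Metric.ball (γ k) ρ, 0 < cross2 e (y - γ k) →
      y ∈ largeSector (γ k) d₁ d₂ ∩ Metric.ball (γ k) ρ := by
    intro y hy hey
    refine ⟨?_, hy⟩
    rcases hch.wedge.trichotomy (γ k) y with h | h | ⟨c, hc, rfl | rfl⟩
    · exact absurd h (hsm _ _ hey)
    · exact h
    · rw [add_sub_cancel_left, cross2_smul_right] at hey
      nlinarith [hle.1]
    · rw [add_sub_cancel_left, cross2_smul_right] at hey
      nlinarith [hle.2.1]
  obtain ⟨y, hyb, hey, hyin⟩ := hin ρ hch.pos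
  obtain ⟨hL, hS⟩ := (γ.sector_dichotomy hch hd').resolve_left
    fun h => h.2 (hup y hyb hey) hyin.1
  obtain ⟨i, hi, hnb, j, hj, hjk⟩ := γ.vtx_neighbours k
  have hreflex : P.IsReflex i := by
    obtain ⟨ε₀, hε₀, hball⟩ := exists_small_smul_mem_ball (γ k) (γ.fwd k + γ.bwd k) hch.pos
    refine ⟨ε₀, hε₀, fun ε hε => ?_⟩
    rw [γ.midpoint_eq hi hnb]
    have hε2 : 0 < ε / 2 := by linarith [hε.1]
    refine hS ⟨?_, hball _ ⟨hε2, by linarith [hε.1, hε.2]⟩⟩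
    have hsum : γ.fwd k + γ.bwd k = d₁ + d₂ := by
      rcases hd with ⟨rfl, rfl⟩ | ⟨rfl, rfl⟩
      · rfl
      · exact add_comm _ _
    rw [hsum]
    have := mul_pos hε2 hpos
    constructor <;>
    simpa [cross2_smul_left, cross2_smul_right, cross2_add_left, cross2_add_right, cross2_self]
      using this
  obtain ⟨ε₀, hε₀, hball⟩ := exists_small_smul_mem_ball (γ k) (P.vtx i - P.vtx j) hch.pos
  have hne : P.vtx i - P.vtx j ≠ 0 := by
    rw [← hi, hjk, sub_ne_zero]
    exact γ.apply_ne (by linarith) (by linarith [P.n_pos_real])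
  have hinside : ∀ t ∈ Ioo 0 ε₀, P.vtx i + t • (P.vtx i - P.vtx j) ∈ P.inside := by
    intro t ht
    have h1 := hball t ht
    rw [← hi]
    refine hL (hup _ (hi ▸ h1) ?_)
    rw [add_sub_cancel_left, cross2_smul_right, hjk, ← neg_sub, ← γ.fwd_int, cross2_neg_right]
    nlinarith [ht.1]
  obtain ⟨t, ht, hhit, hbefore⟩ := exists_first_hit hne hε₀ hinside
  refine ⟨⟨i, j, hj, hreflex, t, ht, hhit, fun s hs => (hbefore s hs).2, ?_⟩, hi.symm, hjk,
    hbefore⟩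
  rw [segment_eq_image']
  rintro _ ⟨θ, hθ, rfl⟩
  simp only [add_sub_cancel_left, smul_smul]
  rcases hθ.1.eq_or_lt with rfl | h0
  · rw [zero_mul, zero_smul, add_zero, ← hi]
    exact boundary_subset_region (γ.mem_boundary _)
  rcases hθ.2.eq_or_lt with rfl | h1
  · rw [one_mul]; exact boundary_subset_region hhit
  · exact (hbefore _ ⟨mul_pos h0 ht, by nlinarith⟩).1

end Param

end SimplePolygon

/-! ### Comparing pockets -/

namespace SimplePolygon

variable {P : SimplePolygon}

namespace Cut

variable (C : P.Cut)

theorem seg_eq_image : C.seg = (fun θ : ℝ => C.v + θ • (C.v - C.u)) '' Icc 0 C.t := by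
  have ht := C.t_pos
  rw [seg, segment_eq_image', C.w_eq]
  apply Subset.antisymm
  · rintro _ ⟨θ, hθ, rfl⟩
    refine ⟨θ * C.t, ⟨mul_nonneg hθ.1 ht.le, by nlinarith [hθ.2]⟩, ?_⟩
    simp [smul_smul]
  · rintro _ ⟨θ, hθ, rfl⟩
    refine ⟨θ / C.t, ⟨div_nonneg hθ.1 ht.le, (div_le_one ht).2 hθ.2⟩, ?_⟩
    simp [smul_smul, div_mul_cancel₀ _ ht.ne']

theorem v_mem_seg : C.v ∈ C.seg := left_mem_segment _ _ _

theorem w_mem_seg : C.w ∈ C.seg := right_mem_segment _ _ _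

theorem v_mem_boundary : C.v ∈ P.boundary :=
  mem_iUnion.2 ⟨C.i, left_mem_segment _ _ _⟩

theorem w_mem_boundary : C.w ∈ P.boundary := C.hits

theorem seg_subset_region : C.seg ⊆ P.region := C.inside

theorem eq_v_or_eq_w {y : E2} (hy : y ∈ C.seg) (hyJ : y ∈ P.boundary) : y = C.v ∨ y = C.w := by
  rw [seg_eq_image] at hy
  obtain ⟨θ, hθ, rfl⟩ := hy
  rcases hθ.1.eq_or_lt with rfl | h0
  · left; simp
  rcases hθ.2.eq_or_lt with rfl | h1
  · right; rfl
  · exact absurd hyJ (C.first_hit θ ⟨h0, h1⟩)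

/-- The component of `P` minus the cut whose closure is the pocket. -/
def comp : Set E2 := connectedComponentIn (P.region \ C.seg) C.u

theorem pocket_eq : C.pocket = closure C.comp ∪ C.seg := rfl

theorem isPreconnected_comp : IsPreconnected C.comp := isPreconnected_connectedComponentIn

theorem comp_subset : C.comp ⊆ P.region \ C.seg := connectedComponentIn_subset _ _

theorem subset_comp {S : Set E2} (hS : IsPreconnected S) (hSr : S ⊆ P.region)
    (hSs : Disjoint S C.seg) {x : E2} (hx : x ∈ S) (hxc : x ∈ C.comp) : S ⊆ C.comp := by
  have := hS.subset_connectedComponentIn (F := P.region \ C.seg) hx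
    (fun y hy => ⟨hSr hy, Set.disjoint_left.1 hSs hy⟩)
  unfold comp at hxc ⊢
  rwa [← connectedComponentIn_eq hxc] at this

theorem redundant_of_subpocket (γ : P.Param) (C' : P.Cut) {k τ z : ℝ} (hv' : C'.v = γ k)
    (hu' : C'.u = γ (k + 1)) (hw' : C'.w = γ τ) (hτ : k + 1 < τ) (hz : C.v = γ z) (hτz : τ < z)
    (hzk : z < k + P.n) (hseg : ∀ y ∈ C'.seg, y ∈ C.seg → y = C'.v) (hwc : C'.w ∈ C.comp)
    (huc : C'.u ∈ C.comp) : C.Redundant := by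
  have hvv : C.v ≠ C'.v := by
    rw [hv', hz]; exact (γ.apply_ne (by linarith) hzk).symm
  have hsegeq : segment ℝ (γ τ) (γ k) = C'.seg := by
    rw [seg, hv', hw', segment_symm]
  have hvnot : C.v ∉ C'.comp := by
    intro h
    refine γ.not_mem_of_chord (a := k) (b := τ) (by linarith) (by linarith)
      (hsegeq ▸ C'.seg_subset_region) C'.isPreconnected_comp (hsegeq ▸ C'.comp_subset)
      (s := k + 1) (t := z) ⟨by linarith, hτ⟩ ⟨hτz, hzk⟩ ?_ (hz ▸ h)
    rw [← hu']
    refine mem_connectedComponentIn ⟨(C.comp_subset huc).1, fun hu => ?_⟩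
    rcases C'.eq_v_or_eq_w hu (by rw [hu']; exact γ.mem_boundary _) with h' | h'
    · rw [hu', hv'] at h'
      exact γ.apply_ne (s := k) (t := k + 1) (by linarith) (by linarith) h'.symm
    · rw [hu', hw'] at h'
      exact γ.apply_ne hτ (by linarith) h'
  have hdisj : Disjoint C'.comp C.seg := by
    rw [Set.disjoint_left]
    intro p hp hps
    apply hvnot
    have hsub : segment ℝ C.v p ⊆ C.seg :=
      (convex_segment _ _).segment_subset C.v_mem_seg hps
    refine C'.subset_comp (convex_segment C.v p).isPreconnected
      (hsub.trans C.seg_subset_region) ?_ (right_mem_segment _ _ _) hp (left_mem_segment _ _ _)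
    rw [Set.disjoint_left]
    intro y hy hy'
    have hyv := hseg y hy' (hsub hy)
    rcases C.eq_v_or_eq_w (hsub hy) (hyv ▸ C'.v_mem_boundary) with h | h
    · exact hvv (h ▸ hyv)
    · have hpw : p = C.w := by
        rw [seg_eq_image] at hps
        obtain ⟨θ, hθ, rfl⟩ := hps
        rw [segment_eq_image'] at hy
        obtain ⟨η, hη, rfl⟩ := hy
        rw [w_eq] at h ⊢
        simp only [add_sub_cancel_left, smul_smul, add_right_inj] at h ⊢
        have hne : C.v - C.u ≠ 0 := by
          intro h0
          have : C.v = C.w := by rw [w_eq, h0, smul_zero, add_zero]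
          apply hvv
          rw [← hyv, h0]
          simp
        have h1 := smul_left_injective ℝ hne h
        have h2 : θ = C.t := by nlinarith [hθ.1, hθ.2, hη.1, hη.2, C.t_pos]
        rw [h2]
      refine (C'.comp_subset hp).2 ?_
      rw [hpw, ← h]
      exact hy'
  have hcomp : C'.comp ⊆ C.comp := by
    refine C.subset_comp C'.isPreconnected_comp (fun y hy => (C'.comp_subset hy).1) hdisj
      (x := C'.u) (mem_connectedComponentIn ⟨(C.comp_subset huc).1, fun hu => ?_⟩) huc
    rcases C'.eq_v_or_eq_w hu (by rw [hu']; exact γ.mem_boundary _) with h' | h'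
    · rw [hu', hv'] at h'
      exact γ.apply_ne (s := k) (t := k + 1) (by linarith) (by linarith) h'.symm
    · rw [hu', hw'] at h'
      exact γ.apply_ne hτ (by linarith) h'
  have hhalf : (fun θ : ℝ => C'.v + θ • (C'.v - C'.u)) '' Ioc 0 C'.t ⊆ C.comp := by
    refine C.subset_comp (isPreconnected_Ioc.image _ (by fun_prop)) ?_ ?_
      (x := C'.w) ⟨C'.t, ⟨C'.t_pos, le_rfl⟩, rfl⟩ hwc
    · refine Subset.trans ?_ C'.seg_subset_region
      rw [seg_eq_image]
      exact image_mono Ioc_subset_Icc_self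
    · rw [Set.disjoint_left]
      rintro _ ⟨θ, hθ, rfl⟩ h
      have h1 := hseg _ (by rw [seg_eq_image]; exact ⟨θ, Ioc_subset_Icc_self hθ, rfl⟩) h
      simp only [add_eq_left, smul_eq_zero] at h1
      rcases h1 with h1 | h1
      · exact hθ.1.ne' h1
      · rw [sub_eq_zero, hv', hu'] at h1
        exact γ.apply_ne (s := k) (t := k + 1) (by linarith) (by linarith) h1
  have hseg' : C'.seg ⊆ closure C.comp := by
    rw [seg_eq_image, ← closure_Ioc C'.t_pos.ne]
    exact (image_closure_subset_closure_image (by fun_prop)).trans (closure_mono hhalf)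
  refine ⟨C', (ssubset_iff_of_subset ?_).2 ⟨C.v, Or.inr C.v_mem_seg, ?_⟩⟩
  · rw [pocket_eq, pocket_eq]
    exact union_subset ((closure_mono hcomp).trans subset_union_left)
      (hseg'.trans subset_union_left)
  · have hvs : C.v ∉ C'.seg := fun h => hvv (hseg _ h C.v_mem_seg)
    rintro (h | h)
    · exact hvnot (mem_connectedComponentIn_of_mem_closure h
        ⟨C.seg_subset_region C.v_mem_seg, hvs⟩)
    · exact hvs h

end Cut

namespace Param

variable (γ : P.Param)

theorem apply_mem_closure_inside (s : ℝ) : γ s ∈ closure P.inside := by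
  obtain ⟨ρ, d₁, d₂, q, hch, hd⟩ := γ.exists_chart s
  rw [mem_closure_iff_nhds]
  intro V hV
  obtain ⟨h1, h2⟩ := hch.exists_mem_sectors (γ.mem_boundary s) (Metric.mem_ball_self hch.pos) hV
  rcases γ.sector_dichotomy hch (hd.imp (·.1) (·.2)) with ⟨h, -⟩ | ⟨h, -⟩
  · exact h1.mono fun y hy => ⟨hy.2, h hy.1⟩
  · exact h2.mono fun y hy => ⟨hy.2, h hy.1⟩

/-- Near a point of the arc, the winding takes one value inside and another one outside. -/
theorem exists_winding_sides {a b s : ℝ} (hb : b ≤ a + P.n) (hs : s ∈ Ioo a b)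
    (hchord : γ s ∉ segment ℝ (γ b) (γ a)) :
    ∃ ρ > 0, ∃ w w' : ℝ, w ≠ w' ∧ (∀ y ∈ Metric.ball (γ s) ρ, y ∈ P.inside → γ.winding a b y = w) ∧
      ∀ y ∈ Metric.ball (γ s) ρ, y ∉ P.region → γ.winding a b y = w' := by
  have hab : a < b := hs.1.trans hs.2
  obtain ⟨ρ₀, d₁, d₂, q, hch₀, hd⟩ := γ.exists_chart s
  have hd' : d₁ = γ.fwd s ∨ d₂ = γ.fwd s := hd.imp (·.1) (·.2)
  obtain ⟨ρ', hρ', hball⟩ := Metric.isOpen_iff.1 (isClosed_chord (γ b) (γ a)).isOpen_compl _ hchord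
  have hmin : 0 < min ρ₀ ρ' := lt_min hch₀.pos hρ'
  have hch := hch₀.mono hmin (min_le_left _ _)
  set ρ := min ρ₀ ρ' with hρ
  have hball' : Metric.ball (γ s) ρ ⊆ (segment ℝ (γ b) (γ a))ᶜ :=
    (Metric.ball_subset_ball (min_le_right _ _)).trans hball
  have hc : ∀ y ∈ segment ℝ (γ b) (γ a), y ∈ Metric.ball (γ s) ρ → y = γ s :=
    fun z hz hzb => absurd hz (hball' hzb)
  have hloop : ∀ S ⊆ Metric.ball (γ s) ρ, Disjoint S P.boundary → Disjoint S (γ.loop a b) := by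
    intro S hS hSJ
    rw [Set.disjoint_left]
    rintro z hz (⟨t, _, rfl⟩ | h)
    · exact Set.disjoint_left.1 hSJ hz (γ.mem_boundary t)
    · exact hball' (hS hz) h
  obtain ⟨⟨p, hp, -⟩, ⟨r, hr, -⟩⟩ := hch.exists_mem_sectors (γ.mem_boundary s)
    (Metric.mem_ball_self hch.pos) Filter.univ_mem
  have hne := γ.winding_ne_of_sectors hb ⟨hs.1.le, hs.2⟩ hch hd' hc hp hr
  have hcS : ∀ y ∈ smallSector (γ s) d₁ d₂ ∩ Metric.ball (γ s) ρ,
      γ.winding a b y = γ.winding a b p := fun y hy =>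
    γ.winding_eq_of_isPreconnected hab (isPreconnected_smallSector_inter_ball _ _ _ _)
      (hloop _ inter_subset_right hch.disjoint_smallSector) hy hp
  have hcL : ∀ y ∈ largeSector (γ s) d₁ d₂ ∩ Metric.ball (γ s) ρ,
      γ.winding a b y = γ.winding a b r := fun y hy =>
    γ.winding_eq_of_isPreconnected hab hch.isPreconnected_largeSector
      (hloop _ inter_subset_right hch.disjoint_largeSector) hy hr
  rcases γ.sector_dichotomy hch hd' with ⟨h1, h2⟩ | ⟨h1, h2⟩
  · refine ⟨ρ, hmin, _, _, hne, fun y hy hyi => ?_, fun y hy hyr => ?_⟩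
    · rcases hch.mem_sectors hyi.2 hy with h | h
      · exact hcS y h
      · exact absurd hyi.1 (h2 h)
    · rcases hch.mem_sectors (fun h => hyr (boundary_subset_region h)) hy with h | h
      · exact absurd (h1 h).1 hyr
      · exact hcL y h
  · refine ⟨ρ, hmin, _, _, hne.symm, fun y hy hyi => ?_, fun y hy hyr => ?_⟩
    · rcases hch.mem_sectors hyi.2 hy with h | h
      · exact absurd hyi.1 (h2 h)
      · exact hcL y h
    · rcases hch.mem_sectors (fun h => hyr (boundary_subset_region h)) hy with h | h
      · exact hcS y h
      · exact absurd (h1 h).1 hyr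

/-- An arc of the boundary whose chord lies in the polygon and in the line carrying a cut, and that
bounds, with its chord, a part of the polygon lying on the side of the chord given by `e`. -/
structure IsBay (γ : P.Param) (C : P.Cut) (e : E2) (p q : ℝ) : Prop where
  lt : p < q
  lt_add : q < p + P.n
  level : cross2 e (γ q) = cross2 e (γ p)
  chord_subset : segment ℝ (γ q) (γ p) ⊆ P.region
  not_mem_chord : ∀ s ∈ Ioo p q, γ s ∉ segment ℝ (γ q) (γ p)
  winding_ne : ∀ y ∈ openSegment ℝ (γ q) (γ p), ∀ᶠ ε in nhdsWithin (0 : ℝ) (Ioi 0),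
    γ.winding p q (y + ε • perp e) ≠ 0
  arc_subset : γ '' Ioo p q ⊆ C.comp
  level_v : cross2 e C.v = cross2 e (γ p)
  level_w : cross2 e C.w = cross2 e (γ p)
  exists_v : ∃ z ∈ Ioo q (p + P.n), C.v = γ z

variable {γ}

namespace IsBay

variable {C : P.Cut} {e : E2} {p q : ℝ}

theorem level_seg (h : γ.IsBay C e p q) {y : E2} (hy : y ∈ C.seg) :
    cross2 e y = cross2 e (γ p) := by
  rw [Cut.seg, segment_eq_image'] at hy
  obtain ⟨θ, -, rfl⟩ := hy
  rw [cross2_add_right, cross2_smul_right, cross2_sub_right, h.level_v, h.level_w]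
  ring

theorem level_chord (h : γ.IsBay C e p q) {y : E2} (hy : y ∈ segment ℝ (γ q) (γ p)) :
    cross2 e y = cross2 e (γ p) := by
  rw [segment_eq_image'] at hy
  obtain ⟨θ, -, rfl⟩ := hy
  rw [cross2_add_right, cross2_smul_right, cross2_sub_right, h.level]
  ring

/-- A reflex vertex on the arc of a bay at the first maximal height generates a smaller pocket. -/
theorem redundant_of_peak (h : γ.IsBay C e p q) {s : ℝ} (hs : s ∈ Ico p q)
    (hlow : cross2 e (γ p) ≤ cross2 e (γ s)) (hf : cross2 e (γ.fwd s) < 0)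
    (hb : cross2 e (γ.bwd s) ≤ 0) (hmax : ∀ t ∈ Icc p s, cross2 e (γ t) ≤ cross2 e (γ s))
    {ρ : ℝ} (hρ : 0 < ρ) (hin : ∀ y ∈ Metric.ball (γ s) ρ, 0 < cross2 e (y - γ s) →
      y ∈ P.inside ∧ γ.winding p q y ≠ 0) : C.Redundant := by
  have hfneg : 0 < cross2 e (-γ.fwd s) := by rw [cross2_neg_right]; linarith
  obtain ⟨k, rfl, C', hv', hu', hray⟩ := γ.exists_cut_of_up hf hb (by
    intro r hr
    obtain ⟨ε₀, hε₀, hball⟩ := exists_small_smul_mem_ball (γ s) (-γ.fwd s) (lt_min hr hρ)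
    have h1 := hball (ε₀ / 2) ⟨by linarith, by linarith⟩
    have h2 : 0 < cross2 e (γ s + (ε₀ / 2) • -γ.fwd s - γ s) := by
      rw [add_sub_cancel_left, cross2_smul_right]
      exact mul_pos (by linarith) hfneg
    exact ⟨_, Metric.ball_subset_ball (min_le_left _ _) h1, h2,
      (hin _ (Metric.ball_subset_ball (min_le_right _ _) h1) h2).1⟩)
  have hvu : C'.v - C'.u = -γ.fwd k := by rw [hv', hu', γ.fwd_int, neg_sub]
  have hup : ∀ θ : ℝ, 0 < θ → cross2 e (γ k) < cross2 e (C'.v + θ • (C'.v - C'.u)) := by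
    intro θ hθ
    rw [hvu, hv', cross2_add_right, cross2_smul_right]
    linarith [mul_pos hθ hfneg]
  have hw0 : ∀ θ ∈ Ioo 0 C'.t, γ.winding p q (C'.v + θ • (C'.v - C'.u)) ≠ 0 := by
    obtain ⟨ε₀, hε₀, hball⟩ := exists_small_smul_mem_ball (γ k) (-γ.fwd k) hρ
    have hm : 0 < min ε₀ C'.t := lt_min hε₀ C'.t_pos
    have h1 := hball (min ε₀ C'.t / 2) ⟨by linarith, by linarith [min_le_left ε₀ C'.t]⟩
    have h2 : 0 < cross2 e (γ k + (min ε₀ C'.t / 2) • -γ.fwd k - γ k) := by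
      rw [add_sub_cancel_left, cross2_smul_right]
      exact mul_pos (by linarith) hfneg
    have h3 := (hin _ h1 h2).2
    rw [← hvu, ← hv'] at h3
    intro θ hθ
    rw [γ.winding_eq_of_isPreconnected h.lt
      (isPreconnected_Ioo.image (fun θ : ℝ => C'.v + θ • (C'.v - C'.u)) (by fun_prop)) ?_
      (mem_image_of_mem _ hθ) (y := C'.v + (min ε₀ C'.t / 2) • (C'.v - C'.u)) ⟨_, ⟨by linarith,
        by linarith [min_le_right ε₀ C'.t, C'.t_pos]⟩, rfl⟩]
    · exact h3
    · rw [Set.disjoint_left]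
      rintro _ ⟨η, hη, rfl⟩ (⟨t, _, ht⟩ | h')
      · have ht' : γ t = C'.v + η • (C'.v - C'.u) := ht
        exact (hray η hη).2 (ht' ▸ γ.mem_boundary t)
      · have := hup η hη.1
        rw [h.level_chord h'] at this
        linarith
  have hwup := hup _ C'.t_pos
  rw [← C'.w_eq] at hwup
  have hwl : C'.w ∈ γ.loop p q := by
    by_contra hcon
    obtain ⟨r, hr, hball⟩ :=
      Metric.isOpen_iff.1 (γ.isCompact_loop p q).isClosed.isOpen_compl _ hcon
    refine (γ.mem_inside_of_winding_ne_zero h.lt h.chord_subset (x := C'.w) ?_ hcon).2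
      C'.w_mem_boundary
    have hcl : C'.w ∈ closure ((fun θ : ℝ => C'.v + θ • (C'.v - C'.u)) '' Ioo 0 C'.t) := by
      refine image_closure_subset_closure_image (by fun_prop) ?_
      rw [closure_Ioo C'.t_pos.ne]
      exact ⟨C'.t, ⟨C'.t_pos.le, le_rfl⟩, rfl⟩
    obtain ⟨y, hyb, ⟨θ, hθ, rfl⟩⟩ := mem_closure_iff_nhds.1 hcl _ (Metric.ball_mem_nhds _ hr)
    rw [γ.winding_eq_of_isPreconnected h.lt (convex_ball _ r).isPreconnected
      (subset_compl_iff_disjoint_right.1 hball) (Metric.mem_ball_self hr) hyb]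
    exact hw0 θ hθ
  obtain ⟨τ, hτ, hwτ⟩ : C'.w ∈ γ '' Icc p q := by
    rcases hwl with h' | h'
    · exact h'
    · rw [h.level_chord h'] at hwup
      linarith
  have hτp : τ ∈ Ioo p q := by
    refine ⟨lt_of_le_of_ne hτ.1 ?_, lt_of_le_of_ne hτ.2 ?_⟩
    · rintro rfl; rw [hwτ] at hlow; linarith
    · rintro rfl; rw [← hwτ, h.level] at hwup; linarith
  have hτk : (k : ℝ) + 1 < τ := by
    by_contra hcon
    rcases le_total τ k with h1 | h1
    · have := hmax τ ⟨hτ.1, h1⟩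
      rw [hwτ] at this; linarith
    · have := γ.lin_sub (k := k) (s := k) (t := τ) ⟨le_rfl, by linarith⟩ ⟨h1, not_lt.1 hcon⟩
      rw [← γ.fwd_int, hwτ] at this
      rw [this, cross2_add_right, cross2_smul_right] at hwup
      nlinarith
  obtain ⟨z, hz, hvz⟩ := h.exists_v
  refine C.redundant_of_subpocket γ C' hv' hu' hwτ.symm hτk hvz (hτp.2.trans hz.1)
    (by linarith [hz.2, hs.1]) ?_ ?_ ?_
  · intro y hy hyC
    rw [Cut.seg_eq_image] at hy
    obtain ⟨θ, hθ, rfl⟩ := hy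
    rcases hθ.1.eq_or_lt with rfl | h0
    · simp
    · have := hup θ h0
      rw [h.level_seg hyC] at this
      linarith
  · rw [← hwτ]; exact h.arc_subset (mem_image_of_mem _ hτp)
  · rw [hu']; exact h.arc_subset (mem_image_of_mem _ ⟨by linarith [hs.1], by linarith [hτp.2]⟩)

end IsBay

end Param

end SimplePolygon

open Filter Topology

/-- A property constant near each point of a preconnected set is constant on it. -/
theorem IsPreconnected.iff_of_eventually_iff {α : Type*} [TopologicalSpace α] {S : Set α}
    (hS : IsPreconnected S) {Q : α → Prop} (h : ∀ x ∈ S, ∀ᶠ y in 𝓝[S] x, (Q x ↔ Q y))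
    {x y : α} (hx : x ∈ S) (hy : y ∈ S) : Q x ↔ Q y :=
  hS.induction₂' (fun x y => Q x ↔ Q y) (fun x hx => (h x hx).mono fun _ h => ⟨h, h.symm⟩)
    (fun _ _ _ _ _ _ h1 h2 => h1.trans h2) hx hy

theorem exists_eq_add_of_mem_segment {a b y : E2} (hy : y ∈ segment ℝ b a) :
    ∃ c ∈ Icc (0 : ℝ) 1, y = a + c • (b - a) := by
  rw [segment_symm, segment_eq_image'] at hy
  obtain ⟨c, hc, rfl⟩ := hy
  exact ⟨c, hc, rfl⟩

namespace SimplePolygon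

variable {P : SimplePolygon}

namespace Param

variable (γ : P.Param)

/-- Near its starting point, an arc runs along a ray. -/
theorem exists_ball_start {p b : ℝ} (hpb : p < b) (hb : b < p + P.n) :
    ∃ ρ > 0, ∀ y ∈ Metric.ball (γ p) ρ, y ∈ γ '' Icc p b →
      ∃ c : ℝ, 0 ≤ c ∧ y = γ p + c • γ.fwd p := by
  have hm : p < min (p + step p) b := lt_min (by linarith [step_pos p]) hpb
  set m := min (p + step p) b
  have hnot : γ p ∉ γ '' Icc m b := by
    rintro ⟨t, ht, h⟩
    exact γ.apply_ne (by linarith [ht.1]) (by linarith [ht.2]) h.symm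
  obtain ⟨ρ, hρ, hball⟩ := Metric.isOpen_iff.1
    (isCompact_Icc.image γ.cont).isClosed.isOpen_compl _ hnot
  refine ⟨ρ, hρ, ?_⟩
  rintro _ hy ⟨t, ht, rfl⟩
  have htm : t < m := by
    by_contra hcon
    exact hball hy ⟨t, ⟨not_lt.1 hcon, ht.2⟩, rfl⟩
  have hst := step_pos p
  have hθ : (t - p) / step p ∈ Icc (0 : ℝ) 1 := by
    refine ⟨div_nonneg (by linarith [ht.1]) hst.le, ?_⟩
    rw [div_le_one hst]
    linarith [min_le_left (p + step p) b]
  refine ⟨_, hθ.1, ?_⟩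
  rw [← γ.fwd_lin p hθ, div_mul_cancel₀ _ hst.ne', add_sub_cancel]

theorem frequently_winding_iff {a b : ℝ} (hb : b ≤ a + P.n)
    (hchord : ∀ s ∈ Ioo a b, γ s ∉ segment ℝ (γ b) (γ a)) {s t : ℝ} (hs : s ∈ Ioo a b)
    (ht : t ∈ Ioo a b) :
    (∃ᶠ y in 𝓝 (γ s), y ∈ P.inside ∧ γ.winding a b y = 0) ↔
      ∃ᶠ y in 𝓝 (γ t), y ∈ P.inside ∧ γ.winding a b y = 0 := by
  refine isPreconnected_Ioo.iff_of_eventually_iff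
    (Q := fun t => ∃ᶠ y in 𝓝 (γ t), y ∈ P.inside ∧ γ.winding a b y = 0) ?_ hs ht
  intro s hs
  obtain ⟨ρ, hρ, w, w', -, hw, -⟩ := γ.exists_winding_sides hb hs (hchord s hs)
  have key : ∀ t, γ t ∈ Metric.ball (γ s) ρ →
      ((∃ᶠ y in 𝓝 (γ t), y ∈ P.inside ∧ γ.winding a b y = 0) ↔ w = 0) := by
    intro t ht
    have hev : ∀ᶠ y in 𝓝 (γ t), y ∈ P.inside → γ.winding a b y = w :=
      (Metric.isOpen_ball.mem_nhds ht : Metric.ball (γ s) ρ ∈ 𝓝 (γ t)) |> fun h =>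
        mem_of_superset h hw
    have hfr : ∃ᶠ y in 𝓝 (γ t), y ∈ P.inside :=
      mem_closure_iff_frequently.1 (γ.apply_mem_closure_inside t)
    constructor
    · intro h
      obtain ⟨y, hy, hy'⟩ := (h.and_eventually hev).exists
      rw [← hy' hy.1, hy.2]
    · rintro rfl
      exact (hfr.and_eventually hev).mono fun y hy => ⟨hy.1, hy.2 hy.1⟩
  have hnh : ∀ᶠ t in 𝓝[Ioo a b] s, γ t ∈ Metric.ball (γ s) ρ :=
    nhdsWithin_le_nhds (γ.cont.continuousAt.preimage_mem_nhds (Metric.ball_mem_nhds _ hρ))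
  exact hnh.mono fun t ht => (key s (Metric.mem_ball_self hρ)).trans (key t ht).symm

variable {γ}

namespace IsBay

variable {C : P.Cut} {e : E2} {p q : ℝ}

theorem exists_winding_ne (h : γ.IsBay C e p q) {y : E2} (hy : y ∈ segment ℝ (γ q) (γ p))
    {V : Set E2} (hV : V ∈ 𝓝 y) : ∃ y₀ ∈ openSegment ℝ (γ q) (γ p), ∃ ε > (0 : ℝ),
      y₀ + ε • perp e ∈ V ∧ γ.winding p q (y₀ + ε • perp e) ≠ 0 := by
  rw [← closure_openSegment] at hy
  obtain ⟨y₀, hy₀V, hy₀⟩ := mem_closure_iff_nhds.1 hy _ (interior_mem_nhds.2 hV)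
  have hlim : ∀ᶠ ε in 𝓝[>] (0 : ℝ), y₀ + ε • perp e ∈ V := by
    have hc : ContinuousAt (fun ε : ℝ => y₀ + ε • perp e) 0 := by fun_prop
    refine nhdsWithin_le_nhds (hc.preimage_mem_nhds ?_)
    simpa using mem_interior_iff_mem_nhds.1 hy₀V
  obtain ⟨ε, ⟨h1, h2⟩, h3⟩ :=
    ((hlim.and (h.winding_ne y₀ hy₀)).and self_mem_nhdsWithin).exists
  exact ⟨y₀, hy₀, ε, h3, h1, h2⟩

/-- A boundary arc of a bay cannot start downwards. -/
theorem redundant_of_fwd_neg (h : γ.IsBay C e p q) (hf : cross2 e (γ.fwd p) < 0) :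
    C.Redundant := by
  have he : e ≠ 0 := by rintro rfl; simp [cross2_zero_left] at hf
  obtain ⟨ρ, hρ, hstart⟩ := γ.exists_ball_start h.lt h.lt_add
  have hdisj : Disjoint ({y | 0 < cross2 e (y - γ p)} ∩ Metric.ball (γ p) ρ) (γ.loop p q) := by
    rw [Set.disjoint_left]
    rintro y ⟨hy, hyb⟩ (hya | hyc)
    · obtain ⟨c, hc, rfl⟩ := hstart y hyb hya
      simp only [mem_ofPred_eq, add_sub_cancel_left, cross2_smul_right] at hy
      nlinarith
    · simp only [mem_ofPred_eq, cross2_sub_right, h.level_chord hyc] at hy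
      linarith
  have hpre : IsPreconnected ({y | 0 < cross2 e (y - γ p)} ∩ Metric.ball (γ p) ρ) :=
    ((convex_cross2_pos e _).inter (convex_ball _ _)).isPreconnected
  obtain ⟨y₀, hy₀, ε, hε, hyb, hyw⟩ := h.exists_winding_ne (right_mem_segment ℝ _ _)
    (Metric.ball_mem_nhds (γ p) hρ)
  have hy1 : y₀ + ε • perp e ∈ {y | 0 < cross2 e (y - γ p)} ∩ Metric.ball (γ p) ρ := by
    refine ⟨?_, hyb⟩
    simp only [mem_ofPred_eq, cross2_sub_right, cross2_add_right, cross2_smul_right, cross2_perp,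
      h.level_chord (openSegment_subset_segment _ _ _ hy₀)]
    have := mul_pos hε (sq_add_sq_pos_of_ne_zero he)
    linarith
  have hin : ∀ y ∈ Metric.ball (γ p) ρ, 0 < cross2 e (y - γ p) →
      y ∈ P.inside ∧ γ.winding p q y ≠ 0 := by
    intro y hy hy'
    have hw : γ.winding p q y ≠ 0 := by
      rw [γ.winding_eq_of_isPreconnected h.lt hpre hdisj ⟨hy', hy⟩ hy1]
      exact hyw
    exact ⟨γ.mem_inside_of_winding_ne_zero h.lt h.chord_subset hw
      (Set.disjoint_left.1 hdisj ⟨hy', hy⟩), hw⟩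
  have hb : cross2 e (γ.bwd p) ≤ 0 := by
    by_contra hcon
    obtain ⟨ε₀, hε₀, hball⟩ := exists_small_smul_mem_ball (γ p) (γ.bwd p) hρ
    have hm : 0 < min ε₀ 1 := lt_min hε₀ one_pos
    have h1 := hball (min ε₀ 1 / 2) ⟨by linarith, by linarith [min_le_left ε₀ 1]⟩
    refine (hin _ h1 ?_).1.2 ?_
    · rw [add_sub_cancel_left, cross2_smul_right]
      exact mul_pos (by linarith) (not_le.1 hcon)
    · rw [← γ.bwd_lin p ⟨by linarith, by linarith [min_le_right ε₀ 1]⟩]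
      exact γ.mem_boundary _
  refine h.redundant_of_peak ⟨le_rfl, h.lt⟩ le_rfl hf hb ?_ hρ hin
  intro t ht
  rw [le_antisymm ht.2 ht.1]

/-- If the boundary arc of a bay first returns to the level of the chord behind its starting point,
then the cut is redundant. -/
theorem redundant_of_return (h : γ.IsBay C e p q) {α m : ℝ} (hα : α ∈ Ioo p q)
    (hup : ∀ t ∈ Ioo p α, cross2 e (γ p) < cross2 e (γ t)) (hm : 0 < m)
    (hαm : γ α = γ p - m • (γ q - γ p)) : C.Redundant := by
  set g := γ q - γ p with hg
  set d := γ.fwd p with hd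
  have hαn : α < p + P.n := hα.2.trans h.lt_add
  have hfg : cross2 e g = 0 := by rw [hg, cross2_sub_right, h.level, sub_self]
  have hαlev : cross2 e (γ α) = cross2 e (γ p) := by
    rw [hαm, cross2_sub_right, cross2_smul_right, hfg]; ring
  have hg0 : g ≠ 0 := sub_ne_zero.2 (γ.apply_ne h.lt h.lt_add).symm
  -- the arc leaves upwards
  have hst := step_pos p
  have hfd : 0 < cross2 e d := by
    set θ := min 1 ((α - p) / (2 * step p)) with hθ
    have hdiv : 0 < (α - p) / (2 * step p) := div_pos (by linarith [hα.1]) (by linarith)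
    have hθ0 : 0 < θ := lt_min one_pos hdiv
    have hθ1 : θ * step p ≤ (α - p) / 2 := by
      calc θ * step p ≤ (α - p) / (2 * step p) * step p :=
            mul_le_mul_of_nonneg_right (min_le_right _ _) hst.le
        _ = (α - p) / 2 := by field_simp
    have h1 := hup (p + θ * step p) ⟨by linarith [mul_pos hθ0 hst], by linarith [hα.1]⟩
    rw [γ.fwd_lin p ⟨hθ0.le, min_le_left _ _⟩, cross2_add_right, cross2_smul_right] at h1
    exact pos_of_mul_pos_right (by linarith : 0 < θ * cross2 e (γ.fwd p)) hθ0.le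
  have he : e ≠ 0 := by rintro rfl; simp [cross2_zero_left] at hfd
  have hpe := sq_add_sq_pos_of_ne_zero he
  rw [← cross2_perp] at hpe
  have hdg : cross2 d g ≠ 0 := by
    intro h0
    obtain ⟨c, hc⟩ := exists_smul_of_cross2_eq_zero (γ.fwd_ne_zero p) h0
    rw [hc, cross2_smul_right] at hfg
    rcases mul_eq_zero.1 hfg with h' | h'
    · exact hg0 (by rw [hc, h', zero_smul])
    · exact hfd.ne' h'
  set d' := cross2 d g • d with hd'
  have hd'd : cross2 d' d = 0 := by rw [hd', cross2_smul_left, cross2_self, mul_zero]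
  have hd'g : 0 < cross2 d' g := by rw [hd', cross2_smul_left]; exact mul_self_pos.2 hdg
  -- all points of the loop of the returning arc are above the level
  have hloopup : ∀ z ∈ γ.loop p α, cross2 e (γ p) ≤ cross2 e z := by
    rintro z (⟨t, ht, rfl⟩ | hz)
    · rcases ht.1.eq_or_lt with rfl | h1
      · exact le_rfl
      rcases ht.2.eq_or_lt with rfl | h2
      · exact hαlev.ge
      exact (hup t ⟨h1, h2⟩).le
    · obtain ⟨c, -, rfl⟩ := exists_eq_add_of_mem_segment hz
      rw [cross2_add_right, cross2_smul_right, cross2_sub_right, hαlev]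
      linarith
  have hchordα : ∀ s ∈ Ioo p α, γ s ∉ segment ℝ (γ α) (γ p) := by
    intro s hs hz
    obtain ⟨c, -, hc⟩ := exists_eq_add_of_mem_segment hz
    have := hup s hs
    rw [hc, cross2_add_right, cross2_smul_right, cross2_sub_right, hαlev] at this
    linarith
  obtain ⟨ρ, hρ, hstart⟩ := γ.exists_ball_start h.lt h.lt_add
  -- the half ball on the side of the chord misses the loop of the returning arc
  have hH : Disjoint ({y | 0 < cross2 d' (y - γ p)} ∩ Metric.ball (γ p) ρ) (γ.loop p α) := by
    rw [Set.disjoint_left]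
    rintro y ⟨hy, hyb⟩ (⟨t, ht, rfl⟩ | hyc)
    · obtain ⟨c, hc, hct⟩ := hstart _ hyb ⟨t, ⟨ht.1, ht.2.trans hα.2.le⟩, rfl⟩
      simp only [mem_ofPred_eq, hct, add_sub_cancel_left, cross2_smul_right] at hy
      rw [← hd, hd'd] at hy
      linarith
    · obtain ⟨c, hc, rfl⟩ := exists_eq_add_of_mem_segment hyc
      simp only [mem_ofPred_eq, hαm, add_sub_cancel_left, cross2_smul_right,
        sub_sub_cancel_left, cross2_neg_right] at hy
      have := mul_nonneg hc.1 (mul_pos hm hd'g).le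
      linarith
  have hHpre : IsPreconnected ({y | 0 < cross2 d' (y - γ p)} ∩ Metric.ball (γ p) ρ) :=
    ((convex_cross2_pos d' _).inter (convex_ball _ _)).isPreconnected
  have hopen : IsOpen ({y | 0 < cross2 d' (y - γ p)} ∩ Metric.ball (γ p) ρ) := by
    refine IsOpen.inter ?_ Metric.isOpen_ball
    exact isOpen_lt continuous_const
      ((continuous_cross2_right d').comp (continuous_id.sub continuous_const))
  obtain ⟨β₀, hβ₀, hβball⟩ := exists_small_smul_mem_ball (γ p) g hρ
  obtain ⟨β, hβ0, hβ1, hβ2⟩ : ∃ β, 0 < β ∧ β < β₀ ∧ β < 1 :=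
    ⟨min β₀ 1 / 2, by have := lt_min hβ₀ one_pos; linarith,
      by have := lt_min hβ₀ one_pos; linarith [min_le_left β₀ 1],
      by linarith [min_le_right β₀ 1]⟩
  have hyβ : γ p + β • g ∈ {y | 0 < cross2 d' (y - γ p)} ∩ Metric.ball (γ p) ρ := by
    refine ⟨?_, hβball β ⟨hβ0, hβ1⟩⟩
    simp only [mem_ofPred_eq, add_sub_cancel_left, cross2_smul_right]
    exact mul_pos hβ0 hd'g
  have hHzero : ∀ y ∈ {y | 0 < cross2 d' (y - γ p)} ∩ Metric.ball (γ p) ρ,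
      γ.winding p α y = 0 := by
    obtain ⟨r, hr, hrball⟩ := Metric.isOpen_iff.1 hopen _ hyβ
    obtain ⟨ε₀, hε₀, hball⟩ := exists_small_smul_mem_ball (γ p + β • g) (-perp e) hr
    have h1 := hrball (hball (ε₀ / 2) ⟨by linarith, by linarith⟩)
    intro y hy
    rw [γ.winding_eq_of_isPreconnected hα.1 hHpre hH hy h1]
    refine γ.winding_eq_zero hα.1 (e := e) fun z hz => ?_
    have := hloopup z hz
    rw [cross2_sub_right, cross2_add_right, cross2_add_right, cross2_smul_right, cross2_smul_right,
      cross2_neg_right, hfg]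
    nlinarith
  -- the cone between the arc and the chord is inside
  set K := {y | 0 < cross2 e (y - γ p)} ∩
    ({y | 0 < cross2 d' (y - γ p)} ∩ Metric.ball (γ p) ρ) with hK
  have hKdisj : Disjoint K (γ.loop p q) := by
    rw [Set.disjoint_left]
    rintro y ⟨hy, hy', hyb⟩ (hya | hyc)
    · obtain ⟨c, hc, rfl⟩ := hstart y hyb hya
      simp only [mem_ofPred_eq, add_sub_cancel_left, cross2_smul_right] at hy'
      rw [← hd, hd'd] at hy'
      linarith
    · simp only [mem_ofPred_eq, cross2_sub_right, h.level_chord hyc] at hy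
      linarith
  have hKpre : IsPreconnected K := ((convex_cross2_pos e _).inter
    ((convex_cross2_pos d' _).inter (convex_ball _ _))).isPreconnected
  have hyβs : γ p + β • g ∈ segment ℝ (γ q) (γ p) := by
    rw [segment_symm, segment_eq_image']
    exact ⟨β, ⟨hβ0.le, hβ2.le⟩, rfl⟩
  obtain ⟨y₀, hy₀, ε, hε, hyb, hyw⟩ := h.exists_winding_ne hyβs (hopen.mem_nhds hyβ)
  have hKin : K ⊆ P.inside := by
    intro y hy
    refine γ.mem_inside_of_winding_ne_zero h.lt h.chord_subset ?_ (Set.disjoint_left.1 hKdisj hy)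
    rw [γ.winding_eq_of_isPreconnected h.lt hKpre hKdisj hy (y := y₀ + ε • perp e) ⟨?_, hyb⟩]
    · exact hyw
    · simp only [mem_ofPred_eq, cross2_sub_right, cross2_add_right, cross2_smul_right,
        h.level_chord (openSegment_subset_segment _ _ _ hy₀)]
      linarith [mul_pos hε hpe]
  -- at the beginning of the arc, the inside has winding zero
  obtain ⟨t₀, ht₀, hQ₀⟩ : ∃ t₀ ∈ Ioo p α,
      ∃ᶠ y in 𝓝 (γ t₀), y ∈ P.inside ∧ γ.winding p α y = 0 := by
    obtain ⟨θ₀, hθ₀, hθball⟩ := exists_small_smul_mem_ball (γ p) d hρ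
    have hdiv : 0 < (α - p) / step p := div_pos (by linarith [hα.1]) hst
    obtain ⟨θ, hθ, hθ1⟩ := exists_between (lt_min (lt_min hθ₀ hdiv) one_pos)
    have hθ2 := hθ1.trans_le (min_le_right _ _)
    have hθ3 := hθ1.trans_le ((min_le_left _ _).trans (min_le_left _ _))
    have hθ4 := hθ1.trans_le ((min_le_left _ _).trans (min_le_right _ _))
    have hγθ := γ.fwd_lin p ⟨hθ.le, hθ2.le⟩
    rw [lt_div_iff₀ hst] at hθ4
    refine ⟨p + θ * step p, ⟨by linarith [mul_pos hθ hst], by linarith⟩, ?_⟩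
    have hbt : γ (p + θ * step p) ∈ Metric.ball (γ p) ρ := hγθ ▸ hθball θ ⟨hθ, hθ3⟩
    rw [frequently_iff]
    intro V hV
    obtain ⟨r, hr, hrball⟩ := Metric.mem_nhds_iff.1
      (inter_mem hV (Metric.isOpen_ball.mem_nhds hbt))
    obtain ⟨η₀, hη₀, hηball⟩ := exists_small_smul_mem_ball (γ (p + θ * step p)) g hr
    have h1 := hrball (hηball (η₀ / 2) ⟨by linarith, by linarith⟩)
    rw [hγθ] at h1
    have h2 : γ p + θ • γ.fwd p + (η₀ / 2) • g - γ p = θ • d + (η₀ / 2) • g := by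
      rw [add_assoc, add_sub_cancel_left]
    have hyH : γ p + θ • γ.fwd p + (η₀ / 2) • g ∈
        {y | 0 < cross2 d' (y - γ p)} ∩ Metric.ball (γ p) ρ := by
      refine ⟨?_, h1.2⟩
      simp only [mem_ofPred_eq, h2, cross2_add_right, cross2_smul_right, hd'd]
      have := mul_pos (half_pos hη₀) hd'g
      linarith
    refine ⟨_, h1.1, hKin ⟨?_, hyH⟩, hHzero _ hyH⟩
    simp only [mem_ofPred_eq, h2, cross2_add_right, cross2_smul_right, hfg]
    have := mul_pos hθ hfd
    linarith
  -- the last highest point of the arc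
  obtain ⟨s, hs, hsmax, hslast⟩ : ∃ s ∈ Ioo p α,
      (∀ t ∈ Icc p α, cross2 e (γ t) ≤ cross2 e (γ s)) ∧
      ∀ t ∈ Ioc s α, cross2 e (γ t) < cross2 e (γ s) := by
    have hcont : Continuous fun t => cross2 e (γ t) := (continuous_cross2_right e).comp γ.cont
    obtain ⟨s₀, hs₀, hmax⟩ :=
      isCompact_Icc.exists_isMaxOn (nonempty_Icc.2 hα.1.le) hcont.continuousOn
    have hcomp : IsCompact (Icc p α ∩ {t | cross2 e (γ t) = cross2 e (γ s₀)}) :=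
      isCompact_Icc.inter_right (isClosed_eq hcont continuous_const)
    obtain ⟨s, ⟨hs, hse⟩, hub⟩ := hcomp.exists_isGreatest ⟨s₀, hs₀, rfl⟩
    have hse' : cross2 e (γ s) = cross2 e (γ s₀) := hse
    have hmax' : ∀ t ∈ Icc p α, cross2 e (γ t) ≤ cross2 e (γ s) := fun t ht =>
      hse' ▸ hmax ht
    have hmid := hup ((p + α) / 2) ⟨by linarith [hα.1], by linarith [hα.1]⟩
    have hmid' := hmax' ((p + α) / 2) ⟨by linarith [hα.1], by linarith [hα.1]⟩
    refine ⟨s, ⟨lt_of_le_of_ne hs.1 ?_, lt_of_le_of_ne hs.2 ?_⟩, hmax', fun t ht => ?_⟩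
    · rintro rfl; linarith
    · rintro rfl; linarith
    · have htI : t ∈ Icc p α := ⟨hs.1.trans ht.1.le, ht.2⟩
      refine lt_of_le_of_ne (hmax' t htI) fun heq => ?_
      exact absurd (hub ⟨htI, heq.trans hse'⟩) (not_le.2 ht.1)
  have hss := step_pos s
  have hf : cross2 e (γ.fwd s) < 0 := by
    obtain ⟨θ, hθ, hθ1⟩ := exists_between
      (lt_min (div_pos (by linarith [hs.2] : 0 < α - s) hss) one_pos)
    have hθ2 := hθ1.trans_le (min_le_left _ _)
    rw [lt_div_iff₀ hss] at hθ2
    have h1 := hslast (s + θ * step s) ⟨by linarith [mul_pos hθ hss], by linarith⟩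
    rw [γ.fwd_lin s ⟨hθ.le, hθ1.le.trans (min_le_right _ _)⟩, cross2_add_right,
      cross2_smul_right] at h1
    by_contra hcon
    have := mul_nonneg hθ.le (not_lt.1 hcon)
    linarith
  have hb : cross2 e (γ.bwd s) ≤ 0 := by
    obtain ⟨θ, hθ, hθ1⟩ := exists_between
      (lt_min (div_pos (by linarith [hs.1] : 0 < s - p) hss) one_pos)
    have hθ2 := hθ1.trans_le (min_le_left _ _)
    rw [lt_div_iff₀ hss] at hθ2
    have h1 := hsmax (s - θ * step s) ⟨by linarith, by linarith [mul_pos hθ hss, hs.2]⟩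
    rw [γ.bwd_lin s ⟨hθ.le, hθ1.le.trans (min_le_right _ _)⟩, cross2_add_right,
      cross2_smul_right] at h1
    by_contra hcon
    have := mul_pos hθ (not_le.1 hcon)
    linarith
  have hsq : s ∈ Ioo p q := ⟨hs.1, hs.2.trans hα.2⟩
  obtain ⟨ρ₁, hρ₁, w, w', hww, hw, hw'⟩ := γ.exists_winding_sides hαn.le hs (hchordα s hs)
  obtain ⟨ρ₂, hρ₂, x, x', hxx, hx, hx'⟩ :=
    γ.exists_winding_sides h.lt_add.le hsq (h.not_mem_chord s hsq)
  obtain ⟨ρ₃, d₁, d₂, q', hch, hdir⟩ := γ.exists_chart s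
  have hw0 : w = 0 := by
    have hQ := (γ.frequently_winding_iff hαn.le hchordα ht₀ hs).1 hQ₀
    obtain ⟨y, hy, hyb⟩ := (hQ.and_eventually (Metric.ball_mem_nhds _ hρ₁)).exists
    rw [← hw y hyb hy.1, hy.2]
  have hx0 : x' = 0 := by
    obtain ⟨y, hyb, hy⟩ := mem_closure_iff_nhds.1 (γ.apply_mem_closure_compl_region s) _
      (Metric.ball_mem_nhds _ hρ₂)
    rw [← hx' y hyb hy]
    exact γ.winding_eq_zero_of_not_mem_region h.lt h.chord_subset hy
  refine h.redundant_of_peak ⟨hs.1.le, hsq.2⟩ (hup s hs).le hf hb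
    (fun t ht => hsmax t ⟨ht.1, ht.2.trans hs.2.le⟩) (ρ := min ρ₁ (min ρ₂ ρ₃))
    (lt_min hρ₁ (lt_min hρ₂ hch.pos)) fun y hy hyup => ?_
  have hyρ₁ := Metric.ball_subset_ball (min_le_left _ _) hy
  have hyρ₂ := Metric.ball_subset_ball ((min_le_right _ _).trans (min_le_left _ _)) hy
  have hyρ₃ := Metric.ball_subset_ball ((min_le_right _ _).trans (min_le_right _ _)) hy
  have hyin : y ∈ P.inside := by
    refine ⟨?_, fun hyJ => ?_⟩
    · by_contra hcon
      have h1 := hw' y hyρ₁ hcon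
      rw [γ.winding_eq_zero hα.1 (e := -e)] at h1
      · exact hww (hw0.trans h1)
      · intro z hz
        rw [cross2_sub_right] at hyup
        rw [cross2_neg_left, cross2_sub_right]
        rcases hz with ⟨t, ht, rfl⟩ | hz
        · linarith [hsmax t ht]
        · obtain ⟨c, -, rfl⟩ := exists_eq_add_of_mem_segment hz
          rw [cross2_add_right, cross2_smul_right, cross2_sub_right, hαlev]
          linarith [hup s hs]
    · obtain ⟨c, hc, h1⟩ := (hch.mem_iff y hyρ₃).1 hyJ
      have h2 : cross2 e d₁ ≤ 0 ∧ cross2 e d₂ ≤ 0 := by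
        rcases hdir with ⟨rfl, rfl⟩ | ⟨rfl, rfl⟩
        · exact ⟨hf.le, hb⟩
        · exact ⟨hb, hf.le⟩
      rcases h1 with rfl | rfl
      · rw [add_sub_cancel_left, cross2_smul_right] at hyup
        nlinarith [h2.1]
      · rw [add_sub_cancel_left, cross2_smul_right] at hyup
        nlinarith [h2.2]
  refine ⟨hyin, ?_⟩
  rw [hx y hyρ₂ hyin, ← hx0]
  exact hxx

end IsBay

end Param

end SimplePolygon

namespace SimplePolygon

variable {P : SimplePolygon}

namespace Param

variable (γ : P.Param)

theorem reverse_apply (s : ℝ) : γ.reverse s = γ (-s) := rfl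

theorem brkNum_neg (a b : ℝ) : brkNum (-b) (-a) = brkNum a b := by
  simp only [brkNum, Int.ceil_neg, Int.floor_neg]
  congr 1
  ring

theorem brk_neg {a b : ℝ} (hab : a < b) {i : ℕ} (hi : i ≤ brkNum a b) :
    brk (-b) (-a) i = -brk a b (brkNum a b - i) := by
  have h1 : ((brkNum a b - i : ℕ) : ℝ) = ⌈b⌉ - ⌊a⌋ - i := by
    rw [Nat.cast_sub hi]
    have := cast_brkNum hab
    have h2 : ((brkNum a b : ℤ) : ℝ) = ((⌈b⌉ - ⌊a⌋ : ℤ) : ℝ) := by rw [this]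
    push_cast at h2
    rw [h2]
  simp only [brk, h1, Int.floor_neg]
  push_cast
  have h2 : -(⌈b⌉ : ℝ) + i = -(⌊a⌋ + (⌈b⌉ - ⌊a⌋ - i)) := by ring
  rw [h2, min_neg_neg, max_neg_neg, min_max_distrib_left, min_eq_right hab.le]

theorem loopPts_reverse {a b : ℝ} (hab : a < b) {i : ℕ} (hi : i ≤ brkNum a b) :
    γ.reverse.loopPts (-b) (-a) i = γ.loopPts a b (brkNum a b - i) := by
  rw [loopPts, loopPts, if_pos (by rwa [brkNum_neg]), if_pos (Nat.sub_le _ _), brk_neg hab hi,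
    reverse_apply, neg_neg]

theorem winding_reverse {a b : ℝ} (hab : a < b) {x : E2} (hx : x ∉ γ.loop a b) :
    γ.reverse.winding (-b) (-a) x = -γ.winding a b x := by
  have hsw : ∀ i < brkNum a b + 1,
      viewAngle (γ.loopPts a b (i + 1)) (γ.loopPts a b i) x =
        -viewAngle (γ.loopPts a b i) (γ.loopPts a b (i + 1)) x := fun i hi =>
    viewAngle_swap fun h => hx (γ.segment_loopPts_subset hab hi h)
  have hlast : γ.reverse.loopPts (-b) (-a) (brkNum a b + 1) = γ.loopPts a b (brkNum a b) := by
    rw [← brkNum_neg, loopPts_last, reverse_apply, neg_neg, brkNum_neg, loopPts_brkNum _ hab]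
  rw [winding, winding, sweep, sweep, brkNum_neg, Finset.sum_range_succ, Finset.sum_range_succ,
    hlast, loopPts_reverse _ hab le_rfl, Nat.sub_self, neg_add, ← hsw _ (Nat.lt_succ_self _),
    loopPts_closed, ← Finset.sum_range_reflect, ← Finset.sum_neg_distrib]
  congr 1
  refine Finset.sum_congr rfl fun i hi => ?_
  rw [Finset.mem_range] at hi
  rw [loopPts_reverse _ hab (by omega), loopPts_reverse _ hab (by omega), ← hsw i (by omega)]
  congr 2 <;> omega

/-- On each side of its chord, the winding of a loop is locally constant. -/
theorem exists_winding_halfBall {p q : ℝ} (hpq : p < q) {e y : E2}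
    (hlev : cross2 e (γ q) = cross2 e (γ p)) (hy : cross2 e y = cross2 e (γ p))
    (hyarc : y ∉ γ '' Icc p q) :
    ∃ ρ > 0, ∃ w, ∀ z ∈ Metric.ball y ρ, 0 < cross2 e (z - y) → γ.winding p q z = w := by
  obtain ⟨ρ, hρ, hball⟩ := Metric.isOpen_iff.1
    (isCompact_Icc.image γ.cont).isClosed.isOpen_compl _ hyarc
  have hdisj : Disjoint ({z | 0 < cross2 e (z - y)} ∩ Metric.ball y ρ) (γ.loop p q) := by
    rw [Set.disjoint_left]
    rintro z ⟨hz, hzb⟩ (hza | hzc)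
    · exact hball hzb hza
    · obtain ⟨c, -, rfl⟩ := exists_eq_add_of_mem_segment hzc
      simp only [mem_ofPred_eq, cross2_sub_right, cross2_add_right, cross2_smul_right, hlev, hy]
        at hz
      linarith
  have hpre : IsPreconnected ({z | 0 < cross2 e (z - y)} ∩ Metric.ball y ρ) :=
    ((convex_cross2_pos e _).inter (convex_ball _ _)).isPreconnected
  rcases ({z | 0 < cross2 e (z - y)} ∩ Metric.ball y ρ).eq_empty_or_nonempty with h0 | ⟨z₀, hz₀⟩
  · refine ⟨ρ, hρ, 0, fun z hz hz' => ?_⟩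
    exact absurd (show z ∈ ({z | 0 < cross2 e (z - y)} ∩ Metric.ball y ρ) from ⟨hz', hz⟩)
      (h0 ▸ notMem_empty z)
  · exact ⟨ρ, hρ, _, fun z hz hz' => γ.winding_eq_of_isPreconnected hpq hpre hdisj ⟨hz', hz⟩ hz₀⟩

theorem eventually_add_smul_mem {y d : E2} {V : Set E2} (hV : V ∈ 𝓝 y) :
    ∀ᶠ ε in 𝓝[>] (0 : ℝ), y + ε • d ∈ V := by
  have hc : ContinuousAt (fun ε : ℝ => y + ε • d) 0 := by fun_prop
  exact nhdsWithin_le_nhds (hc.preimage_mem_nhds (by simpa using hV))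

theorem eventually_winding_ne_of_frequently {p q : ℝ} (hpq : p < q) {e : E2} (he : e ≠ 0)
    (hlev : cross2 e (γ q) = cross2 e (γ p))
    (harc : ∀ y ∈ openSegment ℝ (γ q) (γ p), y ∉ γ '' Icc p q) {y₀ : E2}
    (hy₀ : y₀ ∈ openSegment ℝ (γ q) (γ p))
    (hfr : ∃ᶠ ε in 𝓝[>] (0 : ℝ), γ.winding p q (y₀ + ε • perp e) ≠ 0) :
    ∀ y ∈ openSegment ℝ (γ q) (γ p), ∀ᶠ ε in 𝓝[>] (0 : ℝ),
      γ.winding p q (y + ε • perp e) ≠ 0 := by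
  have hpe := sq_add_sq_pos_of_ne_zero he
  rw [← cross2_perp] at hpe
  have hlevel : ∀ y ∈ openSegment ℝ (γ q) (γ p), cross2 e y = cross2 e (γ p) := by
    intro y hy
    obtain ⟨c, -, rfl⟩ := exists_eq_add_of_mem_segment (openSegment_subset_segment _ _ _ hy)
    rw [cross2_add_right, cross2_smul_right, cross2_sub_right, hlev]
    ring
  have key : ∀ y ∈ openSegment ℝ (γ q) (γ p), ∃ V ∈ 𝓝 y, ∃ w : ℝ,
      ∀ y' ∈ openSegment ℝ (γ q) (γ p), y' ∈ V →
        ∀ᶠ ε in 𝓝[>] (0 : ℝ), γ.winding p q (y' + ε • perp e) = w := by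
    intro y hy
    obtain ⟨ρ, hρ, w, hw⟩ := γ.exists_winding_halfBall hpq hlev (hlevel y hy) (harc y hy)
    refine ⟨_, Metric.ball_mem_nhds y hρ, w, fun y' hy' hyV => ?_⟩
    filter_upwards [eventually_add_smul_mem (d := perp e) (Metric.isOpen_ball.mem_nhds hyV),
      self_mem_nhdsWithin] with ε h1 h2
    refine hw _ h1 ?_
    rw [cross2_sub_right, cross2_add_right, cross2_smul_right, hlevel y hy, hlevel y' hy']
    linarith [mul_pos (show (0 : ℝ) < ε from h2) hpe]
  have hiff : ∀ y' w, (∀ᶠ ε in 𝓝[>] (0 : ℝ), γ.winding p q (y' + ε • perp e) = w) →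
      ((∃ᶠ ε in 𝓝[>] (0 : ℝ), γ.winding p q (y' + ε • perp e) ≠ 0) ↔ w ≠ 0) := by
    intro y' w h
    constructor
    · intro h'
      obtain ⟨ε, h1, h2⟩ := (h'.and_eventually h).exists
      rwa [← h2]
    · intro h'
      exact (h.mono fun ε hε => by rwa [hε]).frequently
  intro y hy
  have hfy := ((convex_openSegment _ _).isPreconnected.iff_of_eventually_iff
    (Q := fun y => ∃ᶠ ε in 𝓝[>] (0 : ℝ), γ.winding p q (y + ε • perp e) ≠ 0) (fun x hx => by
      obtain ⟨V, hV, w, hw⟩ := key x hx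
      filter_upwards [mem_nhdsWithin_of_mem_nhds hV, self_mem_nhdsWithin] with x' h1 h2
      rw [hiff x w (hw x hx (mem_of_mem_nhds hV)), hiff x' w (hw x' h2 h1)]) hy₀ hy).1 hfr
  obtain ⟨V, hV, w, hw⟩ := key y hy
  have hwy := hw y hy (mem_of_mem_nhds hV)
  have := (hiff y w hwy).1 hfy
  exact hwy.mono fun ε hε => by rwa [hε]

theorem openSegment_not_mem_arc {p q : ℝ} (hpq : p < q) (hqp : q < p + P.n)
    (h : ∀ s ∈ Ioo p q, γ s ∉ segment ℝ (γ q) (γ p)) :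
    ∀ y ∈ openSegment ℝ (γ q) (γ p), y ∉ γ '' Icc p q := by
  rintro _ hy ⟨t, ht, rfl⟩
  have hne := γ.apply_ne hpq hqp
  rcases ht.1.eq_or_lt with rfl | h1
  · exact hne (right_mem_openSegment_iff.1 hy).symm
  rcases ht.2.eq_or_lt with rfl | h2
  · exact hne (left_mem_openSegment_iff.1 hy).symm
  exact h t ⟨h1, h2⟩ (openSegment_subset_segment _ _ _ hy)

theorem perp_neg (e : E2) : perp (-e) = -perp e := by
  ext i; fin_cases i <;> simp [perp]

theorem isBay_or_isBay_neg (C : P.Cut) {e : E2} (he : e ≠ 0) {p q : ℝ} (lt : p < q)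
    (lt_add : q < p + P.n) (level : cross2 e (γ q) = cross2 e (γ p))
    (chord_subset : segment ℝ (γ q) (γ p) ⊆ P.region)
    (not_mem_chord : ∀ s ∈ Ioo p q, γ s ∉ segment ℝ (γ q) (γ p))
    (arc_subset : γ '' Ioo p q ⊆ C.comp) (level_v : cross2 e C.v = cross2 e (γ p))
    (level_w : cross2 e C.w = cross2 e (γ p)) (exists_v : ∃ z ∈ Ioo q (p + P.n), C.v = γ z) :
    γ.IsBay C e p q ∨ γ.IsBay C (-e) p q := by
  have harc := γ.openSegment_not_mem_arc lt lt_add not_mem_chord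
  have hne := γ.apply_ne lt lt_add
  obtain ⟨y₀, hy₀⟩ : (openSegment ℝ (γ q) (γ p)).Nonempty :=
    ⟨_, 1 / 2, 1 / 2, by norm_num, by norm_num, by norm_num, rfl⟩
  have hpe := sq_add_sq_pos_of_ne_zero he
  rw [← cross2_perp] at hpe
  have hjump := γ.eventually_winding_ne_of_mem_chord lt hy₀ (harc y₀ hy₀) (ν := perp e) (by
    obtain ⟨c, hc⟩ := exists_smul_of_cross2_eq_zero he
      (show cross2 e (γ p - γ q) = 0 by rw [cross2_sub_right, level, sub_self])
    rw [hc, cross2_smul_left]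
    refine mul_ne_zero ?_ hpe.ne'
    rintro rfl
    rw [zero_smul, sub_eq_zero] at hc
    exact hne hc)
  by_cases hfr : ∃ᶠ ε in 𝓝[>] (0 : ℝ), γ.winding p q (y₀ + ε • perp e) ≠ 0
  · exact Or.inl ⟨lt, lt_add, level, chord_subset, not_mem_chord,
      γ.eventually_winding_ne_of_frequently lt he level harc hy₀ hfr, arc_subset, level_v, level_w,
      exists_v⟩
  · have hlev' : cross2 (-e) (γ q) = cross2 (-e) (γ p) := by
      rw [cross2_neg_left, cross2_neg_left, level]
    refine Or.inr ⟨lt, lt_add, hlev', chord_subset, not_mem_chord,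
      γ.eventually_winding_ne_of_frequently lt (neg_ne_zero.2 he) hlev' harc hy₀ ?_, arc_subset,
      by rw [cross2_neg_left, cross2_neg_left, level_v],
      by rw [cross2_neg_left, cross2_neg_left, level_w], exists_v⟩
    rw [not_frequently] at hfr
    refine (hjump.and hfr).frequently.mono ?_
    rintro ε ⟨h1, h2⟩
    rw [not_not] at h2
    rw [perp_neg, smul_neg, ← sub_eq_add_neg]
    rw [h2] at h1
    exact h1.symm

variable {γ}

theorem IsBay.reverse {C : P.Cut} {e : E2} {p q : ℝ} (h : γ.IsBay C e p q) (he : e ≠ 0) :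
    γ.reverse.IsBay C e (-q) (-p) := by
  have hpe := sq_add_sq_pos_of_ne_zero he
  rw [← cross2_perp] at hpe
  refine ⟨neg_lt_neg h.lt, by linarith [h.lt_add], ?_, ?_, ?_, ?_, ?_, ?_, ?_, ?_⟩
  · simp only [reverse_apply, neg_neg]
    exact h.level.symm
  · simp only [reverse_apply, neg_neg]
    rw [segment_symm]
    exact h.chord_subset
  · intro s hs
    simp only [reverse_apply, neg_neg]
    rw [segment_symm]
    exact h.not_mem_chord _ ⟨by linarith [hs.2], by linarith [hs.1]⟩
  · intro y hy
    simp only [reverse_apply, neg_neg] at hy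
    rw [openSegment_symm] at hy
    have hyarc := γ.openSegment_not_mem_arc h.lt h.lt_add h.not_mem_chord y hy
    filter_upwards [h.winding_ne y hy, self_mem_nhdsWithin, eventually_add_smul_mem (d := perp e)
      ((isCompact_Icc.image γ.cont).isClosed.isOpen_compl.mem_nhds hyarc)] with ε h1 h2 h3
    rw [γ.winding_reverse h.lt]
    · exact neg_ne_zero.2 h1
    · rintro (h' | h')
      · exact h3 h'
      · have := h.level_chord h'
        rw [cross2_add_right, cross2_smul_right,
          h.level_chord (openSegment_subset_segment _ _ _ hy)] at this
        linarith [mul_pos (show (0 : ℝ) < ε from h2) hpe]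
  · rintro _ ⟨s, hs, rfl⟩
    exact h.arc_subset ⟨-s, ⟨by linarith [hs.2], by linarith [hs.1]⟩, rfl⟩
  · simp only [reverse_apply, neg_neg]
    rw [h.level_v, h.level]
  · simp only [reverse_apply, neg_neg]
    rw [h.level_w, h.level]
  · obtain ⟨z, hz, hvz⟩ := h.exists_v
    refine ⟨P.n - z, ⟨by linarith [hz.2], by linarith [hz.1]⟩, ?_⟩
    rw [reverse_apply, hvz, neg_sub, ← γ.periodic (z - P.n), sub_add_cancel]

end Param

end SimplePolygon

namespace SimplePolygon

variable {P : SimplePolygon}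

namespace Param

variable (γ : P.Param)

theorem exists_first_return {e : E2} {p s₀ : ℝ} (hp : 0 < cross2 e (γ.fwd p)) (hps : p < s₀)
    (hs₀ : cross2 e (γ s₀) < cross2 e (γ p)) :
    ∃ α ∈ Ioo p s₀, cross2 e (γ α) = cross2 e (γ p) ∧
      ∀ t ∈ Ioo p α, cross2 e (γ p) < cross2 e (γ t) := by
  have hcont : Continuous fun t => cross2 e (γ t) := (continuous_cross2_right e).comp γ.cont
  have hst := step_pos p
  have hstart : ∀ t ∈ Ioc p (p + step p), cross2 e (γ p) < cross2 e (γ t) := by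
    intro t ht
    have hθ : (t - p) / step p ∈ Icc (0 : ℝ) 1 :=
      ⟨div_nonneg (by linarith [ht.1]) hst.le, (div_le_one hst).2 (by linarith [ht.2])⟩
    have := γ.fwd_lin p hθ
    rw [div_mul_cancel₀ _ hst.ne', add_sub_cancel] at this
    rw [this, cross2_add_right, cross2_smul_right]
    linarith [mul_pos (div_pos (by linarith [ht.1] : 0 < t - p) hst) hp]
  have hs₀' : p + step p < s₀ := by
    by_contra hcon
    linarith [hstart s₀ ⟨hps, not_lt.1 hcon⟩]
  have hcomp : IsCompact (Icc (p + step p) s₀ ∩ {t | cross2 e (γ t) ≤ cross2 e (γ p)}) :=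
    isCompact_Icc.inter_right (isClosed_le hcont continuous_const)
  obtain ⟨α, ⟨hα, hαle⟩, hlb⟩ := hcomp.exists_isLeast ⟨s₀, ⟨hs₀'.le, le_rfl⟩, hs₀.le⟩
  have hαle' : cross2 e (γ α) ≤ cross2 e (γ p) := hαle
  have hpα : p < α := by linarith [hα.1]
  have hup : ∀ t ∈ Ioo p α, cross2 e (γ p) < cross2 e (γ t) := by
    intro t ht
    by_contra hcon
    rcases le_total t (p + step p) with h1 | h1
    · exact hcon (hstart t ⟨ht.1, h1⟩)
    · exact absurd (hlb ⟨⟨h1, ht.2.le.trans hα.2⟩, not_lt.1 hcon⟩) (not_le.2 ht.2)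
  have hge : cross2 e (γ p) ≤ cross2 e (γ α) := by
    have hcl : IsClosed {t | cross2 e (γ p) ≤ cross2 e (γ t)} := isClosed_le continuous_const hcont
    have hsub : Ioo p α ⊆ {t | cross2 e (γ p) ≤ cross2 e (γ t)} := fun t ht => (hup t ht).le
    have := hcl.closure_subset_iff.2 hsub
    rw [closure_Ioo hpα.ne] at this
    exact this (right_mem_Icc.2 hpα.le)
  refine ⟨α, ⟨hpα, lt_of_le_of_ne hα.2 ?_⟩, le_antisymm hαle' hge, hup⟩
  rintro rfl
  linarith

variable {γ}

namespace IsBay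

variable {C : P.Cut} {e : E2} {p q : ℝ}

theorem exists_return (h : γ.IsBay C e p q) (he : e ≠ 0) (hC : C.Nonredundant)
    (hp : cross2 e (γ.fwd p) ≠ 0) {s₀ : ℝ} (hs₀ : s₀ ∈ Ioo p q)
    (hneg : cross2 e (γ s₀) < cross2 e (γ p)) :
    ∃ α ∈ Ioo p s₀, ∃ a : ℝ, 1 < a ∧ γ α = γ p + a • (γ q - γ p) ∧
      ∀ t ∈ Ioo p α, cross2 e (γ p) < cross2 e (γ t) := by
  have hp' : 0 < cross2 e (γ.fwd p) :=
    lt_of_le_of_ne (not_lt.1 fun hlt => hC (h.redundant_of_fwd_neg hlt)) hp.symm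
  obtain ⟨α, hα, hlev, hup⟩ := γ.exists_first_return hp' hs₀.1 hneg
  have hαq : α ∈ Ioo p q := ⟨hα.1, hα.2.trans hs₀.2⟩
  have hg0 : γ q - γ p ≠ 0 := sub_ne_zero.2 (γ.apply_ne h.lt h.lt_add).symm
  obtain ⟨a, ha⟩ : ∃ a : ℝ, γ α - γ p = a • (γ q - γ p) := by
    obtain ⟨c, hc⟩ := exists_smul_of_cross2_eq_zero he
      (show cross2 e (γ q - γ p) = 0 by rw [cross2_sub_right, h.level, sub_self])
    obtain ⟨c', hc'⟩ := exists_smul_of_cross2_eq_zero he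
      (show cross2 e (γ α - γ p) = 0 by rw [cross2_sub_right, hlev, sub_self])
    refine exists_smul_of_cross2_eq_zero hg0 ?_
    rw [hc, hc', cross2_smul_left, cross2_smul_right, cross2_self, mul_zero, mul_zero]
  have halpha : γ α = γ p + a • (γ q - γ p) := by rw [← ha, add_sub_cancel]
  refine ⟨α, hα, a, ?_, halpha, hup⟩
  by_contra hcon
  rcases lt_or_ge a 0 with h0 | h0
  · refine hC (h.redundant_of_return hαq hup (m := -a) (by linarith) ?_)
    rw [halpha, neg_smul, sub_neg_eq_add]
  · refine h.not_mem_chord α hαq ?_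
    rw [segment_symm, segment_eq_image']
    exact ⟨a, ⟨h0, not_lt.1 hcon⟩, halpha.symm⟩

/-- The boundary arc of a bay of a nonredundant cut lies on one side of the chord. -/
theorem level_le (h : γ.IsBay C e p q) (he : e ≠ 0) (hC : C.Nonredundant)
    (hp : cross2 e (γ.fwd p) ≠ 0) (hq : cross2 e (γ.reverse.fwd (-q)) ≠ 0) {s : ℝ}
    (hs : s ∈ Icc p q) : cross2 e (γ p) ≤ cross2 e (γ s) := by
  by_contra hcon
  rw [not_le] at hcon
  have hs' : s ∈ Ioo p q := by
    refine ⟨lt_of_le_of_ne hs.1 ?_, lt_of_le_of_ne hs.2 ?_⟩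
    · rintro rfl; linarith
    · rintro rfl; linarith [h.level]
  have hpe := sq_add_sq_pos_of_ne_zero he
  rw [← cross2_perp] at hpe
  obtain ⟨α, hα, a, ha, hγα, hupα⟩ := h.exists_return he hC hp hs' hcon
  obtain ⟨β', hβ', b, hb, hγβ, hupβ⟩ := (h.reverse he).exists_return he hC hq (s₀ := -s)
    ⟨by linarith [hs'.2], by linarith [hs'.1]⟩
    (by simp only [reverse_apply, neg_neg]; rw [h.level]; exact hcon)
  obtain ⟨β, rfl⟩ : ∃ β, β' = -β := ⟨-β', (neg_neg _).symm⟩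
  simp only [reverse_apply, neg_neg] at hγβ hupβ
  have hβ : β ∈ Ioo s q := ⟨by linarith [hβ'.2], by linarith [hβ'.1]⟩
  have hupβ' : ∀ t ∈ Ioo β q, cross2 e (γ p) < cross2 e (γ t) := by
    intro t ht
    have := hupβ (-t) ⟨by linarith [ht.2], by linarith [ht.1]⟩
    rwa [neg_neg, h.level] at this
  have hlevα : cross2 e (γ α) = cross2 e (γ p) := by
    rw [hγα, cross2_add_right, cross2_smul_right, cross2_sub_right, h.level]; ring
  have hlevβ : cross2 e (γ β) = cross2 e (γ p) := by
    rw [hγβ, cross2_add_right, cross2_smul_right, cross2_sub_right, h.level]; ring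
  have hg0 : γ q - γ p ≠ 0 := sub_ne_zero.2 (γ.apply_ne h.lt h.lt_add).symm
  have hsep : ∀ t ∈ Icc β q, γ t ∉ γ '' Icc p α := by
    rintro t ht ⟨t', ht', heq⟩
    exact γ.apply_ne (by linarith [ht'.2, hα.2, hβ.1, ht.1])
      (by linarith [ht.2, ht'.1, h.lt_add]) heq
  have hqchord : γ q ∈ openSegment ℝ (γ α) (γ p) := by
    rw [openSegment_symm, openSegment_eq_image']
    refine ⟨a⁻¹, ⟨by positivity, inv_lt_one_of_one_lt₀ ha⟩, ?_⟩
    simp only [hγα, add_sub_cancel_left, smul_smul]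
    rw [inv_mul_cancel₀ (by linarith), one_smul, add_sub_cancel]
  have hlow : ∀ y, cross2 e y < cross2 e (γ p) → γ.winding p α y = 0 := by
    intro y hy
    refine γ.winding_eq_zero hα.1 (e := e) ?_
    rintro z (⟨t, ht, rfl⟩ | hz)
    · rw [cross2_sub_right]
      rcases ht.1.eq_or_lt with rfl | h1
      · linarith
      rcases ht.2.eq_or_lt with rfl | h2
      · linarith
      linarith [hupα t ⟨h1, h2⟩]
    · obtain ⟨c, -, rfl⟩ := exists_eq_add_of_mem_segment hz
      rw [cross2_sub_right, cross2_add_right, cross2_smul_right, cross2_sub_right, hlevα]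
      linarith
  have hqarc := hsep q ⟨hβ.2.le, le_rfl⟩
  have hjump := γ.eventually_winding_ne_of_mem_chord hα.1 hqchord hqarc (ν := perp e) (by
    obtain ⟨c, hc⟩ := exists_smul_of_cross2_eq_zero he
      (show cross2 e (γ p - γ α) = 0 by rw [cross2_sub_right, hlevα, sub_self])
    rw [hc, cross2_smul_left]
    refine mul_ne_zero ?_ hpe.ne'
    rintro rfl
    rw [zero_smul, sub_eq_zero] at hc
    exact γ.apply_ne hα.1 (by linarith [hα.2, hs'.2, h.lt_add]) hc)
  obtain ⟨ρ, hρ, w, hw⟩ := γ.exists_winding_halfBall hα.1 hlevα h.level hqarc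
  have hw0 : w ≠ 0 := by
    obtain ⟨ε, ⟨h1, h2⟩, h3⟩ := ((hjump.and (eventually_add_smul_mem (d := perp e)
      (Metric.ball_mem_nhds (γ q) hρ))).and self_mem_nhdsWithin).exists
    have hε := mul_pos (show (0 : ℝ) < ε from h3) hpe
    rw [hlow (γ q - ε • perp e) (by
        rw [cross2_sub_right, cross2_smul_right, h.level]; linarith),
      hw _ h2 (by rw [add_sub_cancel_left, cross2_smul_right]; exact hε)] at h1
    exact h1
  obtain ⟨t, htb, ht⟩ : ∃ t, γ t ∈ Metric.ball (γ q) ρ ∧ t ∈ Ioo β q := by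
    have h1 : ∀ᶠ t in 𝓝[<] q, γ t ∈ Metric.ball (γ q) ρ :=
      nhdsWithin_le_nhds (γ.cont.continuousAt.preimage_mem_nhds (Metric.ball_mem_nhds _ hρ))
    exact (h1.and (Ioo_mem_nhdsLT hβ.2)).exists
  have hwt : γ.winding p α (γ t) = w :=
    hw _ htb (by rw [cross2_sub_right, h.level]; linarith [hupβ' t ht])
  have hdisj : Disjoint (γ '' Icc β t) (γ.loop p α) := by
    rw [Set.disjoint_left]
    rintro _ ⟨r, hr, rfl⟩ (h' | h')
    · exact hsep r ⟨hr.1, hr.2.trans ht.2.le⟩ h'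
    · obtain ⟨c, hc, hcr⟩ := exists_eq_add_of_mem_segment h'
      rcases hr.1.eq_or_lt with rfl | h1
      · rw [hγβ, hγα] at hcr
        have h2 : (1 - b - c * a) • (γ q - γ p) = 0 := by
          have h3 := sub_eq_zero.2 hcr
          rw [← h3]
          module
        rcases smul_eq_zero.1 h2 with h3 | h3
        · nlinarith [hc.1]
        · exact hg0 h3
      · have := hupβ' r ⟨h1, hr.2.trans_lt ht.2⟩
        rw [hcr, cross2_add_right, cross2_smul_right, cross2_sub_right, hlevα] at this
        linarith
  have hβmem : γ β ∈ γ '' Icc β t := ⟨β, ⟨le_rfl, ht.1.le⟩, rfl⟩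
  have hwβ : γ.winding p α (γ β) = w := by
    rw [← hwt]
    exact γ.winding_eq_of_isPreconnected hα.1 (isPreconnected_Icc.image _ γ.cont.continuousOn)
      hdisj hβmem ⟨t, ⟨ht.1.le, le_rfl⟩, rfl⟩
  obtain ⟨r, hr, hball⟩ := Metric.isOpen_iff.1 (γ.isCompact_loop p α).isClosed.isOpen_compl _
    (Set.disjoint_left.1 hdisj hβmem)
  obtain ⟨ε₀, hε₀, hε⟩ := exists_small_smul_mem_ball (γ β) (-perp e) hr
  have h1 := hε (ε₀ / 2) ⟨by linarith, by linarith⟩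
  refine hw0 ?_
  rw [← hwβ, γ.winding_eq_of_isPreconnected hα.1 (convex_ball _ r).isPreconnected
    (subset_compl_iff_disjoint_right.1 hball) (Metric.mem_ball_self hr) h1]
  refine hlow _ ?_
  rw [cross2_add_right, cross2_smul_right, cross2_neg_right, hlevβ]
  nlinarith

end IsBay

end Param

end SimplePolygon

/-- A preconnected subset of a line is convex. -/
theorem segment_subset_of_cross2_eq {S : Set E2} (hS : IsPreconnected S) {e : E2} (he : e ≠ 0)
    {c : ℝ} (hlev : ∀ y ∈ S, cross2 e y = c) {a b : E2} (ha : a ∈ S) (hb : b ∈ S) :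
    segment ℝ a b ⊆ S := by
  intro y hy
  obtain ⟨θ, hθ, rfl⟩ : ∃ θ ∈ Icc (0 : ℝ) 1, a + θ • (b - a) = y := by
    rwa [segment_eq_image'] at hy
  have hpe := sq_add_sq_pos_of_ne_zero he
  rw [← cross2_perp] at hpe
  have hord : OrdConnected ((fun y => cross2 y (perp e)) '' S) :=
    (hS.image _ (continuous_cross2_left (perp e)).continuousOn).ordConnected
  have hmem : cross2 (a + θ • (b - a)) (perp e) ∈ uIcc (cross2 a (perp e)) (cross2 b (perp e)) := by
    rw [← segment_eq_uIcc, segment_eq_image']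
    refine ⟨θ, hθ, ?_⟩
    simp only [cross2_add_left, cross2_smul_left, cross2_sub_left, smul_eq_mul]
  obtain ⟨y', hy', hX⟩ := hord.uIcc_subset (mem_image_of_mem _ ha) (mem_image_of_mem _ hb) hmem
  have hX' : cross2 y' (perp e) = cross2 (a + θ • (b - a)) (perp e) := hX
  obtain ⟨k, hk⟩ := exists_smul_of_cross2_eq_zero he
    (show cross2 e (a + θ • (b - a) - y') = 0 by
      rw [cross2_sub_right, cross2_add_right, cross2_smul_right, cross2_sub_right, hlev _ ha,
        hlev _ hb, hlev _ hy']
      ring)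
  have h0 : k * cross2 e (perp e) = 0 := by
    rw [← cross2_smul_left, ← hk, cross2_sub_left, hX', sub_self]
  rw [(mul_eq_zero.1 h0).resolve_right hpe.ne', zero_smul, sub_eq_zero] at hk
  rwa [hk]

namespace SimplePolygon

variable {P : SimplePolygon}

namespace Param

variable (γ : P.Param)

/-- The last point up to which an arc stays on the line where it starts. -/
theorem exists_departure {e : E2} {a b t₀ : ℝ} (ht₀ : t₀ ∈ Icc a b)
    (hne : cross2 e (γ t₀) ≠ cross2 e (γ a)) :
    ∃ s ∈ Ico a t₀, (∀ t ∈ Icc a s, cross2 e (γ t) = cross2 e (γ a)) ∧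
      cross2 e (γ.fwd s) ≠ 0 := by
  have hcont : Continuous fun t => cross2 e (γ t) := (continuous_cross2_right e).comp γ.cont
  set A := {t | t ∈ Icc a b ∧ cross2 e (γ t) ≠ cross2 e (γ a)} with hA
  have hA0 : A.Nonempty := ⟨t₀, ht₀, hne⟩
  have hbdd : BddBelow A := ⟨a, fun t ht => ht.1.1⟩
  have has : a ≤ sInf A := le_csInf hA0 fun t ht => ht.1.1
  have hst₀ : sInf A ≤ t₀ := csInf_le hbdd ⟨ht₀, hne⟩
  have hlt : ∀ t ∈ Ico a (sInf A), cross2 e (γ t) = cross2 e (γ a) := by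
    intro t ht
    by_contra hcon
    exact absurd (csInf_le hbdd ⟨⟨ht.1, by linarith [ht.2, ht₀.2]⟩, hcon⟩) (not_le.2 ht.2)
  have hle : ∀ t ∈ Icc a (sInf A), cross2 e (γ t) = cross2 e (γ a) := by
    rcases has.eq_or_lt with h | h
    · intro t ht
      rw [← h] at ht
      rw [le_antisymm ht.2 ht.1]
    · have hcl : IsClosed {t | cross2 e (γ t) = cross2 e (γ a)} :=
        isClosed_eq hcont continuous_const
      have := hcl.closure_subset_iff.2 hlt
      rwa [closure_Ico h.ne] at this
  have hst : sInf A < t₀ := by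
    refine lt_of_le_of_ne hst₀ fun h => hne ?_
    rw [← h]
    exact hle _ ⟨has, le_rfl⟩
  refine ⟨sInf A, ⟨has, hst⟩, hle, fun h0 => ?_⟩
  have hpos := step_pos (sInf A)
  have : sInf A + step (sInf A) ≤ sInf A := by
    refine le_csInf hA0 fun t ht => ?_
    by_contra hcon
    have hts : sInf A ≤ t := csInf_le hbdd ht
    have hθ : (t - sInf A) / step (sInf A) ∈ Icc (0 : ℝ) 1 :=
      ⟨div_nonneg (by linarith) hpos.le, (div_le_one hpos).2 (by linarith)⟩
    have h1 := γ.fwd_lin (sInf A) hθ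
    rw [div_mul_cancel₀ _ hpos.ne', add_sub_cancel] at h1
    apply ht.2
    rw [h1, cross2_add_right, cross2_smul_right, h0, mul_zero, add_zero]
    exact hle _ ⟨has, le_rfl⟩
  linarith

end Param

namespace Cut

variable (C : P.Cut)

theorem exists_param : ∃ γ : P.Param, γ 0 = C.v ∧ γ 1 = C.u := by
  obtain ⟨m, hm⟩ := ZMod.intCast_surjective C.i
  have hinteger : ∀ k : ℤ, P.param (k : ℝ) = P.vtx (k : ZMod P.n) := fun k => boundaryPoint_int k
  have h0 := hinteger m
  rcases C.adj with hj | hj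
  · refine ⟨P.param.shift m, ?_, ?_⟩
    · change P.param (0 + m) = P.vtx C.i
      rw [zero_add, h0, hm]
    · change P.param (1 + m) = P.vtx C.j
      have := hinteger (1 + m)
      push_cast at this
      rw [this, hm, hj, add_comm]
  · refine ⟨(P.param.shift m).reverse, ?_, ?_⟩
    · change P.param (-0 + m) = P.vtx C.i
      rw [neg_zero, zero_add, h0, hm]
    · change P.param (-1 + m) = P.vtx C.j
      have := hinteger (-1 + m)
      push_cast at this
      rw [this, hm, hj, neg_add_eq_sub]

theorem v_ne_u : C.v ≠ C.u := by
  obtain ⟨γ, h0, h1⟩ := C.exists_param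
  rw [← h0, ← h1]
  exact γ.apply_ne one_pos (by linarith [P.n_pos_real])

theorem exists_w_eq {γ : P.Param} (h0 : γ 0 = C.v) (h1 : γ 1 = C.u) :
    ∃ τ : ℝ, 1 < τ ∧ τ < P.n ∧ γ τ = C.w := by
  obtain ⟨τ, hτ, hw⟩ := γ.exists_mem_Ico_of_mem 0 C.w_mem_boundary
  rw [zero_add] at hτ
  refine ⟨τ, ?_, hτ.2, hw⟩
  by_contra hcon
  have hlin := γ.lin 0 τ ⟨hτ.1, not_lt.1 hcon⟩
  simp only [Int.cast_zero, zero_add] at hlin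
  have hw' : γ.toFun τ = C.w := hw
  have h0' : γ.toFun 0 = C.v := h0
  have h1' : γ.toFun 1 = C.u := h1
  rw [hw', h0', h1', w_eq] at hlin
  have h2 : (C.t + τ) • (C.v - C.u) = 0 := by
    have := sub_eq_zero.2 hlin
    rw [← this]
    module
  rcases smul_eq_zero.1 h2 with h | h
  · linarith [C.t_pos, hτ.1]
  · exact C.v_ne_u (sub_eq_zero.1 h)

section

variable {C} {γ : P.Param} {τ : ℝ}

theorem apply_not_mem_seg (h0 : γ 0 = C.v) (hτn : τ < P.n) (hτ : γ τ = C.w) {s : ℝ}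
    (hs : s ∈ Ioo 0 τ) : γ s ∉ C.seg := by
  intro h
  rcases C.eq_v_or_eq_w h (γ.mem_boundary s) with h' | h'
  · exact γ.apply_ne hs.1 (by linarith [hs.2]) (h0.trans h'.symm)
  · exact γ.apply_ne hs.2 (by linarith [hs.1]) (h'.trans hτ.symm)

theorem u_mem_comp (h0 : γ 0 = C.v) (h1 : γ 1 = C.u) (hτ1 : 1 < τ) (hτn : τ < P.n)
    (hτ : γ τ = C.w) : C.u ∈ C.comp := by
  refine mem_connectedComponentIn ⟨?_, ?_⟩
  · rw [← h1]; exact boundary_subset_region (γ.mem_boundary _)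
  · rw [← h1]; exact apply_not_mem_seg h0 hτn hτ ⟨one_pos, hτ1⟩

theorem image_Ioo_subset_comp (h0 : γ 0 = C.v) (h1 : γ 1 = C.u) (hτ1 : 1 < τ)
    (hτn : τ < P.n) (hτ : γ τ = C.w) : γ '' Ioo 0 τ ⊆ C.comp := by
  refine C.subset_comp (isPreconnected_Ioo.image _ γ.cont.continuousOn) ?_ ?_ (x := C.u)
    ⟨1, ⟨one_pos, hτ1⟩, h1⟩ (u_mem_comp h0 h1 hτ1 hτn hτ)
  · rintro _ ⟨s, -, rfl⟩
    exact boundary_subset_region (γ.mem_boundary _)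
  · rw [Set.disjoint_left]
    rintro _ ⟨s, hs, rfl⟩
    exact apply_not_mem_seg h0 hτn hτ hs

theorem comp_inter_boundary_subset (h0 : γ 0 = C.v) (h1 : γ 1 = C.u)
    (hτ1 : 1 < τ) (hτn : τ < P.n) (hτ : γ τ = C.w) : C.comp ∩ P.boundary ⊆ γ '' Ioo 0 τ := by
  rintro z ⟨hz, hzJ⟩
  obtain ⟨t, ht, rfl⟩ := γ.exists_mem_Ico_of_mem 0 hzJ
  have hseg := (C.comp_subset hz).2
  have hsegeq : segment ℝ (γ τ) (γ 0) = C.seg := by rw [h0, hτ, segment_symm, seg]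
  refine ⟨t, ⟨lt_of_le_of_ne ht.1 ?_, ?_⟩, rfl⟩
  · rintro rfl
    exact hseg (h0 ▸ C.v_mem_seg)
  · by_contra hcon
    rcases (not_lt.1 hcon).eq_or_lt with rfl | h
    · exact hseg (hτ ▸ C.w_mem_seg)
    · refine γ.not_mem_of_chord (a := 0) (b := τ) (by linarith) (by linarith)
        (hsegeq ▸ C.seg_subset_region) C.isPreconnected_comp (hsegeq ▸ C.comp_subset)
        (s := 1) (t := t) ⟨one_pos, hτ1⟩ ⟨h, ht.2⟩ ?_ hz
      rw [h1]
      exact u_mem_comp h0 h1 hτ1 hτn hτ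

theorem exists_side_arc (h0 : γ 0 = C.v) (h1 : γ 1 = C.u) (hτ1 : 1 < τ) (hτn : τ < P.n)
    (hτ : γ τ = C.w) (hC : C.Nonredundant) :
    ∃ e : E2, e ≠ 0 ∧ cross2 e C.u = cross2 e C.v ∧ cross2 e C.w = cross2 e C.v ∧
      ∀ s ∈ Icc 0 τ, cross2 e C.v ≤ cross2 e (γ s) := by
  set e := C.v - C.u with he_def
  have he : e ≠ 0 := sub_ne_zero.2 C.v_ne_u
  have hlu : cross2 e C.u = cross2 e C.v := by
    have : cross2 e (C.v - C.u) = 0 := cross2_self e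
    rw [cross2_sub_right] at this
    linarith
  have hlw : cross2 e C.w = cross2 e C.v := by
    rw [w_eq, cross2_add_right, cross2_smul_right, ← he_def, cross2_self]; ring
  by_cases hall : ∀ s ∈ Icc 0 τ, cross2 e (γ s) = cross2 e C.v
  · exact ⟨e, he, hlu, hlw, fun s hs => (hall s hs).ge⟩
  push Not at hall
  obtain ⟨t₀, ht₀, hne⟩ := hall
  have hne0 : cross2 e (γ t₀) ≠ cross2 e (γ 0) := by rwa [h0]
  obtain ⟨s₁, hs₁, hflat₁, hfwd₁⟩ := γ.exists_departure ht₀ hne0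
  obtain ⟨s₂', hs₂', hflat₂', hfwd₂⟩ := γ.reverse.exists_departure (e := e) (a := -τ) (b := 0)
    (t₀ := -t₀) ⟨by linarith [ht₀.2], by linarith [ht₀.1]⟩
    (by simp only [Param.reverse_apply, neg_neg, hτ, hlw]; exact hne)
  obtain ⟨s₂, rfl⟩ : ∃ s₂, s₂' = -s₂ := ⟨-s₂', (neg_neg _).symm⟩
  have hs₂ : s₂ ∈ Ioc t₀ τ := ⟨by linarith [hs₂'.2], by linarith [hs₂'.1]⟩
  have hf1 : ∀ t ∈ Icc 0 s₁, cross2 e (γ t) = cross2 e C.v := fun t ht => h0 ▸ hflat₁ t ht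
  have hf2 : ∀ t ∈ Icc s₂ τ, cross2 e (γ t) = cross2 e C.v := by
    intro t ht
    have := hflat₂' (-t) ⟨by linarith [ht.2], by linarith [ht.1]⟩
    simpa only [Param.reverse_apply, neg_neg, hτ, hlw] using this
  have hs₁0 : 0 < s₁ := by
    refine lt_of_le_of_ne hs₁.1 ?_
    rintro rfl
    apply hfwd₁
    have := γ.fwd_int 0
    simp only [Int.cast_zero, zero_add] at this
    rw [this, h0, h1, cross2_sub_right, hlu, sub_self]
  have h12 : s₁ < s₂ := hs₁.2.trans hs₂.1
  -- the part of the pocket boundary contained in the line of the cut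
  set S := (γ '' Icc 0 s₁ ∪ C.seg) ∪ γ '' Icc s₂ τ with hS
  have hSpre : IsPreconnected S := by
    refine IsPreconnected.union (γ τ) (Or.inr (hτ ▸ C.w_mem_seg)) ⟨τ, ⟨hs₂.2, le_rfl⟩, rfl⟩
      (IsPreconnected.union (γ 0) ⟨0, ⟨le_rfl, hs₁.1⟩, rfl⟩ (h0 ▸ C.v_mem_seg)
        (isPreconnected_Icc.image _ γ.cont.continuousOn)
        (convex_segment _ _).isPreconnected)
      (isPreconnected_Icc.image _ γ.cont.continuousOn)
  have hSlev : ∀ y ∈ S, cross2 e y = cross2 e C.v := by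
    rintro y ((⟨t, ht, rfl⟩ | hy) | ⟨t, ht, rfl⟩)
    · exact hf1 t ht
    · rw [seg_eq_image] at hy
      obtain ⟨θ, -, rfl⟩ := hy
      simp only [cross2_add_right, cross2_smul_right, ← he_def, cross2_self]
      ring
    · exact hf2 t ht
  have hbase : segment ℝ (γ s₂) (γ s₁) ⊆ S := segment_subset_of_cross2_eq hSpre he hSlev
    (Or.inr ⟨s₂, ⟨le_rfl, hs₂.2⟩, rfl⟩) (Or.inl (Or.inl ⟨s₁, ⟨hs₁.1, le_rfl⟩, rfl⟩))
  have hSr : S ⊆ P.region := by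
    rintro y ((⟨t, ht, rfl⟩ | hy) | ⟨t, ht, rfl⟩)
    · exact boundary_subset_region (γ.mem_boundary _)
    · exact C.seg_subset_region hy
    · exact boundary_subset_region (γ.mem_boundary _)
  have hl1 := hf1 s₁ ⟨hs₁.1, le_rfl⟩
  have hl2 := hf2 s₂ ⟨le_rfl, hs₂.2⟩
  have hbay := γ.isBay_or_isBay_neg C he h12 (by linarith [hs₂.2]) (by rw [hl1, hl2])
    (hbase.trans hSr) (fun s hs hsb => by
      rcases hbase hsb with (⟨t, ht, heq⟩ | hy) | ⟨t, ht, heq⟩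
      · exact γ.apply_ne (by linarith [ht.2, hs.1]) (by linarith [ht.1, hs.2, hs₂.2]) heq
      · exact apply_not_mem_seg h0 hτn hτ
          ⟨by linarith [hs.1], by linarith [hs.2, hs₂.2]⟩ hy
      · exact γ.apply_ne (by linarith [ht.1, hs.2]) (by linarith [ht.2, hs.1]) heq.symm)
    ((image_mono (Ioo_subset_Ioo hs₁.1 hs₂.2)).trans (image_Ioo_subset_comp h0 h1 hτ1 hτn hτ))
    hl1.symm (hlw.trans hl1.symm) ⟨P.n, ⟨by linarith [hs₂.2], by linarith⟩, by
      have := γ.periodic 0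
      rw [zero_add] at this
      rw [← h0]; exact this.symm⟩
  have hext : ∀ s ∈ Icc 0 τ, s ∈ Icc s₁ s₂ ∨ cross2 e (γ s) = cross2 e C.v := by
    intro s hs
    rcases le_total s s₁ with h | h
    · exact Or.inr (hf1 s ⟨hs.1, h⟩)
    rcases le_total s₂ s with h' | h'
    · exact Or.inr (hf2 s ⟨h', hs.2⟩)
    exact Or.inl ⟨h, h'⟩
  rcases hbay with hbay | hbay
  · refine ⟨e, he, hlu, hlw, fun s hs => ?_⟩
    rcases hext s hs with h | h
    · rw [← hl1]
      exact hbay.level_le he hC hfwd₁ hfwd₂ h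
    · exact h.ge
  · refine ⟨-e, neg_ne_zero.2 he, by simpa only [cross2_neg_left, neg_inj] using hlu,
      by simpa only [cross2_neg_left, neg_inj] using hlw, fun s hs => ?_⟩
    rcases hext s hs with h | h
    · have := hbay.level_le (neg_ne_zero.2 he) hC
        (by rw [cross2_neg_left]; exact neg_ne_zero.2 hfwd₁)
        (by rw [cross2_neg_left]; exact neg_ne_zero.2 hfwd₂) h
      rwa [cross2_neg_left _ (γ s₁), hl1, ← cross2_neg_left] at this
    · rw [cross2_neg_left, cross2_neg_left, h]

end

/-- The pocket of a nonredundant cut lies on one side of the line carrying the cut. -/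
theorem exists_side (hC : C.Nonredundant) : ∃ e : E2, e ≠ 0 ∧ cross2 e C.u = cross2 e C.w ∧
    ∀ x ∈ C.pocket, cross2 e C.u ≤ cross2 e x := by
  obtain ⟨γ, h0, h1⟩ := C.exists_param
  obtain ⟨τ, hτ1, hτn, hτ⟩ := C.exists_w_eq h0 h1
  obtain ⟨e, he, hlu, hlw, hside⟩ := exists_side_arc h0 h1 hτ1 hτn hτ hC
  have hpe := sq_add_sq_pos_of_ne_zero he
  rw [← cross2_perp] at hpe
  have hseg : ∀ y ∈ C.seg, cross2 e y = cross2 e C.v := by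
    intro y hy
    rw [seg, segment_eq_image'] at hy
    obtain ⟨θ, -, rfl⟩ := hy
    rw [cross2_add_right, cross2_smul_right, cross2_sub_right, hlw]
    ring
  have hbd : ∀ y ∈ C.comp, y ∈ P.boundary → cross2 e C.v ≤ cross2 e y := by
    intro y hy hyJ
    obtain ⟨s, hs, rfl⟩ := comp_inter_boundary_subset h0 h1 hτ1 hτn hτ ⟨hy, hyJ⟩
    exact hside s (Ioo_subset_Icc_self hs)
  have hcomp : ∀ x ∈ C.comp, cross2 e C.v ≤ cross2 e x := by
    intro x hx
    by_contra hcon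
    rw [not_le] at hcon
    have hxin : x ∈ P.inside :=
      ⟨(C.comp_subset hx).1, fun hJ => absurd (hbd x hx hJ) (not_le.2 hcon)⟩
    obtain ⟨r, hr, hball⟩ := Metric.isOpen_iff.1 isOpen_inside _ hxin
    obtain ⟨δ, hδ, hδball⟩ := exists_small_smul_mem_ball x (-perp e) hr
    have hd : -perp e ≠ 0 := by
      intro h
      rw [neg_eq_zero.1 h, cross2_zero_right] at hpe
      exact lt_irrefl _ hpe
    obtain ⟨t, ht, htJ, htin⟩ := Param.exists_first_hit hd hδ fun t ht => hball (hδball t ht)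
    have hlow : ∀ θ : ℝ, 0 ≤ θ → cross2 e (x + θ • -perp e) < cross2 e C.v := by
      intro θ hθ
      rw [cross2_add_right, cross2_smul_right, cross2_neg_right]
      nlinarith
    have hsub : (fun θ : ℝ => x + θ • -perp e) '' Icc 0 t ⊆ C.comp := by
      refine C.subset_comp (isPreconnected_Icc.image _ (by fun_prop)) ?_ ?_
        (x := x) ⟨0, ⟨le_rfl, ht.le⟩, by simp⟩ hx
      · rintro _ ⟨θ, hθ, rfl⟩
        rcases hθ.1.eq_or_lt with rfl | hθ0
        · simpa using hxin.1
        rcases hθ.2.eq_or_lt with rfl | hθt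
        · exact boundary_subset_region htJ
        · exact (htin θ ⟨hθ0, hθt⟩).1
      · rw [Set.disjoint_left]
        rintro _ ⟨θ, hθ, rfl⟩ hy
        exact (hlow θ hθ.1).ne (hseg _ hy)
    exact absurd (hbd _ (hsub ⟨t, ⟨ht.le, le_rfl⟩, rfl⟩) htJ) (not_le.2 (hlow t ht.le))
  refine ⟨e, he, hlu.trans hlw.symm, fun x hx => ?_⟩
  rw [hlu]
  rcases hx with hx | hx
  · have hcl : IsClosed {y | cross2 e C.v ≤ cross2 e y} :=
      isClosed_le continuous_const (continuous_cross2_right e)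
    exact hcl.closure_subset_iff.2 hcomp hx
  · exact (hseg x hx).ge

end Cut

/-- A vertex at which a linear functional is minimal on the polygon is convex. -/
theorem not_isReflex_of_minimal {R : SimplePolygon} {e : E2} (he : e ≠ 0) {k : ZMod R.n}
    (hmin : ∀ x ∈ R.region, cross2 e (R.vtx k) ≤ cross2 e x) : ¬ R.IsReflex k := by
  rintro ⟨ε₀, hε₀, hrefl⟩
  obtain ⟨m, hm⟩ := ZMod.intCast_surjective k
  set γ := R.param with hγ
  have hγm : γ m = R.vtx k := by rw [← hm]; exact boundaryPoint_int m
  obtain ⟨i, hi, hnb, -⟩ := γ.vtx_neighbours m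
  obtain rfl : i = k := R.inj (hi.symm.trans hγm)
  obtain ⟨ρ, d₁, d₂, q, hch, hd⟩ := γ.exists_chart m
  have hsum : γ.fwd m + γ.bwd m = d₁ + d₂ := by
    rcases hd with ⟨rfl, rfl⟩ | ⟨rfl, rfl⟩
    · rfl
    · exact add_comm _ _
  obtain ⟨δ, hδ, hball⟩ := exists_small_smul_mem_ball (γ m) (d₁ + d₂) hch.pos
  obtain ⟨ε, hε0, hε⟩ := exists_between (lt_min hε₀ hδ)
  have hmid := hrefl ε ⟨hε0, hε.trans_le (min_le_left _ _)⟩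
  rw [γ.midpoint_eq hi hnb, hsum] at hmid
  have hmb := hball (ε / 2) ⟨by linarith, by linarith [hε.trans_le (min_le_right _ _)]⟩
  have hdf : 0 ≤ cross2 e (γ.fwd m) := by
    have := hmin _ (boundary_subset_region (γ.mem_boundary (m + 1)))
    rw [γ.fwd_int, cross2_sub_right, hi]
    linarith
  have hdb : 0 ≤ cross2 e (γ.bwd m) := by
    have := hmin _ (boundary_subset_region (γ.mem_boundary (m - 1)))
    rw [γ.bwd_int, cross2_sub_right, hi]
    linarith
  have hnonneg : 0 ≤ cross2 e d₁ ∧ 0 ≤ cross2 e d₂ := by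
    rcases hd with ⟨rfl, rfl⟩ | ⟨rfl, rfl⟩
    · exact ⟨hdf, hdb⟩
    · exact ⟨hdb, hdf⟩
  rcases hch.wedge.nonneg.eq_or_lt with hc | hc
  · apply hmid
    apply boundary_subset_region
    rw [hch.mem_iff _ hmb]
    obtain ⟨c, hcd⟩ := exists_smul_of_cross2_eq_zero hch.wedge.ne_zero_left hc.symm
    rcases le_or_gt 0 (1 + c) with h | h
    · refine ⟨ε / 2 * (1 + c), by positivity, Or.inl ?_⟩
      rw [hcd]
      module
    · have hc0 : c < 0 := by linarith
      refine ⟨ε / 2 * ((1 + c) / c),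
        mul_nonneg (by linarith) (div_nonneg_of_nonpos h.le hc0.le), Or.inr ?_⟩
      rw [hcd, smul_smul, mul_assoc, div_mul_cancel₀ _ hc0.ne]
      module
  · have hsmall : γ m + (ε / 2) • (d₁ + d₂) ∈ smallSector (γ m) d₁ d₂ ∩ Metric.ball (γ m) ρ := by
      refine ⟨⟨?_, ?_⟩, hmb⟩
      · rw [add_sub_cancel_left, cross2_smul_right, cross2_add_right, cross2_self, zero_add]
        exact mul_pos (by linarith) hc
      · rw [add_sub_cancel_left, cross2_smul_left, cross2_add_left, cross2_self, add_zero]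
        exact mul_pos (by linarith) hc
    rcases γ.sector_dichotomy hch (hd.imp (·.1) (·.2)) with ⟨h, -⟩ | ⟨h, -⟩
    · exact hmid (h hsmall).1
    · obtain ⟨η₀, hη₀, hηball⟩ := exists_small_smul_mem_ball (γ m) (-(d₁ + d₂)) hch.pos
      have hη := hηball (η₀ / 2) ⟨by linarith, by linarith⟩
      have hin := h ⟨Or.inl (by
        rw [add_sub_cancel_left, cross2_smul_right, cross2_neg_right, cross2_add_right,
          cross2_self]
        nlinarith), hη⟩
      have hle := hmin _ hin.1
      rw [cross2_add_right, hi, cross2_smul_right, cross2_neg_right, cross2_add_right] at hle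
      have h1 : cross2 e d₁ = 0 := by nlinarith [hnonneg.1, hnonneg.2]
      have h2 : cross2 e d₂ = 0 := by nlinarith [hnonneg.1, hnonneg.2]
      obtain ⟨c₁, hc₁⟩ := exists_smul_of_cross2_eq_zero he h1
      obtain ⟨c₂, hc₂⟩ := exists_smul_of_cross2_eq_zero he h2
      rw [hc₁, hc₂, cross2_smul_left, cross2_smul_right, cross2_self] at hc
      simp at hc

end SimplePolygon

/-- For a nonredundant cut `C` of `P` with endpoints `v_C`, `w_C` and
generator `u_C v_C`, the points `u_C` and `w_C` are convex vertices of the polygon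
`Pocket(C)`, and all vertices of `Pocket(C)` lie on the same side of the line through
`u_C` and `w_C`. -/
theorem pocket_generator_endpoints_convex_and_same_side
    (P : SimplePolygon) (C : P.Cut) (hC : C.Nonredundant)
    (R : SimplePolygon) (hR : R.region = C.pocket) :
    (∀ k : ZMod R.n,
        (R.vtx k = C.u → ¬ R.IsReflex k) ∧ (R.vtx k = C.w → ¬ R.IsReflex k)) ∧
    ∃ f : E2 →ₗ[ℝ] ℝ, f ≠ 0 ∧ f C.u = f C.w ∧
      ∀ x : E2, C.PocketVertex x → f C.u ≤ f x := by
  obtain ⟨e, he, huw, hside⟩ := C.exists_side hC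
  refine ⟨fun k => ⟨fun hk => ?_, fun hk => ?_⟩,
    { toFun := cross2 e
      map_add' := cross2_add_right e
      map_smul' := fun t x => cross2_smul_right t e x }, fun h => ?_, huw, ?_⟩
  · exact SimplePolygon.not_isReflex_of_minimal he fun x hx => hk ▸ hside x (hR ▸ hx)
  · exact SimplePolygon.not_isReflex_of_minimal he fun x hx => hk ▸ huw ▸ hside x (hR ▸ hx)
  · have h1 : cross2 e (perp e) = 0 := LinearMap.congr_fun h (perp e)
    rw [cross2_perp] at h1
    exact (sq_add_sq_pos_of_ne_zero he).ne' h1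
  · rintro x (rfl | ⟨k, -, hx⟩)
    · exact huw.le
    · exact hside x hx
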